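/- arXiv:2406.17943 — 5 statements merged into one kernel-verified Lean document; each statement's English description precedes it below -/
import Mathlib

section
/- Let A be a graded artinian algebra, f a homogeneous form of degree s in A, B = A/(0:f) and C = A/(f), and let ℓ be a linear form. If for some degree i the multiplication maps ×ℓ: [B]_{i-s} → [B]_{i+1-s} and ×ℓ: [C]_i → [C]_{i+1} are both injective, then ×ℓ: [A]_i → [A]_{i+1} is injective. Similarly, if both maps are surjective, then ×ℓ: [A]_i → [A]_{i+1} is surjective. -/
open MvPolynomial

noncomputable section

variable {K : Type*} [Field K] {n : ℕ}

/-- The degree `i` graded piece of the standard graded algebra `R/I`,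
where `R = K[x_1,…,x_n]`. -/
def piece (I : Ideal (MvPolynomial (Fin n) K)) (i : ℕ) :
    Submodule K (MvPolynomial (Fin n) K ⧸ I) :=
  (homogeneousSubmodule (Fin n) K i).map (Ideal.Quotient.mkₐ K I).toLinearMap

/-- The Hilbert function of the standard graded algebra `R/I`. -/
def hf (I : Ideal (MvPolynomial (Fin n) K)) (i : ℕ) : ℕ :=
  Module.finrank K (piece I i)

/-- `I` is a homogeneous ideal. -/
def IsHomogIdeal (I : Ideal (MvPolynomial (Fin n) K)) : Prop :=
  ∀ p ∈ I, ∀ i : ℕ, homogeneousComponent i p ∈ I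

/-- The socle of `R/I`: the annihilator of the irrelevant maximal ideal. -/
def socle (I : Ideal (MvPolynomial (Fin n) K)) :
    Submodule K (MvPolynomial (Fin n) K ⧸ I) :=
  ⨅ j : Fin n, LinearMap.ker (LinearMap.mulLeft K (Ideal.Quotient.mk I (X j)))

/-- `R/I` is a standard graded artinian Gorenstein algebra of socle degree `d`:
`I` is homogeneous, the Hilbert function vanishes above degree `d`, is symmetric,
and the socle is one-dimensional, concentrated in degree `d`. -/
def IsArtinianGorenstein (I : Ideal (MvPolynomial (Fin n) K)) (d : ℕ) : Prop :=
  IsHomogIdeal I ∧ hf I d = 1 ∧ (∀ i : ℕ, d < i → hf I i = 0) ∧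
    (∀ i : ℕ, i ≤ d → hf I i = hf I (d - i)) ∧
    Module.finrank K (socle I) = 1 ∧ socle I ≤ piece I d

/-- The weak Lefschetz property for `R/I`: there is a linear form `ℓ` such that
multiplication `×ℓ : [A]_i → [A]_{i+1}` has maximal rank (is injective or
surjective) for every `i`. -/
def WLP (I : Ideal (MvPolynomial (Fin n) K)) : Prop :=
  ∃ ℓ : MvPolynomial (Fin n) K, ℓ.IsHomogeneous 1 ∧ ∀ i : ℕ,
    (∀ a ∈ piece I i, Ideal.Quotient.mk I ℓ * a = 0 → a = 0) ∨
    (∀ b ∈ piece I (i + 1), ∃ a ∈ piece I i, Ideal.Quotient.mk I ℓ * a = b)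

/-- The strong Lefschetz property for `R/I`: there is a linear form `ℓ` such that
`×ℓ^k : [A]_i → [A]_{i+k}` has maximal rank for all `i ≥ 0`, `k ≥ 1`. -/
def SLP (I : Ideal (MvPolynomial (Fin n) K)) : Prop :=
  ∃ ℓ : MvPolynomial (Fin n) K, ℓ.IsHomogeneous 1 ∧ ∀ i k : ℕ, 1 ≤ k →
    ((∀ a ∈ piece I i, Ideal.Quotient.mk I ℓ ^ k * a = 0 → a = 0) ∨
     (∀ b ∈ piece I (i + k), ∃ a ∈ piece I i, Ideal.Quotient.mk I ℓ ^ k * a = b))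

/-- The action of `p ∈ R = K[x_1,…,x_n]` on `S = K[X_1,…,X_n]` by differentiation,
`x_i` acting as `∂/∂X_i`. -/
def diffOp (p : MvPolynomial (Fin n) K) :
    Module.End K (MvPolynomial (Fin n) K) :=
  ∑ m ∈ p.support, MvPolynomial.coeff m p •
    (List.ofFn fun j : Fin n =>
      ((pderiv j).toLinearMap : Module.End K (MvPolynomial (Fin n) K)) ^ (m j)).prod

/-- The degree-`d` graded piece of the inverse system `I^⊥ = {F : g ∘ F = 0 ∀ g ∈ I}`. -/
def invSys (I : Ideal (MvPolynomial (Fin n) K)) (d : ℕ) :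
    Submodule K (MvPolynomial (Fin n) K) :=
  homogeneousSubmodule (Fin n) K d ⊓ ⨅ g ∈ I, LinearMap.ker (diffOp g)

end

theorem homogComp_mul_aux {K : Type*} [Field K] {n : ℕ}
    (c f : MvPolynomial (Fin n) K) (s t : ℕ) (hf : f.IsHomogeneous s) :
    homogeneousComponent (t + s) (c * f) = homogeneousComponent t c * f := by
  letI : GradedAlgebra (homogeneousSubmodule (Fin n) K) := MvPolynomial.gradedAlgebra
  have h := DirectSum.coe_decompose_mul_add_of_right_mem
    (homogeneousSubmodule (Fin n) K) (i := t) (j := s) (a := c) (b := f) hf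
  rw [← decomposition.decompose'_apply, ← decomposition.decompose'_apply]
  exact h

theorem exists_lift_aux {K : Type*} [Field K] {n : ℕ}
    (I : Ideal (MvPolynomial (Fin n) K)) (hI : IsHomogIdeal I)
    (s t : ℕ) (f p : MvPolynomial (Fin n) K) (hf : f.IsHomogeneous s)
    (hp : p.IsHomogeneous (t + s)) (hmem : p ∈ I ⊔ Ideal.span {f}) :
    ∃ g : MvPolynomial (Fin n) K, g.IsHomogeneous t ∧ p - g * f ∈ I := by
  obtain ⟨u, hu, v, hv, rfl⟩ := Submodule.mem_sup.1 hmem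
  obtain ⟨c, rfl⟩ := Ideal.mem_span_singleton'.1 hv
  refine ⟨homogeneousComponent t c, homogeneousComponent_isHomogeneous t c, ?_⟩
  have h1 : homogeneousComponent (t + s) (u + c * f) = u + c * f := by
    rw [homogeneousComponent_of_mem hp, if_pos rfl]
  have h2 := hI u hu (t + s)
  rw [map_add, homogComp_mul_aux c f s t hf] at h1
  rw [← h1, add_sub_cancel_right]
  exact h2

theorem mem_piece_aux {K : Type*} [Field K] {n : ℕ}
    (I : Ideal (MvPolynomial (Fin n) K)) (i : ℕ) (a : MvPolynomial (Fin n) K ⧸ I) :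
    a ∈ piece I i ↔ ∃ p : MvPolynomial (Fin n) K, p.IsHomogeneous i ∧
      Ideal.Quotient.mk I p = a := Iff.rfl

theorem mem_colon_aux {K : Type*} [Field K] {n : ℕ}
    (I : Ideal (MvPolynomial (Fin n) K)) (f g : MvPolynomial (Fin n) K) :
    g ∈ I.colon (Ideal.span {f}) ↔ g * f ∈ I := by
  rw [Submodule.mem_colon]
  constructor
  · intro h
    exact h f (Ideal.mem_span_singleton_self f)
  · intro h q hq
    obtain ⟨c, rfl⟩ := Ideal.mem_span_singleton'.1 hq
    have : g • (c * f) = c * (g * f) := by rw [smul_eq_mul]; ring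
    rw [this]
    exact I.mul_mem_left c h

/-- Snake-lemma consequence: with `B = A/(0:f)` and `C = A/(f)` for a form `f` of
degree `s` in the graded artinian algebra `A = R/I`, if multiplication by a linear
form `ℓ` on `[B]_t → [B]_{t+1}` and on `[C]_{t+s} → [C]_{t+s+1}` are both injective
(resp. both surjective), then so is `×ℓ : [A]_{t+s} → [A]_{t+s+1}`. -/
theorem snake_maximal_rank {K : Type*} [Field K] {n : ℕ}
    (I : Ideal (MvPolynomial (Fin n) K)) (hI : IsHomogIdeal I)
    (hart : FiniteDimensional K (MvPolynomial (Fin n) K ⧸ I))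
    (s : ℕ) (f : MvPolynomial (Fin n) K) (hfhom : f.IsHomogeneous s)
    (ℓ : MvPolynomial (Fin n) K) (hℓ : ℓ.IsHomogeneous 1) (t : ℕ) :
    ((∀ a ∈ piece (I.colon (Ideal.span {f})) t,
        Ideal.Quotient.mk (I.colon (Ideal.span {f})) ℓ * a = 0 → a = 0) →
      (∀ a ∈ piece (I ⊔ Ideal.span {f}) (t + s),
        Ideal.Quotient.mk (I ⊔ Ideal.span {f}) ℓ * a = 0 → a = 0) →
      (∀ a ∈ piece I (t + s), Ideal.Quotient.mk I ℓ * a = 0 → a = 0)) ∧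
    ((∀ b ∈ piece (I.colon (Ideal.span {f})) (t + 1),
        ∃ a ∈ piece (I.colon (Ideal.span {f})) t,
          Ideal.Quotient.mk (I.colon (Ideal.span {f})) ℓ * a = b) →
      (∀ b ∈ piece (I ⊔ Ideal.span {f}) (t + s + 1),
        ∃ a ∈ piece (I ⊔ Ideal.span {f}) (t + s),
          Ideal.Quotient.mk (I ⊔ Ideal.span {f}) ℓ * a = b) →
      (∀ b ∈ piece I (t + s + 1), ∃ a ∈ piece I (t + s),
          Ideal.Quotient.mk I ℓ * a = b)) := by
  constructor
  · intro hB hC a ha h0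
    obtain ⟨p, hp, rfl⟩ := (mem_piece_aux _ _ _).1 ha
    rw [← map_mul, Ideal.Quotient.eq_zero_iff_mem] at h0
    have h1 := hC _ ((mem_piece_aux _ _ _).2 ⟨p, hp, rfl⟩) (by
      rw [← map_mul, Ideal.Quotient.eq_zero_iff_mem]
      exact Ideal.mem_sup_left h0)
    rw [Ideal.Quotient.eq_zero_iff_mem] at h1
    obtain ⟨g, hg, hpg⟩ := exists_lift_aux I hI s t f p hfhom hp h1
    have h2 := hB _ ((mem_piece_aux _ _ _).2 ⟨g, hg, rfl⟩) (by
      rw [← map_mul, Ideal.Quotient.eq_zero_iff_mem, mem_colon_aux]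
      have : ℓ * g * f = ℓ * p - ℓ * (p - g * f) := by ring
      rw [this]
      exact I.sub_mem h0 (I.mul_mem_left ℓ hpg))
    rw [Ideal.Quotient.eq_zero_iff_mem, mem_colon_aux] at h2
    rw [Ideal.Quotient.eq_zero_iff_mem]
    have : p = (p - g * f) + g * f := by ring
    rw [this]
    exact I.add_mem hpg h2
  · intro hB hC b hb
    obtain ⟨p, hp, rfl⟩ := (mem_piece_aux _ _ _).1 hb
    obtain ⟨a, ha, h1⟩ := hC _ ((mem_piece_aux _ _ _).2 ⟨p, hp, rfl⟩)
    obtain ⟨q, hq, rfl⟩ := (mem_piece_aux _ _ _).1 ha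
    rw [← map_mul, Ideal.Quotient.mk_eq_mk_iff_sub_mem] at h1
    have hd : (ℓ * q - p).IsHomogeneous (t + 1 + s) := by
      have e : 1 + (t + s) = t + 1 + s := by ring
      have e' : t + s + 1 = t + 1 + s := by ring
      exact (e ▸ hℓ.mul hq).sub (e' ▸ hp)
    obtain ⟨g, hg, hpg⟩ := exists_lift_aux I hI s (t + 1) f _ hfhom hd h1
    obtain ⟨a', ha', h2⟩ := hB _ ((mem_piece_aux _ _ _).2 ⟨g, hg, rfl⟩)
    obtain ⟨h, hh, rfl⟩ := (mem_piece_aux _ _ _).1 ha'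
    rw [← map_mul, Ideal.Quotient.mk_eq_mk_iff_sub_mem, mem_colon_aux] at h2
    refine ⟨_, (mem_piece_aux _ _ _).2 ⟨q - h * f, hq.sub (hh.mul hfhom), rfl⟩, ?_⟩
    rw [← map_mul, Ideal.Quotient.mk_eq_mk_iff_sub_mem]
    have : ℓ * (q - h * f) - p = (ℓ * q - p - g * f) - (ℓ * h - g) * f := by ring
    rw [this]
    exact I.sub_mem hpg h2
end

section
/- Let A be a standard graded K-algebra with dim_K [A]_j ≤ 2j for some positive integer j. Then for a general linear form ℓ ∈ [A]_1, the quotient satisfies dim_K [A/ℓA]_j ≤ 1. -/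
open MvPolynomial

section Aux

open Submodule

/-- Rank-nullity for the restriction of a linear map to a subspace. -/
theorem aux_rank {K M N : Type*} [Field K] [AddCommGroup M] [Module K M] [AddCommGroup N]
    [Module K N] (f : M →ₗ[K] N) (C : Submodule K M) [FiniteDimensional K C] :
    Module.finrank K (C.map f) + Module.finrank K (C ⊓ LinearMap.ker f : Submodule K M) =
      Module.finrank K C := by
  have h := LinearMap.finrank_range_add_finrank_ker (f.domRestrict C)
  rw [LinearMap.range_domRestrict, LinearMap.ker_domRestrict] at h
  rw [← h, ← Submodule.map_comap_subtype C (LinearMap.ker f), Submodule.finrank_map_subtype_eq]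

theorem aux_sup {K M : Type*} [Field K] [AddCommGroup M] [Module K M]
    (A B V : Submodule K M) [FiniteDimensional K A] (hB : B ≤ A) :
    Module.finrank K (A.map (V ⊔ B).mkQ) + Module.finrank K (B.map V.mkQ) =
      Module.finrank K (A.map V.mkQ) := by
  have hle : V ≤ LinearMap.ker (V ⊔ B).mkQ := by rw [Submodule.ker_mkQ]; exact le_sup_left
  have h := aux_rank (V.liftQ (V ⊔ B).mkQ hle) (A.map V.mkQ)
  rw [← Submodule.map_comp, Submodule.liftQ_mkQ, Submodule.ker_liftQ, Submodule.ker_mkQ,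
    Submodule.map_sup, Submodule.mkQ_map_self, bot_sup_eq,
    inf_eq_right.mpr (Submodule.map_mono hB)] at h
  exact h

/-- Lower semicontinuity of the rank on a pencil of linear maps. -/
theorem aux_pencil {K M N : Type*} [Field K] [AddCommGroup M] [Module K M] [AddCommGroup N]
    [Module K N] [FiniteDimensional K M] (f g : M →ₗ[K] N) :
    {t : K | ¬ Module.finrank K (LinearMap.range f) ≤
      Module.finrank K (LinearMap.range (f + t • g))}.Finite := by
  obtain ⟨p, hp⟩ := LinearMap.exists_leftInverse_of_injective (LinearMap.range f).subtype
    (Submodule.ker_subtype _)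
  obtain ⟨s, hs⟩ := LinearMap.exists_rightInverse_of_surjective f.rangeRestrict
    (LinearMap.range_rangeRestrict f)
  set g' : Module.End K (LinearMap.range f) := p ∘ₗ g ∘ₗ s with hg'
  refine ((g'.finite_hasEigenvalue).image (fun m => -m⁻¹)).subset ?_
  intro t ht
  by_contra hcon
  apply ht
  have hfs : ∀ x, p (f (s x)) = x := by
    intro x
    have h1 := LinearMap.congr_fun hs x
    have h2 := LinearMap.congr_fun hp (f.rangeRestrict (s x))
    simp only [LinearMap.comp_apply, LinearMap.id_apply] at h1 h2
    rw [h1] at h2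
    have h3 : f (s x) = (x : N) := by
      exact congrArg Subtype.val h1
    rw [h3]; exact h2
  have hinj : Function.Injective (p ∘ₗ (f + t • g) ∘ₗ s) := by
    rw [injective_iff_map_eq_zero]
    intro x hx
    by_contra hx0
    simp only [LinearMap.comp_apply, LinearMap.add_apply, LinearMap.smul_apply, map_add, map_smul,
      hfs] at hx
    have ht0 : t ≠ 0 := by
      rintro rfl
      simp at hx
      exact hx0 hx
    apply hcon
    refine ⟨-t⁻¹, ?_, by simp⟩
    refine Module.End.hasEigenvalue_of_hasEigenvector (x := x) ⟨?_, hx0⟩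
    rw [Module.End.mem_eigenspace_iff]
    change p (g (s x)) = _
    have : t • p (g (s x)) = -x := by
      rw [eq_neg_iff_add_eq_zero, add_comm]; exact hx
    rw [neg_smul, ← smul_neg, ← this, smul_smul, inv_mul_cancel₀ ht0, one_smul]
  have hsurj := LinearMap.injective_iff_surjective.mp hinj
  have h1 : Submodule.map p (LinearMap.range (f + t • g)) = ⊤ := by
    rw [eq_top_iff]
    intro y _
    obtain ⟨x, hx⟩ := hsurj y
    exact ⟨_, ⟨s x, rfl⟩, hx⟩
  have h2 := Submodule.finrank_map_le p (LinearMap.range (f + t • g))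
  rw [h1, finrank_top] at h2
  exact h2

variable {K : Type*} [Field K] {n : ℕ}

/-- Dimension of the degree `j` part modulo a subspace `V`. -/
noncomputable def qdim (j : ℕ) (V : Submodule K (MvPolynomial (Fin n) K)) : ℕ :=
  Module.finrank K ((homogeneousSubmodule (Fin n) K j).map V.mkQ)

/-- The subspace `V + ℓ R_j`. -/
noncomputable def addl (V : Submodule K (MvPolynomial (Fin n) K)) (l : MvPolynomial (Fin n) K)
    (j : ℕ) : Submodule K (MvPolynomial (Fin n) K) :=
  V ⊔ (homogeneousSubmodule (Fin n) K j).map (LinearMap.mulLeft K l)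

/-- The subspace `V : ℓ`. -/
noncomputable def coll (V : Submodule K (MvPolynomial (Fin n) K)) (l : MvPolynomial (Fin n) K) :
    Submodule K (MvPolynomial (Fin n) K) :=
  V.comap (LinearMap.mulLeft K l)

instance aux_fd (j : ℕ) : FiniteDimensional K (homogeneousSubmodule (Fin n) K j) :=
  Module.Finite.iff_fg.mpr (homogeneousSubmodule_fg _ _ j)

theorem le_addl (V : Submodule K (MvPolynomial (Fin n) K)) (l : MvPolynomial (Fin n) K)
    (j : ℕ) : V ≤ addl V l j := le_sup_left

theorem qdim_anti (j : ℕ) {V W : Submodule K (MvPolynomial (Fin n) K)} (h : V ≤ W) :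
    qdim j W ≤ qdim j V := by
  have h1 := aux_rank V.mkQ (homogeneousSubmodule (Fin n) K j)
  have h2 := aux_rank W.mkQ (homogeneousSubmodule (Fin n) K j)
  rw [ker_mkQ] at h1 h2
  have h3 : Module.finrank K (homogeneousSubmodule (Fin n) K j ⊓ V : Submodule K _) ≤
      Module.finrank K (homogeneousSubmodule (Fin n) K j ⊓ W : Submodule K _) := by
    haveI : FiniteDimensional K (homogeneousSubmodule (Fin n) K j ⊓ W : Submodule K _) :=
      Submodule.finiteDimensional_inf_left _ _
    exact Submodule.finrank_mono (inf_le_inf_left _ h)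
  unfold qdim
  omega

/-- The map `R_j → R / V` given by multiplication with `ℓ`. -/
noncomputable def mulm (V : Submodule K (MvPolynomial (Fin n) K)) (l : MvPolynomial (Fin n) K)
    (j : ℕ) : homogeneousSubmodule (Fin n) K j →ₗ[K] (MvPolynomial (Fin n) K ⧸ V) :=
  (V.mkQ ∘ₗ LinearMap.mulLeft K l).domRestrict _

theorem map_mul_le {l : MvPolynomial (Fin n) K} (hl : l.IsHomogeneous 1) (j : ℕ) :
    (homogeneousSubmodule (Fin n) K j).map (LinearMap.mulLeft K l) ≤
      homogeneousSubmodule (Fin n) K (j + 1) := by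
  rintro _ ⟨p, hp, rfl⟩
  have := hl.mul ((mem_homogeneousSubmodule j p).mp hp)
  rw [add_comm] at this
  exact this

theorem qdim_rank (V : Submodule K (MvPolynomial (Fin n) K)) {l : MvPolynomial (Fin n) K}
    (hl : l.IsHomogeneous 1) (j : ℕ) :
    qdim (j + 1) (addl V l j) + Module.finrank K (LinearMap.range (mulm V l j)) =
      qdim (j + 1) V := by
  have h := aux_sup (homogeneousSubmodule (Fin n) K (j + 1)) _ V (map_mul_le hl j)
  rw [← Submodule.map_comp] at h
  rw [mulm, LinearMap.range_domRestrict]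
  exact h

theorem rank_coll (V : Submodule K (MvPolynomial (Fin n) K)) (l : MvPolynomial (Fin n) K)
    (j : ℕ) : Module.finrank K (LinearMap.range (mulm V l j)) = qdim j (coll V l) := by
  have h1 := aux_rank (V.mkQ ∘ₗ LinearMap.mulLeft K l) (homogeneousSubmodule (Fin n) K j)
  have h2 := aux_rank (coll V l).mkQ (homogeneousSubmodule (Fin n) K j)
  rw [LinearMap.ker_comp, ker_mkQ] at h1
  rw [ker_mkQ] at h2
  rw [mulm, LinearMap.range_domRestrict, qdim]
  unfold coll at *
  omega

theorem qdim_eq (V : Submodule K (MvPolynomial (Fin n) K)) {l : MvPolynomial (Fin n) K}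
    (hl : l.IsHomogeneous 1) (j : ℕ) :
    qdim (j + 1) (addl V l j) + qdim j (coll V l) = qdim (j + 1) V := by
  rw [← rank_coll, qdim_rank V hl]

theorem qdim_ineq (V : Submodule K (MvPolynomial (Fin n) K)) {l l' : MvPolynomial (Fin n) K}
    (hl : l.IsHomogeneous 1) (hl' : l'.IsHomogeneous 1) (j : ℕ) :
    qdim (j + 1 + 1) (addl V l' (j + 1)) ≤
      qdim (j + 1 + 1) (addl (addl V l (j + 1)) l' (j + 1)) +
        qdim (j + 1) (addl (coll V l) l' j) := by
  rw [← qdim_eq (addl V l' (j + 1)) hl (j + 1)]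
  have h1 : addl (addl V l' (j + 1)) l (j + 1) = addl (addl V l (j + 1)) l' (j + 1) := by
    unfold addl; exact sup_right_comm _ _ _
  rw [h1]
  refine Nat.add_le_add_left (qdim_anti _ ?_) _
  unfold addl coll
  refine sup_le (Submodule.comap_mono le_sup_left) ?_
  rintro _ ⟨p, hp, rfl⟩
  refine Submodule.mem_sup_right ⟨l * p, map_mul_le hl j ⟨p, hp, rfl⟩, ?_⟩
  simp only [LinearMap.mulLeft_apply]
  ring

theorem common [Infinite K] (U W : Submodule K (MvPolynomial (Fin n) K)) (a b : ℕ)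
    {l m : MvPolynomial (Fin n) K} (hl : l.IsHomogeneous 1) (hm : m.IsHomogeneous 1) :
    ∃ e : MvPolynomial (Fin n) K, e.IsHomogeneous 1 ∧
      qdim (a + 1) (addl U e a) ≤ qdim (a + 1) (addl U l a) ∧
      qdim (b + 1) (addl W e b) ≤ qdim (b + 1) (addl W m b) := by
  have hadd : ∀ (V : Submodule K (MvPolynomial (Fin n) K)) (c : ℕ)
      (x y : MvPolynomial (Fin n) K) (t : K), mulm V (x + t • y) c = mulm V x c + t • mulm V y c := by
    intro V c x y t
    ext p
    simp [mulm, add_mul]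
  have h1 := aux_pencil (mulm U l a) (mulm U m a)
  have h2 := aux_pencil (mulm W m b) (mulm W l b)
  obtain ⟨t, ht⟩ := ((h1.union (h2.image (fun s => s⁻¹))).union (Set.finite_singleton (0 : K))).exists_notMem
  simp only [Set.mem_union, not_or, Set.mem_singleton_iff] at ht
  obtain ⟨⟨ht1, ht2⟩, ht0⟩ := ht
  have ht1' := not_not.mp ht1
  have ht2' : Module.finrank K (LinearMap.range (mulm W m b)) ≤
      Module.finrank K (LinearMap.range (mulm W m b + t⁻¹ • mulm W l b)) := by
    by_contra hc
    exact ht2 ⟨t⁻¹, hc, inv_inv t⟩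
  have he : (l + t • m).IsHomogeneous 1 :=
    (homogeneousSubmodule (Fin n) K 1).add_mem hl ((homogeneousSubmodule (Fin n) K 1).smul_mem t hm)
  refine ⟨l + t • m, he, ?_, ?_⟩
  · have e1 := qdim_rank U hl a
    have e2 := qdim_rank U he a
    rw [hadd] at e2
    omega
  · have e1 := qdim_rank W hm b
    have e2 := qdim_rank W he b
    have e3 : mulm W (l + t • m) b = t • (mulm W m b + t⁻¹ • mulm W l b) := by
      rw [hadd, smul_add, smul_smul, mul_inv_cancel₀ ht0, one_smul, add_comm]
    rw [e3, LinearMap.range_smul _ _ ht0] at e2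
    omega

theorem exists_drop (V : Submodule K (MvPolynomial (Fin n) K)) (j : ℕ)
    (h : 0 < qdim (j + 1) V) :
    ∃ l : MvPolynomial (Fin n) K, l.IsHomogeneous 1 ∧
      qdim (j + 1) (addl V l j) < qdim (j + 1) V := by
  by_contra! hcon
  have key : homogeneousSubmodule (Fin n) K (j + 1) ≤ V := by
    rw [← homogeneousSubmodule_one_pow, pow_succ', homogeneousSubmodule_one_pow,
      Submodule.mul_le]
    intro l hl p hp
    have h1 := hcon l hl
    have h2 := qdim_rank V (l := l) hl j
    have h3 : Module.finrank K (LinearMap.range (mulm V l j)) = 0 := by omega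
    rw [Submodule.finrank_eq_zero, LinearMap.range_eq_bot] at h3
    have h4 := LinearMap.congr_fun h3 ⟨p, hp⟩
    simpa [mulm] using h4
  have : qdim (j + 1) V = 0 := by
    unfold qdim
    rw [Submodule.finrank_eq_zero, ← le_bot_iff, Submodule.map_le_iff_le_comap]
    simpa using key
  omega

theorem greenQ [Infinite K] (j : ℕ) : ∀ (N : ℕ) (V : Submodule K (MvPolynomial (Fin n) K)),
    qdim (j + 1) V = N → N ≤ j + 1 →
    ∃ l : MvPolynomial (Fin n) K, l.IsHomogeneous 1 ∧ qdim (j + 1) (addl V l j) = 0 := by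
  induction j with
  | zero =>
    intro N V hN hle
    rcases Nat.eq_zero_or_pos N with h0 | h0
    · refine ⟨0, isHomogeneous_zero _ _ _, ?_⟩
      have := qdim_anti (0 + 1) (le_addl V 0 0)
      omega
    · obtain ⟨l, hl, hlt⟩ := exists_drop V 0 (by omega)
      exact ⟨l, hl, by omega⟩
  | succ j ihj =>
    intro N
    induction N using Nat.strong_induction_on with
    | _ N ih =>
    intro V hN hle
    rcases Nat.eq_zero_or_pos N with h0 | h0
    · refine ⟨0, isHomogeneous_zero _ _ _, ?_⟩
      have := qdim_anti (j + 1 + 1) (le_addl V 0 (j + 1))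
      omega
    · obtain ⟨l, hl, hlt⟩ := exists_drop V (j + 1) (by omega)
      have heq := qdim_eq V hl (j + 1)
      by_cases hz : qdim (j + 1 + 1) (addl V l (j + 1)) = 0
      · exact ⟨l, hl, hz⟩
      obtain ⟨l1, hl1, h1⟩ := ihj _ (coll V l) rfl (by omega)
      obtain ⟨l2, hl2, h2⟩ := ih _ (by omega) (addl V l (j + 1)) rfl (by omega)
      obtain ⟨e, he, he1, he2⟩ := common (coll V l) (addl V l (j + 1)) j (j + 1) hl1 hl2
      have := qdim_ineq V hl he j
      exact ⟨e, he, by rw [h1] at he1; rw [h2] at he2; omega⟩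

theorem greenP [Infinite K] (j : ℕ) : ∀ (N : ℕ) (V : Submodule K (MvPolynomial (Fin n) K)),
    qdim (j + 1) V = N → N ≤ 2 * (j + 1) →
    ∃ l : MvPolynomial (Fin n) K, l.IsHomogeneous 1 ∧ qdim (j + 1) (addl V l j) ≤ 1 := by
  induction j with
  | zero =>
    intro N V hN hle
    rcases Nat.eq_zero_or_pos N with h0 | h0
    · refine ⟨0, isHomogeneous_zero _ _ _, ?_⟩
      have := qdim_anti (0 + 1) (le_addl V 0 0)
      omega
    · obtain ⟨l, hl, hlt⟩ := exists_drop V 0 (by omega)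
      exact ⟨l, hl, by omega⟩
  | succ j ihj =>
    intro N
    induction N using Nat.strong_induction_on with
    | _ N ih =>
    intro V hN hle
    by_contra! hcon
    have h0 : 0 < qdim (j + 1 + 1) V := by
      have := qdim_anti (j + 1 + 1) (le_addl V 0 (j + 1))
      have := hcon 0 (isHomogeneous_zero _ _ _)
      omega
    obtain ⟨l, hl, hlt⟩ := exists_drop V (j + 1) h0
    -- first step: some form reaches dimension at most two
    obtain ⟨e, he, he2⟩ : ∃ e : MvPolynomial (Fin n) K, e.IsHomogeneous 1 ∧
        qdim (j + 1 + 1) (addl V e (j + 1)) ≤ 2 := by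
      have heq := qdim_eq V hl (j + 1)
      have hc := hcon l hl
      obtain ⟨l1, hl1, h1⟩ := ihj _ (coll V l) rfl (by omega)
      obtain ⟨l2, hl2, h2⟩ := ih _ (by omega) (addl V l (j + 1)) rfl (by omega)
      obtain ⟨e, he, he1, he2⟩ := common (coll V l) (addl V l (j + 1)) j (j + 1) hl1 hl2
      have := qdim_ineq V hl he j
      exact ⟨e, he, this.trans (by omega)⟩
    -- second step: use this form
    have heq := qdim_eq V he (j + 1)
    have hc := hcon e he
    obtain ⟨l1, hl1, h1⟩ := ihj _ (coll V e) rfl (by omega)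
    obtain ⟨l2, hl2, h2⟩ := greenQ (j + 1) _ (addl V e (j + 1)) rfl (by omega)
    obtain ⟨e', he', he1', he2'⟩ := common (coll V e) (addl V e (j + 1)) j (j + 1) hl1 hl2
    have h3 := qdim_ineq V he he' j
    have h4 := hcon e' he'
    have h5 : qdim (j + 1 + 1) (addl V e' (j + 1)) ≤ 1 := h3.trans (by omega)
    exact absurd h5 (not_le.mpr h4)

theorem hf_eq_qdim (I : Ideal (MvPolynomial (Fin n) K)) (j : ℕ) :
    hf I j = qdim j (I.restrictScalars K) := by
  unfold hf piece qdim
  have h1 := aux_rank (Ideal.Quotient.mkₐ K I).toLinearMap (homogeneousSubmodule (Fin n) K j)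
  have h2 := aux_rank (I.restrictScalars K).mkQ (homogeneousSubmodule (Fin n) K j)
  have h3 : LinearMap.ker (Ideal.Quotient.mkₐ K I).toLinearMap = I.restrictScalars K := by
    ext x
    simp [Ideal.Quotient.eq_zero_iff_mem]
  rw [h3] at h1
  rw [ker_mkQ] at h2
  omega

end Aux

/-- If `A` is a standard graded `K`-algebra with `dim_K [A]_j ≤ 2j` for a positive
integer `j`, then for a general linear form `ℓ` we have `dim_K [A/ℓA]_j ≤ 1`. -/
theorem dim_quotient_le_one {K : Type*} [Field K] [IsAlgClosed K] [CharZero K] {n : ℕ}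
    (I : Ideal (MvPolynomial (Fin n) K)) (hI : IsHomogIdeal I)
    (j : ℕ) (hj : 0 < j) (hdim : hf I j ≤ 2 * j) :
    ∃ ℓ : MvPolynomial (Fin n) K, ℓ.IsHomogeneous 1 ∧
      hf (I ⊔ Ideal.span {ℓ}) j ≤ 1 := by
  haveI : Infinite K := inferInstance
  obtain ⟨i, rfl⟩ : ∃ i, j = i + 1 := ⟨j - 1, by omega⟩
  rw [hf_eq_qdim] at hdim
  obtain ⟨l, hl, h⟩ := greenP i _ (I.restrictScalars K) rfl hdim
  refine ⟨l, hl, ?_⟩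
  rw [hf_eq_qdim]
  refine le_trans (qdim_anti _ ?_) h
  unfold addl
  refine sup_le ?_ ?_
  · intro x hx
    exact (le_sup_left : I ≤ I ⊔ Ideal.span {l}) hx
  · rintro _ ⟨p, -, rfl⟩
    exact (le_sup_right : Ideal.span {l} ≤ I ⊔ Ideal.span {l})
      (Ideal.mul_mem_right p _ (Ideal.mem_span_singleton_self l))
end

section
/- Any artinian Gorenstein algebra A = R/I over a field of characteristic zero with h-vector (1,4,k,k,4,1) (socle degree 5, codimension 4) has the weak Lefschetz property if and only if it has the strong Lefschetz property. -/
open MvPolynomial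

lemma abs_natmul {R S : Type*} [CommRing R] [IsDomain R] [CharZero R] [CommRing S] [Algebra R S]
    (tf : ∀ (r : R) (z : S), r • z = 0 → r = 0 ∨ z = 0) (n : ℕ) (hn : n ≠ 0) (z : S)
    (h : (n : S) * z = 0) : z = 0 := by
  have : (n : R) • z = 0 := by rw [Algebra.smul_def, map_natCast, h]
  rcases tf _ _ this with h | h
  · exact absurd (by exact_mod_cast h) hn
  · exact h

set_option maxHeartbeats 1000000 in
lemma abs_main {R S : Type*} [CommRing R] [IsDomain R] [CharZero R] [CommRing S] [Algebra R S]
    (tf : ∀ (r : R) (z : S), r • z = 0 → r = 0 ∨ z = 0)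
    (x : Fin 4 → S) (V : Submodule R S) (hV : V = Submodule.span R (Set.range x))
    (L : S) (hL : L ∈ V)
    (der : ∀ u ∈ V, ∃ D : Derivation ℤ S S, D L = u ∧ (∀ v ∈ V, D v ∈ V) ∧
      ∀ r : R, ∃ r' : R, D (algebraMap R S r) = algebraMap R S r')
    (soc : ∀ j ≤ 4, ∀ z ∈ V ^ j, (∀ u ∈ V, u * z = 0) → z = 0)
    (wlp : ∀ z ∈ V ^ 2, L * z = 0 → z = 0)
    (L5 : L ^ 5 ≠ 0)
    (a : S) (ha : a ∈ V) (ha0 : a ≠ 0) (hLa : L ^ 3 * a = 0) : False := by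
  have nat := abs_natmul tf
  choose! D hDL hDV hDR using der
  -- membership in powers
  have m2 : ∀ u ∈ V, ∀ v ∈ V, u * v ∈ V ^ 2 := fun u hu v hv => by
    rw [pow_two]; exact Submodule.mul_mem_mul hu hv
  have m3 : ∀ u ∈ V, ∀ v ∈ V, ∀ w ∈ V, u * v * w ∈ V ^ 3 := fun u hu v hv w hw => by
    rw [pow_succ]; exact Submodule.mul_mem_mul (m2 u hu v hv) hw
  have m4 : ∀ u ∈ V, ∀ v ∈ V, ∀ w ∈ V, ∀ y ∈ V, u * v * w * y ∈ V ^ 4 :=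
    fun u hu v hv w hw y hy => by
      rw [pow_succ]; exact Submodule.mul_mem_mul (m3 u hu v hv w hw) hy
  -- any five vectors are dependent
  have dep : ∀ v : Fin 5 → S, (∀ i, v i ∈ V) →
      ∃ g : Fin 5 → R, ∑ i, g i • v i = 0 ∧ ∃ i, g i ≠ 0 := by
    intro v hv
    by_contra hcon
    have hli : LinearIndependent R v := by
      rw [Fintype.linearIndependent_iff]
      intro g hg i
      by_contra hi
      exact hcon ⟨g, hg, i, hi⟩
    have : Fintype (Set.range x) := Fintype.ofFinite _
    have := linearIndependent_le_span' v hli (Set.range x) (by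
      rintro _ ⟨i, rfl⟩; have := hv i; rw [hV] at this; exact this)
    have h4 : (Set.range x).ncard ≤ 4 := by
      have h := Set.ncard_image_le (f := x) (s := Set.univ) Set.finite_univ
      rw [Set.image_univ, Set.ncard_univ] at h
      simpa using h
    have h5 : 5 ≤ (Set.range x).ncard := by simpa using this
    omega
  let T : S → S := fun u => D u a
  have hT : ∀ u ∈ V, T u ∈ V := fun u hu => hDV u hu a ha
  have R1 : ∀ u ∈ V, 3 * L ^ 2 * u * a + L ^ 3 * T u = 0 := by
    intro u hu
    have := congrArg (D u) hLa
    simp only [Derivation.leibniz, Derivation.leibniz_pow, map_zero, hDL u hu, smul_eq_mul,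
      nsmul_eq_mul] at this
    push_cast at this
    linear_combination this
  have q2 : L ^ 2 * a ^ 2 = 0 := by
    refine soc 4 le_rfl _ ?_ ?_
    · have := m4 L hL L hL a ha a ha
      convert this using 1; ring
    · intro u hu
      refine nat 3 (by norm_num) _ ?_
      push_cast
      linear_combination a * R1 u hu - T u * hLa
  have R2 : ∀ u ∈ V, L * u * a ^ 2 + L ^ 2 * a * T u = 0 := by
    intro u hu
    have := congrArg (D u) q2
    simp only [Derivation.leibniz, Derivation.leibniz_pow, map_zero, hDL u hu, smul_eq_mul,
      nsmul_eq_mul] at this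
    push_cast at this
    refine nat 2 (by norm_num) _ ?_
    push_cast
    linear_combination this
  have q3 : L * a ^ 3 = 0 := by
    refine soc 4 le_rfl _ ?_ ?_
    · have := m4 L hL a ha a ha a ha
      convert this using 1; ring
    · intro u hu
      linear_combination a * R2 u hu - T u * q2
  have R3 : ∀ u ∈ V, u * a ^ 3 + 3 * L * a ^ 2 * T u = 0 := by
    intro u hu
    have := congrArg (D u) q3
    simp only [Derivation.leibniz, Derivation.leibniz_pow, map_zero, hDL u hu, smul_eq_mul,
      nsmul_eq_mul] at this
    push_cast at this
    linear_combination this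
  have q4 : a ^ 4 = 0 := by
    refine soc 4 le_rfl _ ?_ ?_
    · have := m4 a ha a ha a ha a ha
      convert this using 1; ring
    · intro u hu
      linear_combination a * R3 u hu - 3 * T u * q3
  have R4 : ∀ u ∈ V, a ^ 3 * T u = 0 := by
    intro u hu
    have := congrArg (D u) q4
    simp only [Derivation.leibniz_pow, map_zero, smul_eq_mul,
      nsmul_eq_mul] at this
    push_cast at this
    refine nat 4 (by norm_num) _ ?_
    push_cast
    linear_combination this
  -- self-adjointness
  have sa : ∀ u ∈ V, ∀ v ∈ V, L ^ 3 * T u * v = L ^ 3 * u * T v := by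
    intro u hu v hv
    linear_combination v * R1 u hu - u * R1 v hv
  have TL : L ^ 3 * T L = 0 := by
    linear_combination R1 L hL - 3 * hLa
  have T4 : ∀ u ∈ V, L ^ 3 * T (T (T (T u))) = 0 := by
    intro u hu
    have h1 := hT u hu
    have h2 := hT _ h1
    have h3 := hT _ h2
    linear_combination R1 _ h3 - 3 * R2 _ h2 + R3 _ h1 - R4 _ hu
  -- T² = 0 modulo the kernel
  have T2aux : ∀ u ∈ V, L ^ 3 * T (T (T u)) = 0 → ∀ v ∈ V, L ^ 3 * T (T u) * v = 0 := by
    intro u hu h3 v hv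
    by_contra hne
    have h1 := hT u hu
    have h2 := hT _ h1
    obtain ⟨g, hg, i, hi⟩ := dep ![L, u, T u, T (T u), a] (by
      intro i; fin_cases i <;> simp [hL, hu, h1, h2, ha])
    simp only [Fin.sum_univ_five, Matrix.cons_val, Algebra.smul_def] at hg
    obtain ⟨c, hc⟩ : ∃ c : R → S, c = algebraMap R S := ⟨_, rfl⟩
    rw [← hc] at hg
    have hz : c 0 = 0 := hc ▸ map_zero _
    have tf' : ∀ (r : R) (z : S), c r * z = 0 → z ≠ 0 → r = 0 := by
      intro r z h hz
      rw [hc, ← Algebra.smul_def] at h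
      exact (tf r z h).resolve_right hz
    have hv1 := hT v hv
    have hv2 := hT _ hv1
    have L1 : ∀ w ∈ V, L ^ 3 * L * T w = 0 := by
      intro w hw; linear_combination w * TL - sa L hL w hw
    have g1 : g 1 = 0 := by
      refine tf' _ _ ?_ hne
      linear_combination L ^ 3 * T (T v) * hg - c (g 0) * L1 _ hv1
        + c (g 1) * (sa _ h1 _ hv + sa _ hu _ hv1)
        + c (g 2) * (sa _ h1 _ hv1 + sa _ h2 _ hv) - c (g 2) * v * h3
        + c (g 3) * (sa _ h2 _ hv1) - c (g 3) * T v * h3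
        - c (g 4) * T (T v) * hLa
    have g2 : g 2 = 0 := by
      refine tf' _ _ ?_ hne
      rw [g1, hz] at hg
      linear_combination L ^ 3 * T v * hg - c (g 0) * L1 _ hv
        + c (g 2) * (sa _ h1 _ hv)
        + c (g 3) * (sa _ h2 _ hv) - c (g 3) * v * h3
        - c (g 4) * T v * hLa
    have g0 : g 0 = 0 := by
      refine tf' _ _ ?_ L5
      rw [g1, g2, hz] at hg
      linear_combination L ^ 3 * L * hg - c (g 3) * L1 _ h1 - c (g 4) * L * hLa
    rw [g1, g2, g0, hz] at hg
    have g3 : g 3 = 0 := by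
      refine tf' _ _ ?_ hne
      linear_combination L ^ 3 * v * hg - c (g 4) * v * hLa
    rw [g3, hz] at hg
    have g4 : g 4 = 0 := by
      refine tf' _ _ ?_ ha0
      linear_combination hg
    fin_cases i <;> first | exact hi g0 | exact hi g1 | exact hi g2 | exact hi g3 | exact hi g4
  have T3 : ∀ u ∈ V, L ^ 3 * T (T (T u)) = 0 := by
    intro u hu
    refine soc 4 le_rfl _ ?_ ?_
    · have := m4 L hL L hL L hL _ (hT _ (hT _ (hT u hu)))
      convert this using 1; ring
    · intro v hv
      have := T2aux (T u) (hT u hu) (T4 u hu) v hv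
      linear_combination this
  have p1 : L * a ^ 2 = 0 := by
    refine soc 3 (by norm_num) _ ?_ ?_
    · have := m3 L hL a ha a ha
      convert this using 1; ring
    · intro u hu
      refine soc 4 le_rfl _ ?_ ?_
      · have := m4 u hu L hL a ha a ha
        convert this using 1; ring
      · intro v hv
        refine nat 3 (by norm_num) _ ?_
        push_cast
        linear_combination T2aux u hu (T3 u hu) v hv + 3 * v * R2 u hu - v * R1 _ (hT u hu)
  have aa : a ^ 2 = 0 := by
    refine wlp _ ?_ p1
    have := m2 a ha a ha
    convert this using 1; ring
  -- choose m
  obtain ⟨m, hm, hC⟩ : ∃ m ∈ V, L ^ 2 * a * m ^ 2 ≠ 0 := by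
    by_contra hcon
    push Not at hcon
    have hz : L ^ 2 * a = 0 := by
      refine soc 3 (by norm_num) _ ?_ ?_
      · have := m3 L hL L hL a ha
        convert this using 1; ring
      · intro u hu
        refine soc 4 le_rfl _ ?_ ?_
        · have := m4 u hu L hL L hL a ha
          convert this using 1; ring
        · intro v hv
          refine nat 2 (by norm_num) _ ?_
          push_cast
          linear_combination hcon _ (V.add_mem hu hv) - hcon u hu - hcon v hv
    have hz1 : L * a = 0 := by
      refine wlp _ (m2 _ hL _ ha) ?_
      linear_combination hz
    apply ha0
    refine soc 1 (by norm_num) _ (by simpa using ha) ?_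
    intro u hu
    refine wlp _ (m2 _ hu _ ha) ?_
    linear_combination u * hz1
  set δ := D m with hδ
  have δL : δ L = m := hDL m hm
  obtain ⟨b, hb⟩ : ∃ b, b = δ a := ⟨_, rfl⟩
  obtain ⟨e, he⟩ : ∃ e, e = δ b := ⟨_, rfl⟩
  obtain ⟨f, hf⟩ : ∃ f, f = δ e := ⟨_, rfl⟩
  have bV : b ∈ V := hb ▸ hDV m hm a ha
  have eV : e ∈ V := he ▸ hDV m hm b bV
  have ab : a * b = 0 := by
    have := congrArg δ aa
    simp only [Derivation.leibniz_pow, map_zero, smul_eq_mul, nsmul_eq_mul, ← hb] at this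
    push_cast at this
    refine nat 2 (by norm_num) _ ?_
    push_cast
    linear_combination this
  have bb : b ^ 2 + a * e = 0 := by
    have := congrArg δ ab
    simp only [Derivation.leibniz, map_zero, smul_eq_mul, ← hb, ← he] at this
    linear_combination this
  have be : 3 * b * e + a * f = 0 := by
    have := congrArg δ bb
    simp only [Derivation.leibniz, Derivation.leibniz_pow, map_add, map_zero, smul_eq_mul,
      nsmul_eq_mul, ← hb, ← he, ← hf] at this
    push_cast at this
    linear_combination this
  have E1 : 3 * L ^ 2 * m * a + L ^ 3 * b = 0 := by rw [hb]; exact R1 m hm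
  have E2 : 6 * L * m ^ 2 * a + 3 * L ^ 2 * δ m * a + 6 * L ^ 2 * m * b + L ^ 3 * e = 0 := by
    have h3 : δ 3 = 0 := by
      have := Derivation.map_natCast δ 3
      exact_mod_cast this
    have := congrArg δ E1
    simp only [Derivation.leibniz, Derivation.leibniz_pow, map_add, map_zero, smul_eq_mul,
      nsmul_eq_mul, ← hb, ← he, δL, h3] at this
    push_cast at this
    linear_combination this
  have b2 : L ^ 2 * m * b ^ 2 = 0 := by
    refine nat 9 (by norm_num) _ ?_
    push_cast
    linear_combination b * E2 - e * E1 + 3 * L ^ 2 * m * bb - (6 * L * m ^ 2 + 3 * L ^ 2 * δ m) * ab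
  have Ce : L ^ 2 * a * e * m = 0 := by
    linear_combination L ^ 2 * m * bb - b2
  have L4e : 4 * L ^ 3 * m * b + L ^ 4 * e = 0 := by
    have h : L ^ 4 * b = 0 := by linear_combination L * E1 - 3 * m * hLa
    have := congrArg δ h
    simp only [Derivation.leibniz, Derivation.leibniz_pow, map_zero, smul_eq_mul,
      nsmul_eq_mul, ← he, δL] at this
    push_cast at this
    linear_combination this
  obtain ⟨g, hg, i, hi⟩ := dep ![L, a, b, m, e] (by
      intro i; fin_cases i <;> simp [hL, ha, bV, hm, eV])
  simp only [Fin.sum_univ_five, Matrix.cons_val, Algebra.smul_def] at hg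
  obtain ⟨c, hc⟩ : ∃ c : R → S, c = algebraMap R S := ⟨_, rfl⟩
  have hz : c 0 = 0 := hc ▸ map_zero _
  have tf' : ∀ (r : R) (z : S), c r * z = 0 → z ≠ 0 → r = 0 := by
    intro r z h hz
    rw [hc, ← Algebra.smul_def] at h
    exact (tf r z h).resolve_right hz
  have cd : ∀ r, ∃ r', δ (c r) = c r' := by
    intro r; rw [hc]; exact hDR m hm r
  rw [← hc] at hg
  have g3 : g 3 = 0 := by
    refine tf' _ _ ?_ hC
    linear_combination L ^ 2 * a * m * hg - c (g 0) * m * hLa - c (g 1) * L ^ 2 * m * aa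
      - c (g 2) * L ^ 2 * m * ab - c (g 4) * Ce
  rw [g3, hz] at hg
  obtain ⟨r0, h0⟩ := cd (g 0)
  obtain ⟨r1, h1⟩ := cd (g 1)
  obtain ⟨r2, h2⟩ := cd (g 2)
  obtain ⟨r4, h4⟩ := cd (g 4)
  have hg' := congrArg δ hg
  simp only [Derivation.leibniz, map_add, map_zero, smul_eq_mul, ← hb, ← he, ← hf, δL,
    h0, h1, h2, h4] at hg'
  have g0 : g 0 = 0 := by
    refine tf' _ _ ?_ hC
    refine nat 8 (by norm_num) _ ?_
    push_cast
    have k1 : c (g 4) * (L ^ 2 * b * e * m) = 3 * c (g 0) * (L ^ 2 * a * m ^ 2) := by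
      linear_combination L ^ 2 * b * m * hg - c (g 0) * m * E1
        - c (g 1) * L ^ 2 * m * ab - c (g 2) * b2
    have k2 : c (g 4) * (L ^ 2 * a * f * m) = - c (g 0) * (L ^ 2 * a * m ^ 2) := by
      linear_combination L ^ 2 * a * m * hg' - c r0 * m * hLa - c r1 * L^2*m*aa - c (g 1) * L^2*m*ab - c r2 * L^2*m*ab - c (g 2) * Ce - c r4 * Ce
    linear_combination c (g 4) * L ^ 2 * m * be - 3 * k1 - k2
  rw [g0, hz] at hg
  have L4b : L ^ 4 * b = 0 := by linear_combination L * E1 - 3 * m * hLa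
  have g4 : g 4 = 0 := by
    refine tf' _ _ ?_ hC
    refine nat 12 (by norm_num) _ ?_
    push_cast
    linear_combination L ^ 4 * hg - c (g 1) * L * hLa - c (g 2) * L4b - c (g 4) * L4e
      + 4 * c (g 4) * m * E1
  rw [g4, hz] at hg
  have g2 : g 2 = 0 := by
    refine tf' _ _ ?_ hC
    refine nat 3 (by norm_num) _ ?_
    push_cast
    linear_combination c (g 2) * m * E1 - L ^ 3 * m * hg + c (g 1) * m * hLa
  rw [g2, hz] at hg
  have g1 : g 1 = 0 := by
    refine tf' _ _ ?_ ha0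
    linear_combination hg
  fin_cases i <;> first | exact hi g0 | exact hi g1 | exact hi g2 | exact hi g3 | exact hi g4

section Mid

open MvPolynomial

variable {K A : Type*} [Field K] [CommRing A] [Algebra K A]

/-- apply a linear functional coefficientwise -/
noncomputable def lamMap (w : A →ₗ[K] K) (z : MvPolynomial (Fin 4) A) : MvPolynomial (Fin 4) K :=
  AddMonoidAlgebra.map (w : A →+ K) z

lemma coeff_lamMap (w : A →ₗ[K] K) (z : MvPolynomial (Fin 4) A) (d) :
    coeff d (lamMap w z) = w (coeff d z) :=
  coeff_addMonoidAlgebraMap _ _ _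

lemma lamMap_zero (w : A →ₗ[K] K) : lamMap w 0 = 0 := by
  ext d; simp [coeff_lamMap]

lemma lamMap_add (w : A →ₗ[K] K) (y z : MvPolynomial (Fin 4) A) :
    lamMap w (y + z) = lamMap w y + lamMap w z := by
  ext d; simp [coeff_lamMap]

lemma lamMap_sum (w : A →ₗ[K] K) {ι : Type*} (s : Finset ι) (f : ι → MvPolynomial (Fin 4) A) :
    lamMap w (∑ i ∈ s, f i) = ∑ i ∈ s, lamMap w (f i) := by
  ext d; simp [coeff_lamMap, coeff_sum]

lemma lamMap_mul (w : A →ₗ[K] K) (r : MvPolynomial (Fin 4) K) (z : MvPolynomial (Fin 4) A) :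
    lamMap w (map (algebraMap K A) r * z) = r * lamMap w z := by
  ext d
  simp only [coeff_lamMap, coeff_mul, coeff_map, map_sum]
  refine Finset.sum_congr rfl fun p _ => ?_
  rw [← Algebra.smul_def, map_smul, smul_eq_mul]

lemma eval_lamMap (w : A →ₗ[K] K) (c : Fin 4 → K) (z : MvPolynomial (Fin 4) A) :
    eval c (lamMap w z) = w (eval (fun i => algebraMap K A (c i)) z) := by
  induction z using MvPolynomial.induction_on' with
  | monomial d a =>
    have : lamMap w (monomial d a) = monomial d (w a) := by
      ext e
      classical
      rw [coeff_lamMap, coeff_monomial, coeff_monomial]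
      split_ifs <;> simp
    rw [this, eval_monomial, eval_monomial]
    have : (d.prod fun i k => (algebraMap K A (c i)) ^ k)
        = algebraMap K A (d.prod fun i k => (c i) ^ k) := by
      simp [Finsupp.prod, map_prod, map_pow]
    rw [this, mul_comm a, ← Algebra.smul_def, map_smul, smul_eq_mul, mul_comm]
  | add p q hp hq => rw [lamMap_add, map_add, hp, hq, map_add, map_add]

lemma lamMap_ext (z : MvPolynomial (Fin 4) A) (h : ∀ w : A →ₗ[K] K, lamMap w z = 0) : z = 0 := by
  ext d
  rw [coeff_zero]
  refine (Module.forall_dual_apply_eq_zero_iff K _).1 fun f => ?_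
  rw [← coeff_lamMap f z d, h f, coeff_zero]

lemma tf_concrete (r : MvPolynomial (Fin 4) K) (z : MvPolynomial (Fin 4) A)
    (h : map (algebraMap K A) r * z = 0) : r = 0 ∨ z = 0 := by
  by_cases hr : r = 0
  · exact Or.inl hr
  · refine Or.inr (lamMap_ext (K := K) z fun w => ?_)
    have := congrArg (lamMap w) h
    rw [lamMap_mul, lamMap_zero] at this
    exact (mul_eq_zero.1 this).resolve_left hr

lemma pow_ne (x : Fin 4 → A) [CharZero K] (n : ℕ) : ∀ w : A,
    C w * (∑ i, C (x i) * X i : MvPolynomial (Fin 4) A) ^ n = 0 →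
    ∀ z ∈ (Submodule.span K (Set.range x)) ^ n, w * z = 0 := by
  induction n with
  | zero =>
    intro w hw z hz
    have hw : w = 0 := by
      have := congrArg (coeff 0) hw
      simpa using this
    simp [hw]
  | succ n ih =>
    intro w hw z hz
    have key : ∀ i, ∀ y ∈ (Submodule.span K (Set.range x)) ^ n, w * (x i * y) = 0 := by
      intro i y hy
      rw [← mul_assoc]
      refine ih (w * x i) ?_ y hy
      have := congrArg (pderiv i) hw
      have hL : pderiv i (∑ j, C (x j) * X j : MvPolynomial (Fin 4) A) = C (x i) := by
        simp [map_sum, pderiv_X, Pi.single_apply]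
      simp only [Derivation.leibniz, Derivation.leibniz_pow, pderiv_C, hL, map_zero, smul_eq_mul,
        nsmul_eq_mul, Nat.add_sub_cancel] at this
      rcases tf_concrete (K := K) (C ((n + 1 : ℕ) : K)) 
        (C (w * x i) * (∑ j, C (x j) * X j : MvPolynomial (Fin 4) A) ^ n) (by
          rw [map_C, map_natCast, C_mul]
          simp only [map_natCast]
          linear_combination this) with h | h
      · exfalso
        rw [C_eq_zero] at h
        exact absurd h (by exact_mod_cast Nat.succ_ne_zero n)
      · exact h
    rw [pow_succ'] at hz
    induction hz using Submodule.mul_induction_on' with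
    | mem_mul_mem m hm y hy =>
      induction hm using Submodule.span_induction with
      | mem m h => obtain ⟨i, rfl⟩ := h; exact key i y hy
      | zero => simp
      | add a b _ _ ha hb => rw [add_mul, mul_add, ha, hb, add_zero]
      | smul k a _ ha => rw [smul_mul_assoc, mul_smul_comm, ha, smul_zero]
    | add a _ b _ ha hb => rw [mul_add, ha, hb, add_zero]

lemma exists_der (r : Fin 4 → MvPolynomial (Fin 4) K) :
    ∃ D : Derivation A (MvPolynomial (Fin 4) A) (MvPolynomial (Fin 4) A),
      ∀ z, D z = ∑ i, map (algebraMap K A) (r i) * pderiv i z := by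
  refine ⟨∑ i, (map (algebraMap K A) (r i)) • (pderiv i), fun z => ?_⟩
  rw [← Derivation.coeFnAddMonoidHom_apply, map_sum, Finset.sum_apply]
  rfl

lemma der_conv {S B : Type*} [CommRing S] [CommRing B] [Algebra B S] (D : Derivation B S S) :
    ∃ D' : Derivation ℤ S S, ∀ z, D' z = D z :=
  ⟨Derivation.mk' (D : S →+ S).toIntLinearMap fun a b => D.leibniz a b, fun _ => rfl⟩

attribute [local instance] MvPolynomial.algebraMvPolynomial

/-- polynomials with coefficients in a subspace -/
def polySub (W : Submodule K A) :
    Submodule (MvPolynomial (Fin 4) K) (MvPolynomial (Fin 4) A) where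
  carrier := {z | ∀ d, coeff d z ∈ W}
  add_mem' := fun ha hb d => by rw [coeff_add]; exact W.add_mem (ha d) (hb d)
  zero_mem' := fun d => by simp
  smul_mem' := fun r z hz d => by
    rw [Algebra.smul_def, MvPolynomial.algebraMap_def, coeff_mul]
    refine W.sum_mem fun p _ => ?_
    rw [coeff_map, ← Algebra.smul_def]
    exact W.smul_mem _ (hz _)

lemma mem_polySub (W : Submodule K A) (z : MvPolynomial (Fin 4) A) :
    z ∈ polySub W ↔ ∀ d, coeff d z ∈ W := Iff.rfl

lemma C_mem_polySub (W : Submodule K A) (a : A) (ha : a ∈ W) : C a ∈ polySub W := by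
  classical
  intro d
  rw [coeff_C]
  split_ifs
  · exact ha
  · exact W.zero_mem

lemma polySub_mul (W W' : Submodule K A) : polySub W * polySub W' ≤ polySub (W * W') := by
  rw [Submodule.mul_le]
  intro y hy z hz d
  rw [coeff_mul]
  exact Submodule.sum_mem _ fun p _ => Submodule.mul_mem_mul (hy _) (hz _)

lemma polySub_pow (W : Submodule K A) (n : ℕ) : polySub W ^ n ≤ polySub (W ^ n) := by
  induction n with
  | zero =>
    rw [pow_zero, pow_zero, Submodule.one_le]
    exact C_mem_polySub _ 1 (Submodule.one_le.1 le_rfl)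
  | succ n ih =>
    rw [pow_succ, pow_succ]
    exact (mul_le_mul' ih le_rfl).trans (polySub_mul _ _)

lemma eval_mem (W : Submodule K A) (z : MvPolynomial (Fin 4) A) (hz : ∀ d, coeff d z ∈ W)
    (c : Fin 4 → K) : eval (fun i => algebraMap K A (c i)) z ∈ W := by
  rw [eval_eq]
  refine W.sum_mem fun d _ => ?_
  have : ∏ i ∈ d.support, (algebraMap K A (c i)) ^ d i
        = algebraMap K A (∏ i ∈ d.support, (c i) ^ d i) := by
      simp [map_prod, map_pow]
  rw [this, mul_comm, ← Algebra.smul_def]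
  exact W.smul_mem _ (hz d)

lemma der_part (x : Fin 4 → A) (L : MvPolynomial (Fin 4) A) (hLdef : L = ∑ i, C (x i) * X i)
    (V : Submodule (MvPolynomial (Fin 4) K) (MvPolynomial (Fin 4) A))
    (hV : V = Submodule.span _ (Set.range fun i => C (x i)))
    (u : MvPolynomial (Fin 4) A) (hu : u ∈ V) :
    ∃ D : Derivation A (MvPolynomial (Fin 4) A) (MvPolynomial (Fin 4) A),
      D L = u ∧ (∀ v ∈ V, D v ∈ V) ∧ ∀ s : MvPolynomial (Fin 4) K, ∃ t : MvPolynomial (Fin 4) K,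
        D (map (algebraMap K A) s) = map (algebraMap K A) t := by
  subst hV
  have CV : ∀ i, C (x i) ∈ Submodule.span (MvPolynomial (Fin 4) K)
    (Set.range fun i => (C (x i) : MvPolynomial (Fin 4) A)) :=
    fun i => Submodule.subset_span ⟨i, rfl⟩
  have alg : ∀ r : MvPolynomial (Fin 4) K,
      algebraMap (MvPolynomial (Fin 4) K) (MvPolynomial (Fin 4) A) r
        = map (algebraMap K A) r := fun r => rfl
  obtain ⟨r, rfl⟩ := (Submodule.mem_span_range_iff_exists_fun _).1 hu
  obtain ⟨D, Dap⟩ := exists_der (A := A) r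
  have Dr : ∀ s : MvPolynomial (Fin 4) K,
      ∑ i, map (algebraMap K A) (r i) * pderiv i (map (algebraMap K A) s)
      = map (algebraMap K A) (∑ i, r i * pderiv i s) := by
    intro s
    rw [map_sum]
    refine Finset.sum_congr rfl fun i _ => ?_
    rw [map_mul, pderiv_map]
  refine ⟨D, ?_, ?_, ?_⟩
  · rw [Dap]
    refine Finset.sum_congr rfl fun i _ => ?_
    rw [Algebra.smul_def, alg, hLdef]
    congr 1
    simp [map_sum, pderiv_X, Pi.single_apply]
  · intro v hv
    obtain ⟨s, rfl⟩ := (Submodule.mem_span_range_iff_exists_fun _).1 hv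
    rw [map_sum]
    refine Submodule.sum_mem _ fun j _ => ?_
    have : D (s j • C (x j))
        = (∑ i, r i * pderiv i (s j)) • (C (x j) : MvPolynomial (Fin 4) A) := by
      rw [Dap, Algebra.smul_def, Algebra.smul_def, alg, alg, ← Dr, Finset.sum_mul]
      refine Finset.sum_congr rfl fun i _ => ?_
      rw [Derivation.leibniz, pderiv_C, smul_zero, zero_add, smul_eq_mul]
      ring
    rw [this]
    exact Submodule.smul_mem _ _ (CV j)
  · intro s
    refine ⟨∑ i, r i * pderiv i s, ?_⟩
    rw [Dap, Dr]

set_option maxHeartbeats 2000000 in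
theorem mid_main [CharZero K] (x : Fin 4 → A) (hx : LinearIndependent K x)
    (W : Submodule K A) (hW : W = Submodule.span K (Set.range x))
    (soc : ∀ j ≤ 4, ∀ z ∈ W ^ j, (∀ i, x i * z = 0) → z = 0)
    (w : A →ₗ[K] K) (hw : ∀ z ∈ W ^ 5, w z = 0 → z = 0)
    (h5 : W ^ 5 ≠ ⊥)
    (p2 : MvPolynomial (Fin 4) K) (hp2 : p2 ≠ 0)
    (wlp : ∀ c : Fin 4 → K, eval c p2 ≠ 0 → ∀ z ∈ W ^ 2, (∑ i, c i • x i) * z = 0 → z = 0) :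
    ∃ c : Fin 4 → K, (∑ i, c i • x i) ^ 5 ≠ 0 ∧
      (∀ a ∈ W, (∑ i, c i • x i) ^ 3 * a = 0 → a = 0) ∧
      (∀ z ∈ W ^ 2, (∑ i, c i • x i) * z = 0 → z = 0) := by
  obtain ⟨L, hLdef⟩ : ∃ L : MvPolynomial (Fin 4) A, L = ∑ i, C (x i) * X i := ⟨_, rfl⟩
  have evL : ∀ c : Fin 4 → K, eval (fun i => algebraMap K A (c i)) L = ∑ i, c i • x i := by
    intro c
    rw [hLdef]
    simp [Algebra.smul_def, mul_comm]
  have alg : ∀ r : MvPolynomial (Fin 4) K,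
      algebraMap (MvPolynomial (Fin 4) K) (MvPolynomial (Fin 4) A) r
        = map (algebraMap K A) r := fun r => rfl
  have xW : ∀ i, x i ∈ W := fun i => hW ▸ Submodule.subset_span ⟨i, rfl⟩
  have LP : L ∈ polySub W := by
    rw [hLdef]
    refine Submodule.sum_mem _ fun i _ => ?_
    have : C (x i) * X i = (X i : MvPolynomial (Fin 4) K) • (C (x i) : MvPolynomial (Fin 4) A) := by
      rw [Algebra.smul_def, alg, map_X, mul_comm]
    rw [this]
    exact Submodule.smul_mem _ _ (C_mem_polySub _ _ (xW i))
  have powP : ∀ n, L ^ n ∈ polySub (W ^ n) := fun n =>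
    polySub_pow W n (Submodule.pow_mem_pow _ LP n)
  -- L^5 ≠ 0
  have L5 : L ^ 5 ≠ 0 := by
    intro h
    apply h5
    rw [eq_bot_iff]
    intro z hz
    have := pow_ne (K := K) x 5 1 (by rw [← hLdef, h, mul_zero]) z (hW ▸ hz)
    simpa using this
  have wz : ∀ z ∈ polySub (W ^ 5), lamMap w z = 0 → z = 0 := by
    intro z hz h
    ext d
    rw [coeff_zero]
    refine hw _ (hz d) ?_
    rw [← coeff_lamMap, h, coeff_zero]
  have p1 : lamMap w (L ^ 5) ≠ 0 := fun h => L5 (wz _ (powP 5) h)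
  obtain ⟨M, hM⟩ : ∃ M : Matrix (Fin 4) (Fin 4) (MvPolynomial (Fin 4) K),
    ∀ i j, M i j = lamMap w (L ^ 3 * C (x i) * C (x j)) :=
    ⟨Matrix.of fun i j => lamMap w (L ^ 3 * C (x i) * C (x j)), fun _ _ => rfl⟩
  have p3 : M.det ≠ 0 := by
    intro hdet
    obtain ⟨v, hv0, hv⟩ := Matrix.exists_mulVec_eq_zero_iff.2 hdet
    let V : Submodule (MvPolynomial (Fin 4) K) (MvPolynomial (Fin 4) A) :=
      Submodule.span _ (Set.range fun i => C (x i))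
    have CV : ∀ i, C (x i) ∈ V := fun i => Submodule.subset_span ⟨i, rfl⟩
    have VP : V ≤ polySub W := by
      rw [Submodule.span_le]
      rintro _ ⟨i, rfl⟩
      exact C_mem_polySub _ _ (xW i)
    have VPn : ∀ n, V ^ n ≤ polySub (W ^ n) := fun n =>
      (pow_le_pow_left' VP n).trans (polySub_pow W n)
    have hL : L ∈ V := by
      rw [hLdef]
      refine Submodule.sum_mem _ fun i _ => ?_
      have : C (x i) * X i = (X i : MvPolynomial (Fin 4) K) • (C (x i) : MvPolynomial (Fin 4) A) := by
        rw [Algebra.smul_def, alg, map_X, mul_comm]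
      rw [this]
      exact Submodule.smul_mem _ _ (CV i)
    have socS : ∀ j ≤ 4, ∀ z ∈ V ^ j, (∀ u ∈ V, u * z = 0) → z = 0 := by
      intro j hj z hz h
      ext d
      rw [coeff_zero]
      refine soc j hj _ (VPn j hz d) fun i => ?_
      have := congrArg (coeff d) (h _ (CV i))
      rwa [coeff_C_mul, coeff_zero] at this
    obtain ⟨a, hadef⟩ : ∃ a : MvPolynomial (Fin 4) A, a = ∑ i, v i • C (x i) := ⟨_, rfl⟩
    have haV : a ∈ V := hadef ▸ Submodule.sum_mem _ fun i _ => Submodule.smul_mem _ _ (CV i)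
    refine abs_main (R := MvPolynomial (Fin 4) K) (S := MvPolynomial (Fin 4) A)
      ?_ (fun i => C (x i)) V rfl L hL ?_ socS ?_ L5 a haV ?_ ?_
    · intro r z h
      rw [Algebra.smul_def, alg] at h
      exact tf_concrete r z h
    · intro u hu
      obtain ⟨D0, d1, d2, d3⟩ := der_part x L hLdef V rfl u hu
      obtain ⟨D, hD⟩ := der_conv D0
      exact ⟨D, (hD L).trans d1, fun v hv => (hD v).symm ▸ d2 v hv,
        fun s => (d3 s).imp fun t ht => (hD _).trans ht⟩
    · intro z hz h
      refine lamMap_ext (K := K) z fun t => ?_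
      have : p2 * lamMap t z = 0 := by
        refine MvPolynomial.funext fun c => ?_
        rw [map_mul, map_zero, eval_lamMap]
        by_cases hc : eval c p2 = 0
        · rw [hc, zero_mul]
        · have := congrArg (eval (fun i => algebraMap K A (c i))) h
          rw [map_mul, evL, map_zero] at this
          rw [wlp c hc _ (eval_mem _ z (VPn 2 hz) c) this, map_zero, mul_zero]
      exact (mul_eq_zero.1 this).resolve_left hp2
    · intro ha
      apply hv0
      ext i d
      have h := congrArg (coeff d) ha
      rw [hadef, coeff_sum, coeff_zero] at h
      rw [Fintype.linearIndependent_iff] at hx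
      refine hx (fun i => coeff d (v i)) ?_ i
      rw [← h]
      refine Finset.sum_congr rfl fun j _ => ?_
      rw [Algebra.smul_def (coeff d (v j)), Algebra.smul_def (v j), alg,
        mul_comm (map _ (v j)), coeff_C_mul, coeff_map, mul_comm]
    · have h4 : L ^ 3 * a ∈ V ^ 4 := by
        rw [pow_succ]
        exact Submodule.mul_mem_mul (Submodule.pow_mem_pow _ hL 3) haV
      ext d
      rw [coeff_zero]
      refine soc 4 le_rfl _ (VPn 4 h4 d) fun i => ?_
      rw [← coeff_C_mul]
      have : C (x i) * (L ^ 3 * a) = 0 := by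
        refine wz _ (VPn 5 ?_) ?_
        · rw [pow_succ']
          exact Submodule.mul_mem_mul (CV i) h4
        · have hi := congrFun hv i
          simp only [Matrix.mulVec, dotProduct, hM, Pi.zero_apply] at hi
          rw [← hi, hadef, Finset.mul_sum, Finset.mul_sum, lamMap_sum]
          refine Finset.sum_congr rfl fun j _ => ?_
          rw [mul_comm _ (v j), ← lamMap_mul, Algebra.smul_def, alg]
          congr 1
          ring
      rw [this, coeff_zero]
  obtain ⟨c, hc⟩ : ∃ c, eval c (lamMap w (L ^ 5) * p2 * M.det) ≠ 0 := by
    by_contra hcon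
    push Not at hcon
    exact mul_ne_zero (mul_ne_zero p1 hp2) p3 (MvPolynomial.funext fun c => by rw [hcon, map_zero])
  rw [map_mul, map_mul] at hc
  have c1 := left_ne_zero_of_mul (left_ne_zero_of_mul hc)
  have c2 := right_ne_zero_of_mul (left_ne_zero_of_mul hc)
  have c3 := right_ne_zero_of_mul hc
  refine ⟨c, ?_, ?_, wlp c c2⟩
  · intro h
    apply c1
    rw [eval_lamMap, map_pow, evL, h, map_zero]
  · intro a ha h
    rw [hW] at ha
    obtain ⟨r, rfl⟩ := (Submodule.mem_span_range_iff_exists_fun _).1 ha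
    by_contra hne
    apply c3
    rw [RingHom.map_det, ← Matrix.exists_mulVec_eq_zero_iff]
    refine ⟨r, ?_, ?_⟩
    · rintro rfl; simp at hne
    · ext i
      simp only [Matrix.mulVec, dotProduct, RingHom.mapMatrix_apply, Matrix.map_apply, hM,
        eval_lamMap, map_mul, map_pow, evL, eval_C, Pi.zero_apply]
      have := congrArg (fun y => w (x i * y)) h
      simp only [mul_zero, map_zero, Finset.mul_sum, map_sum] at this
      rw [← this]
      refine Finset.sum_congr rfl fun j _ => ?_
      rw [mul_comm _ (r j), ← smul_eq_mul, ← map_smul]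
      congr 1
      simp only [Algebra.smul_def]
      ring

end Mid

section Fin

open MvPolynomial

variable {K : Type*} [Field K]

lemma gen_pow_add {A : Type*} [CommRing A] [Algebra K A] (W : Submodule K A) (m n : ℕ) :
    W ^ (m + n) = W ^ m * W ^ n := pow_add W m n

lemma gen_pow_zero {A : Type*} [CommRing A] [Algebra K A] (W : Submodule K A) :
    W ^ 0 = 1 := pow_zero W

lemma gen_map_pow {A B : Type*} [CommRing A] [Algebra K A] [CommRing B] [Algebra K B]
    (f : A →ₐ[K] B) (W : Submodule K A) (n : ℕ) :
    W.map f.toLinearMap ^ n = (W ^ n).map f.toLinearMap := (Submodule.map_pow W f n).symm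

lemma piece_one_eq (I : Ideal (MvPolynomial (Fin 4) K)) :
    piece I 1 = Submodule.span K (Set.range fun i => Ideal.Quotient.mk I (X i)) := by
  rw [piece, homogeneousSubmodule_one_eq_span_X, Submodule.map_span, ← Set.range_comp]
  rfl

lemma piece_pow_eq (I : Ideal (MvPolynomial (Fin 4) K)) (n : ℕ) :
    piece I 1 ^ n = piece I n := by
  rw [piece, piece, ← homogeneousSubmodule_one_pow K n]
  exact gen_map_pow _ _ _

lemma piece_mul (I : Ideal (MvPolynomial (Fin 4) K)) {m n : ℕ} {a b : MvPolynomial (Fin 4) K ⧸ I}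
    (ha : a ∈ piece I m) (hb : b ∈ piece I n) : a * b ∈ piece I (m + n) := by
  rw [← piece_pow_eq, gen_pow_add, piece_pow_eq, piece_pow_eq]
  exact Submodule.mul_mem_mul ha hb

lemma piece_finite (I : Ideal (MvPolynomial (Fin 4) K)) (n : ℕ) : Module.Finite K (piece I n) :=
  Module.Finite.iff_fg.2 ((homogeneousSubmodule_fg _ _ n).map _)

lemma piece_disj (I : Ideal (MvPolynomial (Fin 4) K)) (hI : IsHomogIdeal I) {m n : ℕ}
    (hmn : m ≠ n) {z : MvPolynomial (Fin 4) K ⧸ I} (h1 : z ∈ piece I m) (h2 : z ∈ piece I n) :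
    z = 0 := by
  obtain ⟨p, hp, rfl⟩ := h1
  obtain ⟨q, hq, h⟩ := h2
  have h' : q - p ∈ I := (Ideal.Quotient.mk_eq_mk_iff_sub_mem _ _).1 h
  have := hI _ h' m
  rw [map_sub, homogeneousComponent_of_mem hp, homogeneousComponent_of_mem hq, if_neg hmn,
    if_pos rfl, zero_sub, neg_mem_iff] at this
  exact Ideal.Quotient.eq_zero_iff_mem.2 this

lemma det_poly {U : Type*} [AddCommGroup U] [Module K U] [Module.Finite K U]
    (g : Fin 4 → Module.End K U) :
    ∃ p : MvPolynomial (Fin 4) K, ∀ c, eval c p = LinearMap.det (∑ i, c i • g i) := by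
  classical
  let b := Module.finBasis K U
  refine ⟨Matrix.det (∑ i, (X i : MvPolynomial (Fin 4) K) • (LinearMap.toMatrix b b (g i)).map C),
    fun c => ?_⟩
  rw [RingHom.map_det, ← LinearMap.det_toMatrix b]
  congr 1
  ext j k
  simp [Matrix.sum_apply]

lemma inj_iff_det {U : Type*} [AddCommGroup U] [Module K U] [Module.Finite K U]
    (g : Module.End K U) : LinearMap.det g ≠ 0 ↔ ∀ u, g u = 0 → u = 0 := by
  rw [← isUnit_iff_ne_zero, ← LinearMap.isUnit_iff_isUnit_det, LinearMap.isUnit_iff_ker_eq_bot,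
    LinearMap.ker_eq_bot']

/-- multiplication by a homogeneous element between graded pieces -/
noncomputable def mulPiece (I : Ideal (MvPolynomial (Fin 4) K)) (m n : ℕ)
    (y : MvPolynomial (Fin 4) K ⧸ I) (hy : ∀ a ∈ piece I m, y * a ∈ piece I n) :
    piece I m →ₗ[K] piece I n :=
  (LinearMap.mulLeft K y).restrict hy

lemma mulPiece_coe (I : Ideal (MvPolynomial (Fin 4) K)) (m n : ℕ)
    (y : MvPolynomial (Fin 4) K ⧸ I) (hy : ∀ a ∈ piece I m, y * a ∈ piece I n) (a : piece I m) :
    (mulPiece I m n y hy a : MvPolynomial (Fin 4) K ⧸ I) = y * a := rfl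

lemma inj_iff_surj (I : Ideal (MvPolynomial (Fin 4) K)) (m n : ℕ) (hmn : hf I m = hf I n)
    (y : MvPolynomial (Fin 4) K ⧸ I) (hy : ∀ a ∈ piece I m, y * a ∈ piece I n) :
    (∀ a ∈ piece I m, y * a = 0 → a = 0) ↔ (∀ b ∈ piece I n, ∃ a ∈ piece I m, y * a = b) := by
  have := piece_finite I m
  have := piece_finite I n
  have key := LinearMap.injective_iff_surjective_of_finrank_eq_finrank
    (f := mulPiece I m n y hy) hmn
  constructor
  · intro h b hb
    have hinj : Function.Injective (mulPiece I m n y hy) := by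
      rw [injective_iff_map_eq_zero]
      intro a ha
      exact Subtype.ext (h a a.2 (congrArg Subtype.val ha))
    obtain ⟨a, ha⟩ := key.1 hinj ⟨b, hb⟩
    exact ⟨a, a.2, congrArg Subtype.val ha⟩
  · intro h a ha h0
    have hs : Function.Surjective (mulPiece I m n y hy) := by
      rintro ⟨b, hb⟩
      obtain ⟨a, ha, rfl⟩ := h b hb
      exact ⟨⟨a, ha⟩, rfl⟩
    have := (injective_iff_map_eq_zero _).1 (key.2 hs) ⟨a, ha⟩ (Subtype.ext h0)
    exact congrArg Subtype.val this

lemma exists_p2 (I : Ideal (MvPolynomial (Fin 4) K)) (h23 : hf I 2 = hf I 3) (hW : WLP I) :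
    ∃ p2 : MvPolynomial (Fin 4) K, p2 ≠ 0 ∧ ∀ c : Fin 4 → K, eval c p2 ≠ 0 →
      ∀ z ∈ piece I 2, (∑ i, c i • Ideal.Quotient.mk I (X i)) * z = 0 → z = 0 := by
  have := piece_finite I 2
  have := piece_finite I 3
  have hx : ∀ i, Ideal.Quotient.mk I (X i) ∈ piece I 1 := fun i =>
    piece_one_eq I ▸ Submodule.subset_span ⟨i, rfl⟩
  have hm : ∀ i, ∀ a ∈ piece I 2, Ideal.Quotient.mk I (X i) * a ∈ piece I 3 :=
    fun i a ha => piece_mul I (hx i) ha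
  let e : piece I 2 ≃ₗ[K] piece I 3 := LinearEquiv.ofFinrankEq _ _ h23
  let g : Fin 4 → Module.End K (piece I 2) := fun i =>
    e.symm.toLinearMap ∘ₗ mulPiece I 2 3 _ (hm i)
  have hg : ∀ (c : Fin 4 → K) (u : piece I 2), (∑ i, c i • g i) u = 0 ↔
      (∑ i, c i • Ideal.Quotient.mk I (X i)) * (u : MvPolynomial (Fin 4) K ⧸ I) = 0 := by
    intro c u
    have : (∑ i, c i • g i) u = e.symm (∑ i, c i • mulPiece I 2 3 _ (hm i) u) := by
      simp [g, LinearMap.sum_apply, map_sum]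
    rw [this, LinearEquiv.map_eq_zero_iff, ← Submodule.coe_eq_zero, Submodule.coe_sum,
      Finset.sum_mul]
    simp only [Submodule.coe_smul, mulPiece_coe, smul_mul_assoc]
  obtain ⟨p, hp⟩ := det_poly g
  refine ⟨p, ?_, ?_⟩
  · rintro rfl
    obtain ⟨ℓ, hℓ, h⟩ := hW
    have hℓ1 : Ideal.Quotient.mk I ℓ ∈ piece I 1 := ⟨ℓ, hℓ, rfl⟩
    have hinj : ∀ a ∈ piece I 2, Ideal.Quotient.mk I ℓ * a = 0 → a = 0 := by
      rcases h 2 with h | h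
      · exact h
      · exact (inj_iff_surj I 2 3 h23 _ (fun a ha => piece_mul I hℓ1 ha)).2 h
    rw [piece_one_eq] at hℓ1
    obtain ⟨c, hc⟩ := (Submodule.mem_span_range_iff_exists_fun _).1 hℓ1
    have hd := (inj_iff_det (∑ i, c i • g i)).2 (fun u hu => by
      rw [hg, hc] at hu
      exact Subtype.ext (hinj u u.2 hu))
    rw [← hp, map_zero] at hd
    exact hd rfl
  · intro c hc z hz h
    rw [hp, inj_iff_det] at hc
    exact congrArg Subtype.val (hc ⟨z, hz⟩ ((hg c ⟨z, hz⟩).2 h))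

end Fin

/-- An artinian Gorenstein algebra with h-vector `(1,4,k,k,4,1)` has the WLP iff it
has the SLP. -/
theorem wlp_iff_slp_14kk41 {K : Type*} [Field K] [IsAlgClosed K] [CharZero K]
    (I : Ideal (MvPolynomial (Fin 4) K)) (k : ℕ)
    (hAG : IsArtinianGorenstein I 5)
    (h0 : hf I 0 = 1) (h1 : hf I 1 = 4) (h2 : hf I 2 = k)
    (h3 : hf I 3 = k) (h4 : hf I 4 = 4) (h5 : hf I 5 = 1) :
    WLP I ↔ SLP I := by
  constructor
  swap
  · rintro ⟨ℓ, hℓ, h⟩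
    refine ⟨ℓ, hℓ, fun i => ?_⟩
    simpa only [pow_one] using h i 1 le_rfl
  intro hW
  obtain ⟨hI, -, hvan, -, -, hsoc⟩ := hAG
  obtain ⟨p2, hp2, hwlp⟩ := exists_p2 I (h2.trans h3.symm) hW
  have hx : LinearIndependent K (fun i : Fin 4 => Ideal.Quotient.mk I (X i)) := by
    rw [linearIndependent_iff_card_eq_finrank_span, Set.finrank, ← piece_one_eq]
    exact h1.symm
  obtain ⟨v, hv0, hv⟩ := finrank_eq_one_iff'.1 h5
  have hv0' : (v : MvPolynomial (Fin 4) K ⧸ I) ≠ 0 := fun h => hv0 (Subtype.ext h)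
  obtain ⟨w, hw⟩ : ∃ w : (MvPolynomial (Fin 4) K ⧸ I) →ₗ[K] K, w v ≠ 0 := by
    by_contra hcon
    push Not at hcon
    exact hv0' ((Module.forall_dual_apply_eq_zero_iff K _).1 hcon)
  obtain ⟨c, c5, c3, c1⟩ := mid_main (fun i : Fin 4 => Ideal.Quotient.mk I (X i)) hx (piece I 1)
    (piece_one_eq I) (by
      intro j hj z hz h
      rw [piece_pow_eq] at hz
      refine piece_disj I hI (m := j) (n := 5) (by omega) hz (hsoc ?_)
      rw [socle, Submodule.mem_iInf]
      intro i
      exact h i) w (by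
      intro z hz hz0
      rw [piece_pow_eq] at hz
      obtain ⟨r, hr⟩ := hv ⟨z, hz⟩
      have hr' : r • (v : MvPolynomial (Fin 4) K ⧸ I) = z := congrArg Subtype.val hr
      rw [← hr', map_smul, smul_eq_mul] at hz0
      rw [← hr', (mul_eq_zero.1 hz0).resolve_right hw, zero_smul]) (by
      rw [piece_pow_eq]
      intro h
      exact hv0' ((Submodule.mem_bot K).1 (h ▸ v.2))) p2 hp2 (by
      intro c hc z hz
      rw [piece_pow_eq] at hz
      exact hwlp c hc z hz)
  obtain ⟨y, hy⟩ : ∃ y, y = ∑ i, c i • Ideal.Quotient.mk I (X i) := ⟨_, rfl⟩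
  rw [← hy] at c5 c3 c1
  rw [piece_pow_eq] at c1
  have hy1 : y ∈ piece I 1 := by
    rw [hy, piece_one_eq]
    exact Submodule.sum_mem _ fun i _ =>
      Submodule.smul_mem _ _ (Submodule.subset_span ⟨i, rfl⟩)
  obtain ⟨ℓ, hℓ, hℓy⟩ := id hy1
  have hℓy : Ideal.Quotient.mk I ℓ = y := hℓy
  have ypow : ∀ n, y ^ n ∈ piece I n := fun n => by
    rw [← piece_pow_eq]; exact Submodule.pow_mem_pow _ hy1 n
  have ymul : ∀ m n a, a ∈ piece I m → y ^ n * a ∈ piece I (m + n) := fun m n a ha => by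
    rw [add_comm]; exact piece_mul I (ypow n) ha
  have c0 : ∀ a ∈ piece I 0, y ^ 5 * a = 0 → a = 0 := by
    intro a ha h
    rw [← piece_pow_eq, gen_pow_zero] at ha
    obtain ⟨r, rfl⟩ := Submodule.mem_one.1 ha
    rw [mul_comm, ← Algebra.smul_def] at h
    rw [(smul_eq_zero.1 h).resolve_right c5, map_zero]
  have inj : ∀ i ≤ 2, ∀ a ∈ piece I i, y ^ (5 - 2 * i) * a = 0 → a = 0 := by
    intro i hi
    interval_cases i
    · exact c0
    · exact c3
    · intro a ha h; exact c1 a ha (by simpa using h)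
  have surj : ∀ i ≤ 2, ∀ b ∈ piece I (5 - i), ∃ a ∈ piece I i, y ^ (5 - 2 * i) * a = b := by
    intro i hi
    refine (inj_iff_surj I i (5 - i) ?_ _ ?_).1 (inj i hi)
    · interval_cases i
      · exact h0.trans h5.symm
      · exact h1.trans h4.symm
      · exact h2.trans h3.symm
    · intro a ha
      have := ymul i (5 - 2 * i) a ha
      rwa [show i + (5 - 2 * i) = 5 - i by omega] at this
  refine ⟨ℓ, hℓ, fun i n hn => ?_⟩
  rw [hℓy]
  by_cases hle : 2 * i + n ≤ 5
  · left
    intro a ha h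
    refine inj i (by omega) a ha ?_
    rw [show 5 - 2 * i = (5 - 2 * i - n) + n by omega, pow_add, mul_assoc, h, mul_zero]
  · right
    intro b hb
    by_cases hbig : 5 < i + n
    · have := piece_finite I (i + n)
      have hz : piece I (i + n) = ⊥ := Submodule.finrank_eq_zero.1 (hvan _ hbig)
      rw [hz, Submodule.mem_bot] at hb
      exact ⟨0, Submodule.zero_mem _, by rw [hb, mul_zero]⟩
    · obtain ⟨a, ha, hab⟩ := surj (5 - (i + n)) (by omega) b (by
        rwa [show 5 - (5 - (i + n)) = i + n by omega])
      refine ⟨y ^ (i - (5 - (i + n))) * a, ?_, ?_⟩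
      · have := ymul _ (i - (5 - (i + n))) a ha
        rwa [show 5 - (i + n) + (i - (5 - (i + n))) = i by omega] at this
      · rw [← mul_assoc, ← pow_add, ← hab]
        congr 2
        omega
end

section
/- Any artinian Gorenstein algebra A of codimension 3 (i.e., a quotient of K[x_1,x_2,x_3]) with odd socle degree 2m+1 and h-vector (1, 3, 5, 7, ..., 2m-1, 2m+1, 2m+1, 2m-1, ..., 7, 5, 3, 1) satisfies the weak Lefschetz property. -/
open MvPolynomial

namespace WlpOdd

open Polynomial in
/-- A univariate Wronskian argument in characteristic zero. -/
theorem poly_wronskian {K : Type*} [Field K] [CharZero K] (F H : Polynomial K)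
    (h : F * derivative H = H * derivative F) (hF : F.eval 0 ≠ 0) (hH : H.eval 0 = 0) :
    H = 0 := by
  by_contra hne
  obtain ⟨H1, h1, h2⟩ := Polynomial.exists_eq_pow_rootMultiplicity_mul_and_not_dvd H hne 0
  have hk : 0 < Polynomial.rootMultiplicity 0 H :=
    (Polynomial.rootMultiplicity_pos hne).2 hH
  obtain ⟨k, hk'⟩ : ∃ k, Polynomial.rootMultiplicity 0 H = k + 1 := ⟨_, (Nat.succ_pred_eq_of_pos hk).symm⟩
  rw [hk'] at h1
  simp only [map_zero, sub_zero] at h1 h2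
  rw [h1] at h
  rw [derivative_mul, derivative_X_pow] at h
  have e : (Polynomial.X : K[X]) ^ k * (F * (Polynomial.C ((k + 1 : ℕ) : K) * H1 + Polynomial.X * derivative H1))
      = Polynomial.X ^ k * (Polynomial.X * H1 * derivative F) := by
    have : k + 1 - 1 = k := rfl
    rw [this] at h
    linear_combination h
  have e2 := mul_left_cancel₀ (pow_ne_zero k Polynomial.X_ne_zero) e
  have e3 := congrArg (Polynomial.eval 0) e2
  simp only [Polynomial.eval_mul, Polynomial.eval_add, Polynomial.eval_C, Polynomial.eval_X, zero_mul, add_zero, mul_eq_zero] at e3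
  rw [Polynomial.X_dvd_iff, Polynomial.coeff_zero_eq_eval_zero] at h2
  rcases e3 with e3 | e3 | e3
  · exact hF e3
  · exact Nat.cast_ne_zero.2 (Nat.succ_ne_zero k) e3
  · exact h2 e3

variable {K : Type*} [Field K]

theorem hom_one {L : MvPolynomial (Fin 3) K} (h : L.IsHomogeneous 1) :
    ∃ a : Fin 3 → K, L = ∑ i, C (a i) * X i := by
  have : L ∈ homogeneousSubmodule (Fin 3) K 1 := h
  rw [homogeneousSubmodule_one_eq_span_X, Submodule.mem_span_range_iff_exists_fun] at this
  obtain ⟨a, ha⟩ := this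
  exact ⟨a, by rw [← ha]; simp [MvPolynomial.smul_eq_C_mul]⟩

theorem lin_hom (a : Fin 3 → K) : (∑ i, C (a i) * X i : MvPolynomial (Fin 3) K).IsHomogeneous 1 :=
  IsHomogeneous.sum _ _ _ fun _ _ => isHomogeneous_C_mul_X _ _

theorem lin_ne (a : Fin 3 → K) (ha : a ≠ 0) : (∑ i, C (a i) * X i : MvPolynomial (Fin 3) K) ≠ 0 := by
  intro h
  apply ha
  funext j
  have := congrArg (MvPolynomial.eval (Pi.single j 1)) h
  simpa [Pi.single_apply] using this

theorem eval_add_lin {L : MvPolynomial (Fin 3) K} (h : L.IsHomogeneous 1) (p v : Fin 3 → K) :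
    MvPolynomial.eval (p + v) L = MvPolynomial.eval p L + MvPolynomial.eval v L := by
  obtain ⟨a, rfl⟩ := hom_one h
  simp [mul_add, Finset.sum_add_distrib]

theorem exists_lin (p v : Fin 3 → K) : ∃ ℓ : MvPolynomial (Fin 3) K, ℓ.IsHomogeneous 1 ∧ ℓ ≠ 0 ∧
    MvPolynomial.eval p ℓ = 0 ∧ MvPolynomial.eval v ℓ = 0 := by
  have := LinearMap.ker_ne_bot_of_finrank_lt
    (f := (Matrix.mulVecLin !![p 0, p 1, p 2; v 0, v 1, v 2] : (Fin 3 → K) →ₗ[K] (Fin 2 → K)))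
    (by simp)
  obtain ⟨a, ha, ha0⟩ := (Submodule.ne_bot_iff _).1 this
  refine ⟨∑ i, C (a i) * X i, lin_hom a, lin_ne a ha0, ?_, ?_⟩
  · have := congrFun (LinearMap.mem_ker.1 ha) 0
    simp [Matrix.mulVec, dotProduct, Fin.sum_univ_three] at this
    simp [Fin.sum_univ_three]
    linear_combination this
  · have := congrFun (LinearMap.mem_ker.1 ha) 1
    simp [Matrix.mulVec, dotProduct, Fin.sum_univ_three] at this
    simp [Fin.sum_univ_three]
    linear_combination this

theorem lin_dvd {L ℓ : MvPolynomial (Fin 3) K} (hL : L.IsHomogeneous 1) (hl : ℓ.IsHomogeneous 1)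
    (h : L ∣ ℓ) (h0 : ℓ ≠ 0) : ∃ c : K, c ≠ 0 ∧ ℓ = C c * L := by
  obtain ⟨r, rfl⟩ := h
  have hL0 : L ≠ 0 := left_ne_zero_of_mul h0
  have hr0 : r ≠ 0 := right_ne_zero_of_mul h0
  have h1 := hl.totalDegree h0
  rw [totalDegree_mul_of_isDomain hL0 hr0, hL.totalDegree hL0] at h1
  have h2 : r.totalDegree = 0 := by omega
  rw [totalDegree_eq_zero_iff_eq_C] at h2
  refine ⟨coeff 0 r, ?_, ?_⟩
  · intro h; rw [h] at h2; apply hr0; rw [h2]; simp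
  · rw [← h2]; ring

theorem not_dvd_of_eval {L ℓ : MvPolynomial (Fin 3) K} (hL : L.IsHomogeneous 1)
    (hl : ℓ.IsHomogeneous 1) (h0 : ℓ ≠ 0) (p : Fin 3 → K) (h1 : MvPolynomial.eval p ℓ = 0)
    (h2 : MvPolynomial.eval p L ≠ 0) : ¬ L ∣ ℓ := by
  intro h
  obtain ⟨c, hc, rfl⟩ := lin_dvd hL hl h h0
  simp at h1
  exact h1.elim hc h2

theorem lin_prime {L : MvPolynomial (Fin 3) K} (hL : L.IsHomogeneous 1) (h0 : L ≠ 0) : Prime L := by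
  rw [← irreducible_iff_prime]
  apply irreducible_of_totalDegree_eq_one (hL.totalDegree h0)
  intro x hx
  rw [isUnit_iff_ne_zero]
  rintro rfl
  apply h0
  ext i
  simpa using hx i

theorem null [IsAlgClosed K] {q f : MvPolynomial (Fin 3) K} (hq : Prime q)
    (h : ∀ p, MvPolynomial.eval p q = 0 → MvPolynomial.eval p f = 0) : q ∣ f := by
  have hp : (Ideal.span {q}).IsPrime := (Ideal.span_singleton_prime hq.ne_zero).2 hq
  rw [← Ideal.mem_span_singleton, ← MvPolynomial.IsPrime.vanishingIdeal_zeroLocus (K := K) (Ideal.span {q})]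
  intro p hp
  have := hp q (Ideal.mem_span_singleton_self q)
  simp only [aeval_eq_eval] at this ⊢
  exact h p this

theorem exists_null [IsAlgClosed K] {q f : MvPolynomial (Fin 3) K} (hq : Prime q) (h : ¬ q ∣ f) :
    ∃ p, MvPolynomial.eval p q = 0 ∧ MvPolynomial.eval p f ≠ 0 := by
  by_contra! hh
  exact h (null hq hh)

/-- Two functionals separating `f` and `g` and killing multiples of `q` and `ℓ`. -/
theorem det_kill (E1 E2 : MvPolynomial (Fin 3) K →ₗ[K] K) (q ℓ f g : MvPolynomial (Fin 3) K)
    (hq1 : ∀ r, E1 (q * r) = 0) (hq2 : ∀ r, E2 (q * r) = 0)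
    (hl1 : ∀ r, E1 (ℓ * r) = 0) (hl2 : ∀ r, E2 (ℓ * r) = 0)
    (hdet : E1 f * E2 g ≠ E2 f * E1 g) (u : MvPolynomial (Fin 3) K) (a b : K)
    (h : q ∣ ℓ * u - C a * f - C b * g) : q ∣ ℓ * u := by
  obtain ⟨r, hr⟩ := h
  have h1 := congrArg E1 hr
  have h2 := congrArg E2 hr
  simp only [map_sub, hl1, hl2, hq1, hq2, ← MvPolynomial.smul_eq_C_mul, map_smul, smul_eq_mul] at h1 h2
  have hd : E1 f * E2 g - E2 f * E1 g ≠ 0 := sub_ne_zero.2 hdet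
  have ha : a = 0 := by
    apply (mul_eq_zero.1 (_ : a * (E1 f * E2 g - E2 f * E1 g) = 0)).resolve_right hd
    linear_combination -E2 g * h1 + E1 g * h2
  have hb : b = 0 := by
    apply (mul_eq_zero.1 (_ : b * (E1 f * E2 g - E2 f * E1 g) = 0)).resolve_right hd
    linear_combination E2 f * h1 - E1 f * h2
  subst ha hb
  exact ⟨r, by simpa using hr⟩

noncomputable def ev (p : Fin 3 → K) : MvPolynomial (Fin 3) K →ₗ[K] K := (MvPolynomial.aeval p).toLinearMap

theorem ev_apply (p : Fin 3 → K) (f) : ev p f = MvPolynomial.eval p f := by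
  simp [ev, aeval_eq_eval]

theorem key_irred [IsAlgClosed K] (q f g : MvPolynomial (Fin 3) K) (hq : q.IsHomogeneous 2)
    (hp : Prime q) (hind : ∀ a b : K, q ∣ C a * f + C b * g → a = 0 ∧ b = 0) :
    ∃ ℓ : MvPolynomial (Fin 3) K, ℓ.IsHomogeneous 1 ∧
      ∀ u (a b : K), q ∣ ℓ * u - C a * f - C b * g → q ∣ u := by
  have h1 : ¬ q ∣ f := fun h => by
    have := hind 1 0 (by simpa using h)
    simp at this
  obtain ⟨p, hpq, hpf⟩ := exists_null hp h1
  have h2 : ¬ q ∣ C (- MvPolynomial.eval p g) * f + C (MvPolynomial.eval p f) * g := fun h =>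
    hpf (hind _ _ h).2
  obtain ⟨p', hpq', hpf'⟩ := exists_null hp h2
  obtain ⟨ℓ, hl, hl0, hlp, hlp'⟩ := exists_lin p p'
  refine ⟨ℓ, hl, fun u a b h => ?_⟩
  have := det_kill (ev p) (ev p') q ℓ f g (by simp [ev_apply, hpq]) (by simp [ev_apply, hpq'])
    (by simp [ev_apply, hlp]) (by simp [ev_apply, hlp']) (by
      simp only [ev_apply]
      intro h
      apply hpf'
      simp
      linear_combination h) u a b h
  refine (hp.dvd_or_dvd this).resolve_left ?_
  rintro ⟨r, rfl⟩
  have h3 := hl.totalDegree hl0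
  rw [totalDegree_mul_of_isDomain hp.ne_zero (right_ne_zero_of_mul hl0), hq.totalDegree hp.ne_zero] at h3
  omega

theorem key_two [IsAlgClosed K] (L M f g : MvPolynomial (Fin 3) K) (hL : L.IsHomogeneous 1)
    (hM : M.IsHomogeneous 1) (hL0 : L ≠ 0) (hM0 : M ≠ 0) (hLM : ¬ L ∣ M)
    (hind : ∀ a b : K, L * M ∣ C a * f + C b * g → a = 0 ∧ b = 0)
    (h1 : ¬ (L ∣ f ∧ L ∣ g)) (h2 : ¬ (M ∣ f ∧ M ∣ g)) :
    ∃ ℓ : MvPolynomial (Fin 3) K, ℓ.IsHomogeneous 1 ∧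
      ∀ u (a b : K), L * M ∣ ℓ * u - C a * f - C b * g → L * M ∣ u := by
  have pL := lin_prime hL hL0
  have pM := lin_prime hM hM0
  have hML : ¬ M ∣ L := by
    intro h
    obtain ⟨c, hc, rfl⟩ := lin_dvd hM hL h hL0
    apply hLM
    refine ⟨C c⁻¹, ?_⟩
    rw [mul_right_comm, ← C_mul, mul_inv_cancel₀ hc]
    simp
  suffices ∃ p p', MvPolynomial.eval p L = 0 ∧ MvPolynomial.eval p M ≠ 0 ∧
      MvPolynomial.eval p' M = 0 ∧ MvPolynomial.eval p' L ≠ 0 ∧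
      MvPolynomial.eval p f * MvPolynomial.eval p' g ≠ MvPolynomial.eval p' f * MvPolynomial.eval p g by
    obtain ⟨p, p', a1, a2, a3, a4, a5⟩ := this
    obtain ⟨ℓ, hl, hl0, hlp, hlp'⟩ := exists_lin p p'
    refine ⟨ℓ, hl, fun u a b h => ?_⟩
    have := det_kill (ev p) (ev p') (L * M) ℓ f g (by simp [ev_apply, a1]) (by simp [ev_apply, a3])
      (by simp [ev_apply, hlp]) (by simp [ev_apply, hlp']) (by simpa only [ev_apply] using a5) u a b h
    have n1 := not_dvd_of_eval hL hl hl0 p' hlp' a4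
    have n2 := not_dvd_of_eval hM hl hl0 p hlp a2
    obtain ⟨r, hr⟩ := this
    obtain ⟨v, rfl⟩ := (pL.dvd_or_dvd (⟨M * r, by rw [hr]; ring⟩ : L ∣ ℓ * u)).resolve_left n1
    have e : ℓ * v = M * r := mul_left_cancel₀ hL0 (by linear_combination hr)
    obtain ⟨w, rfl⟩ := (pM.dvd_or_dvd (⟨r, e⟩ : M ∣ ℓ * v)).resolve_left n2
    exact ⟨w, by ring⟩
  by_contra! hcon
  have key : ∀ (A B : MvPolynomial (Fin 3) K), Prime A → ¬ A ∣ B → ¬ (A ∣ f ∧ A ∣ g) →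
      ∃ p, MvPolynomial.eval p A = 0 ∧ MvPolynomial.eval p B ≠ 0 ∧
        (MvPolynomial.eval p f ≠ 0 ∨ MvPolynomial.eval p g ≠ 0) := by
    intro A B pA hAB hA
    by_contra! hh
    apply hA
    constructor
    · refine (pA.dvd_or_dvd (null pA (f := B * f) fun p hp => ?_)).resolve_left hAB
      by_cases hb : MvPolynomial.eval p B = 0
      · simp [hb]
      · simp [(hh p hp hb).1]
    · refine (pA.dvd_or_dvd (null pA (f := B * g) fun p hp => ?_)).resolve_left hAB
      by_cases hb : MvPolynomial.eval p B = 0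
      · simp [hb]
      · simp [(hh p hp hb).2]
  obtain ⟨p, b1, b2, b3⟩ := key L M pL hLM h1
  obtain ⟨p', c1, c2, c3⟩ := key M L pM hML h2
  have d0 := hcon p p' b1 b2 c1 c2
  have d1 : M ∣ C (- MvPolynomial.eval p g) * f + C (MvPolynomial.eval p f) * g := by
    refine (pM.dvd_or_dvd (null pM (f := L * _) fun x hx => ?_)).resolve_left hML
    by_cases hb : MvPolynomial.eval x L = 0
    · simp [hb]
    · have := hcon p x b1 b2 hx hb
      simp
      right
      linear_combination this
  have d2 : L ∣ C (- MvPolynomial.eval p g) * f + C (MvPolynomial.eval p f) * g := by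
    refine (pL.dvd_or_dvd (null pL (f := M * _) fun x hx => ?_)).resolve_left hLM
    by_cases hb : MvPolynomial.eval x M = 0
    · simp [hb]
    · have := hcon x p' hx hb c1 c2
      simp
      right
      rcases c3 with c3 | c3
      · apply mul_left_cancel₀ c3
        linear_combination MvPolynomial.eval x f * d0 - MvPolynomial.eval p f * this
      · apply mul_left_cancel₀ c3
        linear_combination MvPolynomial.eval x g * d0 - MvPolynomial.eval p g * this
  have d3 : L * M ∣ C (- MvPolynomial.eval p g) * f + C (MvPolynomial.eval p f) * g := by
    obtain ⟨w, hw⟩ := d1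
    rw [hw] at d2 ⊢
    obtain ⟨w', rfl⟩ := (pL.dvd_or_dvd d2).resolve_left hLM
    exact ⟨w', by ring⟩
  have := hind _ _ d3
  rcases b3 with b3 | b3
  · exact b3 this.2
  · exact b3 (neg_eq_zero.1 this.1)

end WlpOdd

namespace WlpOdd
variable {K : Type*} [Field K]

/-- Directional derivative. -/
noncomputable def dd (v : Fin 3 → K) : Derivation K (MvPolynomial (Fin 3) K) (MvPolynomial (Fin 3) K) :=
  mkDerivation K (fun i => C (v i))

theorem dd_add (v w : Fin 3 → K) (f : MvPolynomial (Fin 3) K) : dd (v + w) f = dd v f + dd w f := by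
  have : dd (v + w) = dd v + dd w := by
    apply MvPolynomial.derivation_ext
    intro i
    simp [dd, mkDerivation_X]
  rw [this]; rfl

theorem dd_lin {L : MvPolynomial (Fin 3) K} (hL : L.IsHomogeneous 1) (v : Fin 3 → K) :
    dd v L = C (MvPolynomial.eval v L) := by
  obtain ⟨a, rfl⟩ := hom_one hL
  simp [dd, Derivation.leibniz, mkDerivation_X]

noncomputable def line (p v : Fin 3 → K) : MvPolynomial (Fin 3) K →ₐ[K] Polynomial K :=
  MvPolynomial.aeval (fun i => Polynomial.C (p i) + Polynomial.C (v i) * Polynomial.X)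

theorem eval_line (p v : Fin 3 → K) (f : MvPolynomial (Fin 3) K) (t : K) :
    (line p v f).eval t = MvPolynomial.eval (p + t • v) f := by
  induction f using MvPolynomial.induction_on with
  | C a => simp [line]
  | add f g hf hg => simp [hf, hg]
  | mul_X f i hf =>
    rw [map_mul, Polynomial.eval_mul, hf, map_mul]
    simp [line]
    left; ring

theorem deriv_line (p v : Fin 3 → K) (f : MvPolynomial (Fin 3) K) :
    Polynomial.derivative (line p v f) = line p v (dd v f) := by
  induction f using MvPolynomial.induction_on with
  | C a => simp [line, dd]
  | add f g hf hg => simp [hf, hg]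
  | mul_X f i hf =>
    rw [map_mul, Polynomial.derivative_mul, hf, Derivation.leibniz]
    simp [line, dd, mkDerivation_X]
    ring

theorem key_double [IsAlgClosed K] [CharZero K] (L f g : MvPolynomial (Fin 3) K) (hL : L.IsHomogeneous 1)
    (hL0 : L ≠ 0)
    (hind : ∀ a b : K, L * L ∣ C a * f + C b * g → a = 0 ∧ b = 0)
    (h1 : ¬ L ∣ f) :
    ∃ ℓ : MvPolynomial (Fin 3) K, ℓ.IsHomogeneous 1 ∧
      ∀ u (a b : K), L * L ∣ ℓ * u - C a * f - C b * g → L * L ∣ u := by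
  have pL := lin_prime hL hL0
  suffices ∃ p v, MvPolynomial.eval p L = 0 ∧ MvPolynomial.eval v L ≠ 0 ∧
      MvPolynomial.eval p f * MvPolynomial.eval p (dd v g) ≠
        MvPolynomial.eval p (dd v f) * MvPolynomial.eval p g by
    obtain ⟨p, v, a1, a2, a5⟩ := this
    obtain ⟨ℓ, hl, hl0, hlp, hlv⟩ := exists_lin p v
    refine ⟨ℓ, hl, fun u a b h => ?_⟩
    have := det_kill (ev p) (ev p ∘ₗ (dd v).toLinearMap) (L * L) ℓ f g
      (by simp [ev_apply, a1]) (by simp [ev_apply, a1])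
      (by simp [ev_apply, hlp]) (by simp [ev_apply, hlp, dd_lin hl, hlv])
      (by simpa [ev_apply] using a5) u a b h
    have n1 := not_dvd_of_eval hL hl hl0 v hlv a2
    obtain ⟨r, hr⟩ := this
    obtain ⟨v, rfl⟩ := (pL.dvd_or_dvd (⟨L * r, by rw [hr]; ring⟩ : L ∣ ℓ * u)).resolve_left n1
    have e : ℓ * v = L * r := mul_left_cancel₀ hL0 (by linear_combination hr)
    obtain ⟨w, rfl⟩ := (pL.dvd_or_dvd (⟨r, e⟩ : L ∣ ℓ * v)).resolve_left n1
    exact ⟨w, by ring⟩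
  by_contra! hcon
  obtain ⟨v0, hv0⟩ : ∃ v, MvPolynomial.eval v L ≠ 0 := by
    by_contra! hh
    exact hL0 (MvPolynomial.funext (by simpa using hh))
  have hall : ∀ p v, MvPolynomial.eval p L = 0 →
      MvPolynomial.eval p f * MvPolynomial.eval p (dd v g) =
        MvPolynomial.eval p (dd v f) * MvPolynomial.eval p g := by
    intro p v hp
    by_cases hv : MvPolynomial.eval v L = 0
    · have e1 := hcon p v0 hp hv0
      have e2 := hcon p (v + v0) hp (by rw [eval_add_lin hL, hv, zero_add]; exact hv0)
      rw [dd_add, dd_add, map_add, map_add] at e2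
      linear_combination e2 - e1
    · exact hcon p v hp hv
  obtain ⟨p0, hp0, hf0⟩ := exists_null pL h1
  set h := C (- MvPolynomial.eval p0 g) * f + C (MvPolynomial.eval p0 f) * g with hh
  have hdd : ∀ v, dd v h = C (- MvPolynomial.eval p0 g) * dd v f + C (MvPolynomial.eval p0 f) * dd v g := by
    intro v
    rw [hh, map_add, Derivation.leibniz, Derivation.leibniz]
    simp [dd]
  have hallh : ∀ p v, MvPolynomial.eval p L = 0 →
      MvPolynomial.eval p f * MvPolynomial.eval p (dd v h) =
        MvPolynomial.eval p h * MvPolynomial.eval p (dd v f) := by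
    intro p v hp
    rw [hdd, hh]
    simp only [map_add, map_mul, eval_C]
    linear_combination MvPolynomial.eval p0 f * hall p v hp
  have hLh : L ∣ h := by
    apply null pL
    intro p hp
    have hv : MvPolynomial.eval (p - p0) L = 0 := by
      have := eval_add_lin hL (p - p0) p0
      rw [sub_add_cancel, hp, hp0, add_zero] at this
      exact this.symm
    have hline : ∀ t : K, MvPolynomial.eval (p0 + t • (p - p0)) L = 0 := by
      intro t
      rw [eval_add_lin hL, hp0, zero_add]
      obtain ⟨a, rfl⟩ := hom_one hL
      simp only [map_sum, map_mul, eval_C, eval_X, Pi.smul_apply, smul_eq_mul] at hv ⊢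
      rw [← mul_zero t, ← hv, Finset.mul_sum]
      exact Finset.sum_congr rfl fun i _ => by ring
    have hz : line p0 (p - p0) h = 0 := by
      apply poly_wronskian (line p0 (p - p0) f)
      · rw [deriv_line, deriv_line]
        apply Polynomial.funext
        intro t
        simp only [Polynomial.eval_mul, eval_line]
        exact hallh _ _ (hline t)
      · rw [eval_line]; simpa using hf0
      · rw [eval_line]; simp [hh]; ring
    have := congrArg (Polynomial.eval 1) hz
    rw [eval_line] at this
    simpa using this
  obtain ⟨h', hh'⟩ := hLh
  have hLh' : L ∣ f * h' := by
    apply null pL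
    intro p hp
    have := hallh p v0 hp
    rw [hh', Derivation.leibniz, dd_lin hL] at this
    simp [hp, hv0] at this
    simpa using this
  obtain ⟨w, rfl⟩ := (pL.dvd_or_dvd hLh').resolve_left h1
  exact hf0 (hind _ _ ⟨w, by rw [← hh, hh']; ring⟩).2

theorem quad_factor {q : MvPolynomial (Fin 3) K} (hq : q.IsHomogeneous 2) (h0 : q ≠ 0)
    (hirr : ¬ Irreducible q) : ∃ L M : MvPolynomial (Fin 3) K, L.IsHomogeneous 1 ∧ M.IsHomogeneous 1 ∧
      q = L * M := by
  have hu : ¬ IsUnit q := by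
    intro h
    have := (isUnit_iff_totalDegree_of_isReduced.1 h).2
    rw [hq.totalDegree h0] at this
    omega
  rw [irreducible_iff] at hirr
  push Not at hirr
  obtain ⟨a, b, hab, ha, hb⟩ := hirr hu
  have ha0 : a ≠ 0 := by rintro rfl; simp at hab; exact h0 hab
  have hb0 : b ≠ 0 := by rintro rfl; simp at hab; exact h0 hab
  have hdeg := hq.totalDegree h0
  rw [hab, totalDegree_mul_of_isDomain ha0 hb0] at hdeg
  have nu : ∀ c : MvPolynomial (Fin 3) K, c ≠ 0 → ¬ IsUnit c → c.totalDegree ≠ 0 := by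
    intro c hc hcu hd
    apply hcu
    rw [totalDegree_eq_zero_iff_eq_C] at hd
    rw [isUnit_iff_eq_C_of_isReduced]
    refine ⟨_, ?_, hd⟩
    rw [isUnit_iff_ne_zero]
    intro h; rw [h] at hd; exact hc (by simpa using hd)
  have hda : a.totalDegree = 1 := by have := nu a ha0 ha; have := nu b hb0 hb; omega
  have hdb : b.totalDegree = 1 := by have := nu a ha0 ha; have := nu b hb0 hb; omega
  have dec : ∀ c : MvPolynomial (Fin 3) K, c.totalDegree = 1 →
      c = homogeneousComponent 0 c + homogeneousComponent 1 c := by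
    intro c hc
    conv_lhs => rw [← sum_homogeneousComponent c]
    rw [hc, Finset.sum_range_succ, Finset.sum_range_one]
  refine ⟨homogeneousComponent 1 a, homogeneousComponent 1 b, homogeneousComponent_isHomogeneous _ _,
    homogeneousComponent_isHomogeneous _ _, ?_⟩
  have e : q = homogeneousComponent 0 a * homogeneousComponent 0 b +
      (homogeneousComponent 0 a * homogeneousComponent 1 b +
       homogeneousComponent 1 a * homogeneousComponent 0 b) +
      homogeneousComponent 1 a * homogeneousComponent 1 b := by
    rw [hab]
    conv_lhs => rw [dec a hda, dec b hdb]
    ring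
  have H : ∀ (c : MvPolynomial (Fin 3) K) (i : ℕ), (homogeneousComponent i c).IsHomogeneous i :=
    fun c i => homogeneousComponent_isHomogeneous _ _
  have e2 := congrArg (homogeneousComponent 2) e
  rw [homogeneousComponent_eq_self hq, map_add, map_add,
    homogeneousComponent_of_mem ((H a 0).mul (H b 0)),
    homogeneousComponent_of_mem (n := 1) (Submodule.add_mem _ (by simpa using (H a 0).mul (H b 1)) (by simpa using (H a 1).mul (H b 0))),
    homogeneousComponent_of_mem ((H a 1).mul (H b 1))] at e2
  simpa using e2

theorem key [IsAlgClosed K] [CharZero K] (q f g : MvPolynomial (Fin 3) K) (hq : q.IsHomogeneous 2)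
    (hq0 : q ≠ 0) (hind : ∀ a b : K, q ∣ C a * f + C b * g → a = 0 ∧ b = 0) :
    (∃ ℓ : MvPolynomial (Fin 3) K, ℓ.IsHomogeneous 1 ∧
      ∀ u (a b : K), q ∣ ℓ * u - C a * f - C b * g → q ∣ u) ∨
    (∃ L M : MvPolynomial (Fin 3) K, L.IsHomogeneous 1 ∧ M.IsHomogeneous 1 ∧
      q = L * M ∧ L ∣ f ∧ L ∣ g) := by
  by_cases hirr : Irreducible q
  · exact Or.inl (key_irred q f g hq (irreducible_iff_prime.1 hirr) hind)
  obtain ⟨L, M, hL, hM, rfl⟩ := quad_factor hq hq0 hirr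
  have hL0 := left_ne_zero_of_mul hq0
  have hM0 := right_ne_zero_of_mul hq0
  by_cases h1 : L ∣ f ∧ L ∣ g
  · exact Or.inr ⟨L, M, hL, hM, rfl, h1.1, h1.2⟩
  by_cases h2 : M ∣ f ∧ M ∣ g
  · exact Or.inr ⟨M, L, hM, hL, mul_comm _ _, h2.1, h2.2⟩
  left
  by_cases hLM : L ∣ M
  · obtain ⟨c, hc, rfl⟩ := lin_dvd hL hM hLM hM0
    have hun : IsUnit (C c : MvPolynomial (Fin 3) K) := (isUnit_iff_ne_zero.2 hc).map C
    have hdv : ∀ x, L * (C c * L) ∣ x ↔ L * L ∣ x := by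
      intro x
      rw [show L * (C c * L) = C c * (L * L) by ring, hun.mul_left_dvd]
    simp only [hdv] at hind ⊢
    by_cases h3 : L ∣ f
    · obtain ⟨ℓ, hl, H⟩ := key_double L g f hL hL0
        (fun a b h => (hind b a (by rwa [add_comm])).symm) (fun h4 => h1 ⟨h3, h4⟩)
      exact ⟨ℓ, hl, fun u a b h => H u b a (by rwa [sub_right_comm])⟩
    · exact key_double L f g hL hL0 hind h3
  · exact key_two L M f g hL hM hL0 hM0 hLM hind h1 h2

end WlpOdd

namespace WlpOdd
variable {K : Type*} [Field K]

section LA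
variable {E : Type*} [AddCommGroup E] [Module K E]

theorem finrank_quot (V W : Submodule K E) (hVW : V ≤ W) [FiniteDimensional K W] :
    Module.finrank K (W ⧸ V.submoduleOf W) + Module.finrank K V = Module.finrank K W := by
  rw [← (Submodule.submoduleOfEquivOfLe hVW).finrank_eq]
  exact Submodule.finrank_quotient_add_finrank _

theorem la2 (V W : Submodule K E) (hVW : V ≤ W) [FiniteDimensional K W]
    (h : Module.finrank K W = Module.finrank K V + 2) :
    ∃ f ∈ W, ∃ g ∈ W, (∀ a b : K, a • f + b • g ∈ V → a = 0 ∧ b = 0) ∧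
      ∀ w ∈ W, ∃ a b : K, w - a • f - b • g ∈ V := by
  have h2 : Module.finrank K (W ⧸ V.submoduleOf W) = 2 := by
    have := finrank_quot V W hVW
    omega
  let B := Module.finBasisOfFinrankEq K _ h2
  obtain ⟨f, hf⟩ := Submodule.mkQ_surjective _ (B 0)
  obtain ⟨g, hg⟩ := Submodule.mkQ_surjective _ (B 1)
  refine ⟨f, f.2, g, g.2, ?_, ?_⟩
  · intro a b hab
    have : (V.submoduleOf W).mkQ (a • f + b • g) = 0 := by
      rw [Submodule.mkQ_apply, Submodule.Quotient.mk_eq_zero]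
      exact hab
    rw [map_add, map_smul, map_smul, hf, hg] at this
    have li := Fintype.linearIndependent_iff.1 B.linearIndependent ![a, b]
      (by simpa [Fin.sum_univ_two] using this)
    exact ⟨by simpa using li 0, by simpa using li 1⟩
  · intro w hw
    have := B.sum_repr ((V.submoduleOf W).mkQ ⟨w, hw⟩)
    rw [Fin.sum_univ_two, ← hf, ← hg, ← map_smul, ← map_smul, ← map_add, eq_comm, ← sub_eq_zero,
      ← map_sub, Submodule.mkQ_apply, Submodule.Quotient.mk_eq_zero] at this
    refine ⟨B.repr ((V.submoduleOf W).mkQ ⟨w, hw⟩) 0, B.repr ((V.submoduleOf W).mkQ ⟨w, hw⟩) 1, ?_⟩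
    rw [sub_sub]
    exact this

theorem la3 (V W : Submodule K E) (hVW : V ≤ W) [FiniteDimensional K W] (x y z : E)
    (hx : x ∈ W) (hy : y ∈ W) (hz : z ∈ W)
    (h : ∀ a b c : K, a • x + b • y + c • z ∈ V → a = 0 ∧ b = 0 ∧ c = 0) :
    Module.finrank K V + 3 ≤ Module.finrank K W := by
  have := finrank_quot V W hVW
  have li : LinearIndependent K ![(V.submoduleOf W).mkQ ⟨x, hx⟩, (V.submoduleOf W).mkQ ⟨y, hy⟩,
      (V.submoduleOf W).mkQ ⟨z, hz⟩] := by
    rw [Fintype.linearIndependent_iff]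
    intro c hc
    simp only [Fin.sum_univ_three, Matrix.cons_val_zero, Matrix.cons_val_one, Matrix.cons_val] at hc
    rw [← map_smul, ← map_smul, ← map_smul, ← map_add, ← map_add, Submodule.mkQ_apply,
      Submodule.Quotient.mk_eq_zero] at hc
    obtain ⟨h0, h1, h2⟩ := h (c 0) (c 1) (c 2) hc
    intro i
    fin_cases i <;> assumption
  have h3 := li.fintype_card_le_finrank
  simp at h3
  omega

theorem rank_bound {X Y : Type*} [AddCommGroup X] [Module K X] [AddCommGroup Y] [Module K Y]
    [FiniteDimensional K X] [FiniteDimensional K Y] (B : X →ₗ[K] Module.Dual K Y)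
    (W : Submodule K Y) (hW : ∀ x, ∀ w ∈ W, B x w = 0) :
    Module.finrank K X + Module.finrank K W ≤
      Module.finrank K (LinearMap.ker B) + Module.finrank K Y := by
  have h1 := LinearMap.finrank_range_add_finrank_ker B
  have h2 := Subspace.finrank_add_finrank_dualAnnihilator_eq W
  have h3 : LinearMap.range B ≤ W.dualAnnihilator := by
    rintro _ ⟨x, rfl⟩
    rw [Submodule.mem_dualAnnihilator]
    exact hW x
  have h4 := Submodule.finrank_mono h3
  omega

end LA

abbrev Rk (K : Type*) [Field K] (k : ℕ) : Submodule K (MvPolynomial (Fin 3) K) :=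
  homogeneousSubmodule (Fin 3) K k

instance (k : ℕ) : FiniteDimensional K (Rk K k) :=
  Module.Finite.iff_fg.2 (homogeneousSubmodule_fg _ _ _)

theorem finrank_Rk (k : ℕ) : Module.finrank K (Rk K k) = (k + 2).choose 2 := by
  rw [Rk, homogeneousSubmodule_eq_finsupp_supported]
  have hs : {d : Fin 3 →₀ ℕ | d.degree = k} = ((Finset.univ : Finset (Fin 3)).finsuppAntidiag k : Set _) := by
    ext d
    simp [Finset.mem_finsuppAntidiag, Finsupp.degree_eq_sum]
  rw [hs, (AddMonoidAlgebra.supportedEquivFinsupp _).finrank_eq, Module.finrank_finsupp_self]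
  simp only [Finset.coe_sort_coe, Fintype.card_coe]
  rw [Finset.card_finsuppAntidiag_nat_eq_choose, Finset.card_univ, Fintype.card_fin,
    show 3 + k - 1 = k + 2 by omega]
  exact Nat.choose_symm_add

theorem finrank_Rk_succ (k : ℕ) :
    Module.finrank K (Rk K (k + 1)) = Module.finrank K (Rk K k) + (k + 2) := by
  rw [finrank_Rk, finrank_Rk, Nat.choose_succ_succ' (k + 2) 1, Nat.choose_one_right]
  ring

/-- `p * R_k` -/
noncomputable def mulSub (p : MvPolynomial (Fin 3) K) (k : ℕ) : Submodule K (MvPolynomial (Fin 3) K) :=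
  (Rk K k).map (LinearMap.mulLeft K p)

theorem finrank_map_mul (p : MvPolynomial (Fin 3) K) (hp : p ≠ 0) (V : Submodule K (MvPolynomial (Fin 3) K)) :
    Module.finrank K (V.map (LinearMap.mulLeft K p)) = Module.finrank K V := by
  exact (Submodule.equivMapOfInjective _ (mul_right_injective₀ hp) V).finrank_eq.symm

theorem mulSub_le {p : MvPolynomial (Fin 3) K} {e : ℕ} (hp : p.IsHomogeneous e) (k j : ℕ) (hj : e + k = j) :
    mulSub p k ≤ Rk K j := by
  rintro _ ⟨u, hu, rfl⟩
  subst hj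
  exact hp.mul hu

theorem comp_mul {p : MvPolynomial (Fin 3) K} {e : ℕ} (hp : p.IsHomogeneous e) (k : ℕ)
    (r : MvPolynomial (Fin 3) K) :
    homogeneousComponent (e + k) (p * r) = p * homogeneousComponent k r := by
  induction r using MvPolynomial.induction_on' with
  | monomial d a =>
    have hd : (monomial d a : MvPolynomial (Fin 3) K).IsHomogeneous d.degree :=
      isHomogeneous_monomial a rfl
    rw [homogeneousComponent_of_mem (hp.mul hd), homogeneousComponent_of_mem hd]
    simp
  | add f g hf hg => rw [mul_add, map_add, map_add, hf, hg, mul_add]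

theorem mem_mulSub {p u : MvPolynomial (Fin 3) K} {e k j : ℕ} (hp : p.IsHomogeneous e)
    (hu : u.IsHomogeneous j) (hj : e + k = j) (h : p ∣ u) : u ∈ mulSub p k := by
  obtain ⟨r, rfl⟩ := h
  refine ⟨homogeneousComponent k r, homogeneousComponent_isHomogeneous _ _, ?_⟩
  rw [LinearMap.mulLeft_apply, ← comp_mul hp, hj, homogeneousComponent_eq_self hu]

/-- `I_k` -/
noncomputable def Ik (I : Ideal (MvPolynomial (Fin 3) K)) (k : ℕ) : Submodule K (MvPolynomial (Fin 3) K) :=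
  Rk K k ⊓ I.restrictScalars K

theorem mem_Ik {I : Ideal (MvPolynomial (Fin 3) K)} {k : ℕ} {u : MvPolynomial (Fin 3) K} :
    u ∈ Ik I k ↔ u.IsHomogeneous k ∧ u ∈ I := Iff.rfl

instance (I : Ideal (MvPolynomial (Fin 3) K)) (k : ℕ) : FiniteDimensional K (Ik I k) :=
  Submodule.finiteDimensional_of_le (inf_le_left : Ik I k ≤ Rk K k)

theorem finrank_Ik (I : Ideal (MvPolynomial (Fin 3) K)) (k : ℕ) :
    hf I k + Module.finrank K (Ik I k) = Module.finrank K (Rk K k) := by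
  set φ := ((Ideal.Quotient.mkₐ K I).toLinearMap).domRestrict (Rk K k) with hφ
  have h1 := LinearMap.finrank_range_add_finrank_ker φ
  have h2 : LinearMap.range φ = piece I k := by
    rw [hφ, LinearMap.range_domRestrict]; rfl
  have h3 : (LinearMap.ker φ).map (Rk K k).subtype = Ik I k := by
    ext u
    simp only [Submodule.mem_map, LinearMap.mem_ker, Submodule.coe_subtype, Subtype.exists, mem_Ik]
    constructor
    · rintro ⟨a, ha, h, rfl⟩
      exact ⟨ha, Ideal.Quotient.eq_zero_iff_mem.1 h⟩
    · rintro ⟨ha, h⟩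
      exact ⟨u, ha, Ideal.Quotient.eq_zero_iff_mem.2 h, rfl⟩
  rw [← h3, Submodule.finrank_map_subtype_eq, hf, ← h2]
  exact h1

theorem soc {I : Ideal (MvPolynomial (Fin 3) K)} {d : ℕ} (hAG : IsArtinianGorenstein I d)
    {a : MvPolynomial (Fin 3) K} {i : ℕ} (ha : a.IsHomogeneous i) (hi : i ≠ d)
    (h : ∀ j, X j * a ∈ I) : a ∈ I := by
  have h1 : Ideal.Quotient.mk I a ∈ socle I := by
    rw [socle, Submodule.mem_iInf]
    intro j
    rw [LinearMap.mem_ker, LinearMap.mulLeft_apply, ← map_mul]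
    exact Ideal.Quotient.eq_zero_iff_mem.2 (h j)
  obtain ⟨b, hb, hab⟩ := hAG.2.2.2.2.2 h1
  have h2 : b - a ∈ I := (Ideal.Quotient.mk_eq_mk_iff_sub_mem _ _).1 hab
  have h3 := hAG.1 _ h2 i
  rw [map_sub, homogeneousComponent_of_mem hb, homogeneousComponent_eq_self ha, if_neg hi, zero_sub] at h3
  exact neg_mem_iff.1 h3

theorem soc_iter {I : Ideal (MvPolynomial (Fin 3) K)} {d : ℕ} (hAG : IsArtinianGorenstein I d)
    (k : ℕ) : ∀ (a : MvPolynomial (Fin 3) K) (i : ℕ), a.IsHomogeneous i → i + k = d →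
    (∀ b : MvPolynomial (Fin 3) K, b.IsHomogeneous k → a * b ∈ I) → a ∈ I := by
  induction k with
  | zero =>
    intro a i _ _ h
    simpa using h 1 (isHomogeneous_one _ _)
  | succ k ih =>
    intro a i ha hi h
    apply soc hAG ha (by omega)
    intro j
    apply ih (X j * a) (i + 1) (by rw [add_comm]; exact (isHomogeneous_X _ j).mul ha) (by omega)
    intro b hb
    have := h (X j * b) (by rw [add_comm]; exact (isHomogeneous_X _ j).mul hb)
    convert this using 1
    ring

theorem hom_succ {b : MvPolynomial (Fin 3) K} {i : ℕ} (hb : b.IsHomogeneous (i + 1)) :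
    ∃ c : Fin 3 → MvPolynomial (Fin 3) K, (∀ j, (c j).IsHomogeneous i) ∧ b = ∑ j, X j * c j := by
  have h : b ∈ homogeneousSubmodule (Fin 3) K 1 * homogeneousSubmodule (Fin 3) K i := by
    have e : homogeneousSubmodule (Fin 3) K 1 * homogeneousSubmodule (Fin 3) K i =
        homogeneousSubmodule (Fin 3) K (i + 1) := by
      rw [← homogeneousSubmodule_one_pow (R := K) (n := i), ← pow_succ',
        homogeneousSubmodule_one_pow]
    rw [e]
    exact hb
  induction h using Submodule.mul_induction_on' with
  | mem_mul_mem x hx y hy =>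
    obtain ⟨a, rfl⟩ := hom_one hx
    refine ⟨fun j => C (a j) * y, fun j => IsHomogeneous.C_mul hy _, ?_⟩
    rw [Finset.sum_mul]
    exact Finset.sum_congr rfl fun j _ => by ring
  | add x hx y hy hx' hy' =>
    have mm : ∀ z ∈ homogeneousSubmodule (Fin 3) K 1 * homogeneousSubmodule (Fin 3) K i,
        z.IsHomogeneous (i + 1) := by
      intro z hz
      rw [add_comm]
      exact homogeneousSubmodule_mul 1 i hz
    obtain ⟨c, hc, ec⟩ := hx' (mm x hx)
    obtain ⟨c', hc', ec'⟩ := hy' (mm y hy)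
    refine ⟨fun j => c j + c' j, fun j => (hc j).add (hc' j), ?_⟩
    rw [ec, ec', ← Finset.sum_add_distrib]
    exact Finset.sum_congr rfl fun j _ => by ring

theorem wlp_of_inj {I : Ideal (MvPolynomial (Fin 3) K)} {m : ℕ}
    (hAG : IsArtinianGorenstein I (2 * m + 1)) (h1 : hf I m = 2 * m + 1)
    (h2 : hf I (m + 1) = 2 * m + 1) (ℓ : MvPolynomial (Fin 3) K) (hl : ℓ.IsHomogeneous 1)
    (hinj : ∀ u : MvPolynomial (Fin 3) K, u.IsHomogeneous m → ℓ * u ∈ I → u ∈ I) : WLP I := by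
  have hinj' : ∀ k i, i + k = m →
      ∀ u : MvPolynomial (Fin 3) K, u.IsHomogeneous i → ℓ * u ∈ I → u ∈ I := by
    intro k
    induction k with
    | zero => intro i hi; obtain rfl : i = m := by omega
              exact hinj
    | succ k ih =>
      intro i hi u hu hlu
      apply soc hAG hu (by omega)
      intro j
      apply ih (i + 1) (by omega) _ (by rw [add_comm]; exact (isHomogeneous_X _ j).mul hu)
      have := I.mul_mem_left (X j) hlu
      convert this using 1
      ring
  have hsurj : ∀ k, ∀ b : MvPolynomial (Fin 3) K, b.IsHomogeneous (m + k + 1) →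
      ∃ a : MvPolynomial (Fin 3) K, a.IsHomogeneous (m + k) ∧ ℓ * a - b ∈ I := by
    intro k
    induction k with
    | zero =>
      intro b hb
      set V := (piece I m).map (LinearMap.mulLeft K (Ideal.Quotient.mk I ℓ)) with hV
      have hle : V ≤ piece I (m + 1) := by
        rintro _ ⟨_, ⟨u, hu, rfl⟩, rfl⟩
        refine ⟨ℓ * u, ?_, ?_⟩
        · have := hl.mul (hu : u.IsHomogeneous m)
          rw [add_comm] at this
          exact this
        · simp
      have : FiniteDimensional K (piece I (m + 1)) := by
        rw [piece]
        infer_instance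
      have hVf : Module.finrank K V = 2 * m + 1 := by
        have e : V = LinearMap.range ((LinearMap.mulLeft K (Ideal.Quotient.mk I ℓ)).domRestrict (piece I m)) := by
          rw [LinearMap.range_domRestrict]
        rw [e, ← h1, hf]
        apply LinearMap.finrank_range_of_inj
        rw [← LinearMap.ker_eq_bot, LinearMap.ker_eq_bot']
        rintro ⟨_, u, hu, rfl⟩ h
        have h' : ℓ * u ∈ I := by
          apply Ideal.Quotient.eq_zero_iff_mem.1
          rw [map_mul]
          exact h
        exact Subtype.ext (Ideal.Quotient.eq_zero_iff_mem.2 (hinj u hu h'))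
      have hEq := Submodule.eq_of_le_of_finrank_eq hle (by rw [hVf]; exact h2.symm)
      have hbV : Ideal.Quotient.mk I b ∈ V := by
        rw [hEq]; exact ⟨b, hb, rfl⟩
      obtain ⟨_, ⟨u, hu, rfl⟩, hub⟩ := hbV
      refine ⟨u, hu, (Ideal.Quotient.mk_eq_mk_iff_sub_mem _ _).1 ?_⟩
      rw [map_mul]
      exact hub
    | succ k ih =>
      intro b hb
      obtain ⟨c, hc, rfl⟩ := hom_succ hb
      choose a ha hab using fun j => ih (c j) (hc j)
      refine ⟨∑ j, X j * a j, ?_, ?_⟩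
      · apply IsHomogeneous.sum
        intro j _
        have := (isHomogeneous_X K j).mul (ha j)
        rw [add_comm] at this
        exact this
      · rw [Finset.mul_sum, ← Finset.sum_sub_distrib]
        apply Ideal.sum_mem
        intro j _
        have := I.mul_mem_left (X j) (hab j)
        convert this using 1
        ring
  refine ⟨ℓ, hl, fun i => ?_⟩
  rcases le_or_gt i m with hi | hi
  · left
    rintro _ ⟨u, hu, rfl⟩ h
    apply Ideal.Quotient.eq_zero_iff_mem.2
    apply hinj' (m - i) i (by omega) u hu
    apply Ideal.Quotient.eq_zero_iff_mem.1
    rw [map_mul]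
    exact h
  · right
    rintro _ ⟨b, hb, rfl⟩
    obtain ⟨k, rfl⟩ := Nat.exists_eq_add_of_lt hi
    obtain ⟨a, ha, hab⟩ := hsurj (k + 1) b hb
    refine ⟨Ideal.Quotient.mk I a, ⟨a, ha, rfl⟩, ?_⟩
    rw [← map_mul]
    exact (Ideal.Quotient.mk_eq_mk_iff_sub_mem _ _).2 hab

end WlpOdd

namespace WlpOdd
variable {K : Type*} [Field K]

theorem exists_functional {I : Ideal (MvPolynomial (Fin 3) K)} {d : ℕ} (h : hf I d = 1) :
    ∃ π : (MvPolynomial (Fin 3) K ⧸ I) →ₗ[K] K, ∀ u : MvPolynomial (Fin 3) K, u.IsHomogeneous d →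
      π (Ideal.Quotient.mk I u) = 0 → u ∈ I := by
  have h1 : Module.finrank K (piece I d) = Module.finrank K K := by
    rw [Module.finrank_self]; exact h
  have : FiniteDimensional K (piece I d) := by
    rw [piece]
    infer_instance
  let e := LinearEquiv.ofFinrankEq _ _ h1
  obtain ⟨π, hπ⟩ := LinearMap.exists_extend e.toLinearMap
  refine ⟨π, fun u hu h0 => ?_⟩
  have hm : Ideal.Quotient.mk I u ∈ piece I d := ⟨u, hu, rfl⟩
  have h2 := LinearMap.congr_fun hπ ⟨_, hm⟩
  have h3 : e ⟨_, hm⟩ = 0 := by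
    rw [← h0]; exact h2.symm
  rw [LinearEquiv.map_eq_zero_iff] at h3
  exact Ideal.Quotient.eq_zero_iff_mem.1 (congrArg Subtype.val h3)

/-- The degree `k` part of `I : L`. -/
noncomputable def Jk (I : Ideal (MvPolynomial (Fin 3) K)) (L : MvPolynomial (Fin 3) K) (k : ℕ) :
    Submodule K (MvPolynomial (Fin 3) K) :=
  Rk K k ⊓ (I.restrictScalars K).comap (LinearMap.mulLeft K L)

theorem mem_Jk {I : Ideal (MvPolynomial (Fin 3) K)} {L : MvPolynomial (Fin 3) K} {k : ℕ}
    {u : MvPolynomial (Fin 3) K} :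
    u ∈ Jk I L k ↔ u.IsHomogeneous k ∧ L * u ∈ I := Iff.rfl

instance (I : Ideal (MvPolynomial (Fin 3) K)) (L : MvPolynomial (Fin 3) K) (k : ℕ) :
    FiniteDimensional K (Jk I L k) :=
  Submodule.finiteDimensional_of_le (inf_le_left : Jk I L k ≤ Rk K k)

theorem finrank_Jk_le {I : Ideal (MvPolynomial (Fin 3) K)} {L : MvPolynomial (Fin 3) K}
    (hL : L.IsHomogeneous 1) (hL0 : L ≠ 0) (k : ℕ) :
    Module.finrank K (Jk I L k) ≤ Module.finrank K (Ik I (k + 1)) := by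
  rw [← finrank_map_mul L hL0]
  apply Submodule.finrank_mono
  rintro _ ⟨u, hu, rfl⟩
  refine mem_Ik.2 ⟨?_, hu.2⟩
  rw [add_comm]
  exact hL.mul hu.1

theorem dual_bound {I : Ideal (MvPolynomial (Fin 3) K)} {n : ℕ}
    (hAG : IsArtinianGorenstein I (2 * (n + 1) + 1)) {L : MvPolynomial (Fin 3) K}
    (hL : L.IsHomogeneous 1) :
    Module.finrank K (Rk K n) + Module.finrank K (Jk I L (n + 2)) ≤
      Module.finrank K (Jk I L n) + Module.finrank K (Rk K (n + 2)) := by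
  obtain ⟨π, hπ⟩ := exists_functional hAG.2.1
  let B : Rk K n →ₗ[K] Module.Dual K (Rk K (n + 2)) :=
    LinearMap.mk₂ K (fun a b => π (Ideal.Quotient.mkₐ K I (L * a * b)))
      (by intro a b c; simp [mul_add, add_mul])
      (by intro c a b; simp)
      (by intro a b c; simp [mul_add])
      (by intro c a b; simp)
  have hB : ∀ a b, B a b = π (Ideal.Quotient.mk I (L * a * b)) := fun a b => rfl
  have h1 := rank_bound B ((Jk I L (n + 2)).submoduleOf (Rk K (n + 2))) (by
    intro a b hb
    have hb' : L * (b : MvPolynomial (Fin 3) K) ∈ I := hb.2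
    rw [hB, Ideal.Quotient.eq_zero_iff_mem.2, map_zero]
    rw [mul_right_comm]
    exact I.mul_mem_right _ hb')
  have hle : Jk I L (n + 2) ≤ Rk K (n + 2) := inf_le_left
  rw [(Submodule.submoduleOfEquivOfLe hle).finrank_eq] at h1
  have h2 : Module.finrank K (LinearMap.ker B) ≤ Module.finrank K (Jk I L n) := by
    rw [← Submodule.finrank_map_subtype_eq]
    apply Submodule.finrank_mono
    rintro _ ⟨a, ha, rfl⟩
    refine mem_Jk.2 ⟨a.2, ?_⟩
    have hLa : (L * (a : MvPolynomial (Fin 3) K)).IsHomogeneous (1 + n) := hL.mul a.2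
    apply soc_iter hAG (n + 2) _ (1 + n) hLa (by omega)
    intro b hb
    apply hπ
    · convert hLa.mul hb using 1
      omega
    · exact LinearMap.congr_fun (LinearMap.mem_ker.1 ha) ⟨b, hb⟩
  omega

theorem grow [IsAlgClosed K] {I : Ideal (MvPolynomial (Fin 3) K)} {n : ℕ} {L M f g : MvPolynomial (Fin 3) K}
    (hM : M.IsHomogeneous 1) (hM0 : M ≠ 0) (hLM : L * M ∈ I)
    (hf : f.IsHomogeneous (n + 1)) (hg : g.IsHomogeneous (n + 1))
    (hfI : L * f ∈ I) (hgI : L * g ∈ I)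
    (hind : ∀ a b : K, M ∣ C a * f + C b * g → a = 0 ∧ b = 0) :
    Module.finrank K (Rk K (n + 1)) + 3 ≤ Module.finrank K (Jk I L (n + 2)) := by
  have pM := lin_prime hM hM0
  have hMf : ¬ M ∣ f := fun h => by
    have := hind 1 0 (by simpa using h)
    simp at this
  obtain ⟨e, heM, hef⟩ := exists_null pM hMf
  obtain ⟨j, hj⟩ : ∃ j, e j ≠ 0 := by
    by_contra! hh
    obtain ⟨c, hc, rfl⟩ := hom_succ hf
    apply hef
    simp [hh]
  -- a point of `V(M)` with vanishing `j`-th coordinate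
  obtain ⟨p, hp0, hpM, hpj⟩ : ∃ p : Fin 3 → K, p ≠ 0 ∧ MvPolynomial.eval p M = 0 ∧ p j = 0 := by
    obtain ⟨a, rfl⟩ := hom_one hM
    obtain ⟨s, hs, hs0, h1, h2⟩ := exists_lin a (Pi.single j 1)
    obtain ⟨p, rfl⟩ := hom_one hs
    refine ⟨p, ?_, ?_, ?_⟩
    · rintro rfl; simp at hs0
    · simp at h1 ⊢
      rw [← h1]
      exact Finset.sum_congr rfl fun i _ => by ring
    · simpa [Pi.single_apply] using h2
  obtain ⟨k, hk⟩ : ∃ k, p k ≠ 0 := by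
    by_contra! hh
    exact hp0 (funext hh)
  set s : MvPolynomial (Fin 3) K := C (e j) * X k - C (e k) * X j with hs
  have hshom : s.IsHomogeneous 1 := (isHomogeneous_C_mul_X _ _).sub (isHomogeneous_C_mul_X _ _)
  have hse : MvPolynomial.eval e s = 0 := by simp [hs]; ring
  have hMs : ¬ M ∣ s := by
    rintro ⟨r, hr⟩
    have := congrArg (MvPolynomial.eval p) hr
    simp [hs, hpM, hpj] at this
    exact this.elim hj hk
  have hsub : mulSub M (n + 1) ≤ Jk I L (n + 2) := by
    intro u hu
    refine ⟨mulSub_le hM (n + 1) (n + 2) (by omega) hu, ?_⟩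
    obtain ⟨v, hv, rfl⟩ := hu
    have := I.mul_mem_right v hLM
    rw [mul_assoc] at this
    exact this
  have hJ : ∀ (l u : MvPolynomial (Fin 3) K), l.IsHomogeneous 1 → u.IsHomogeneous (n + 1) →
      L * u ∈ I → l * u ∈ Jk I L (n + 2) := by
    intro l u hl hu huI
    refine mem_Jk.2 ⟨?_, ?_⟩
    · convert hl.mul hu using 1
      omega
    · rw [mul_left_comm]; exact I.mul_mem_left _ huI
  have h3 := la3 (mulSub M (n + 1)) (Jk I L (n + 2)) hsub (s * f) (s * g) (X j * f)
    (hJ _ _ hshom hf hfI) (hJ _ _ hshom hg hgI) (hJ _ _ (isHomogeneous_X _ _) hf hfI) (by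
      intro a b c habc
      obtain ⟨r, -, hr⟩ := habc
      simp only [LinearMap.mulLeft_apply, MvPolynomial.smul_eq_C_mul] at hr
      have hc : c = 0 := by
        have := congrArg (MvPolynomial.eval e) hr
        simp [heM, hse, hj, hef] at this
        exact this
      subst hc
      have : M ∣ s * (C a * f + C b * g) := ⟨r, by rw [hr]; simp; ring⟩
      have := hind a b ((pM.dvd_or_dvd this).resolve_left hMs)
      exact ⟨this.1, this.2, rfl⟩)
  rw [mulSub, finrank_map_mul M hM0] at h3
  exact h3

theorem main_succ [IsAlgClosed K] [CharZero K] (n : ℕ)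
    (I : Ideal (MvPolynomial (Fin 3) K))
    (hAG : IsArtinianGorenstein I (2 * (n + 1) + 1))
    (h1 : hf I (n + 1) = 2 * (n + 1) + 1) (h2 : hf I (n + 2) = 2 * (n + 1) + 1)
    (hq : hf I 2 < 6) : WLP I := by
  have f1 := finrank_Ik I (n + 1)
  have f2 := finrank_Ik I (n + 2)
  have r0 := finrank_Rk_succ (K := K) n
  have r1 := finrank_Rk_succ (K := K) (n + 1)
  have hI2 : Ik I 2 ≠ ⊥ := by
    intro h
    have f3 := finrank_Ik I 2
    rw [h, finrank_bot, finrank_Rk] at f3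
    simp [Nat.choose] at f3
    omega
  obtain ⟨q, ⟨hq2, hqI⟩, hq0⟩ := (Submodule.ne_bot_iff _).1 hI2
  replace hq2 : q.IsHomogeneous 2 := hq2
  replace hqI : q ∈ I := hqI
  have hsub : mulSub q n ≤ Ik I (n + 2) := by
    intro u hu
    refine mem_Ik.2 ⟨mulSub_le hq2 n (n + 2) (by omega) hu, ?_⟩
    obtain ⟨v, hv, rfl⟩ := hu
    exact I.mul_mem_right v hqI
  have hrank : Module.finrank K (mulSub q n) = Module.finrank K (Rk K n) := finrank_map_mul q hq0 _
  obtain ⟨f, hfm, g, hgm, hind, hspan⟩ := la2 (mulSub q n) (Ik I (n + 2)) hsub (by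
    rw [hrank]
    rw [show n + 1 + 1 = n + 2 from rfl] at r1
    omega)
  rw [mem_Ik] at hfm hgm
  have hind' : ∀ a b : K, q ∣ C a * f + C b * g → a = 0 ∧ b = 0 := by
    intro a b h
    apply hind
    rw [MvPolynomial.smul_eq_C_mul, MvPolynomial.smul_eq_C_mul]
    exact mem_mulSub hq2 ((hfm.1.C_mul a).add (hgm.1.C_mul b)) (by omega) h
  rcases key q f g hq2 hq0 hind' with ⟨ℓ, hl, H⟩ | ⟨L, M, hL, hM, rfl, ⟨f', rfl⟩, ⟨g', rfl⟩⟩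
  · apply wlp_of_inj hAG h1 h2 ℓ hl
    intro u hu hlu
    have hm : ℓ * u ∈ Ik I (n + 2) := mem_Ik.2 ⟨by convert hl.mul hu using 1; omega, hlu⟩
    obtain ⟨a, b, hab⟩ := hspan _ hm
    obtain ⟨r, -, hr⟩ := hab
    rw [MvPolynomial.smul_eq_C_mul, MvPolynomial.smul_eq_C_mul] at hr
    exact I.mem_of_dvd (H u a b ⟨r, hr.symm⟩) hqI
  · exfalso
    have hL0 := left_ne_zero_of_mul hq0
    have hM0 := right_ne_zero_of_mul hq0
    have hhom : ∀ u : MvPolynomial (Fin 3) K, (L * u).IsHomogeneous (n + 2) → u.IsHomogeneous (n + 1) := by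
      intro u hu
      obtain ⟨v, hv, e⟩ := mem_mulSub (k := n + 1) hL hu (by omega) ⟨u, rfl⟩
      have : v = u := mul_left_cancel₀ hL0 e
      rw [← this]
      exact hv
    have g1 := grow (n := n) hM hM0 hqI (hhom _ hfm.1) (hhom _ hgm.1) hfm.2 hgm.2 (by
      rintro a b ⟨r, hr⟩
      exact hind' a b ⟨r, by linear_combination L * hr⟩)
    have g2 := dual_bound hAG hL
    have g3 := finrank_Jk_le (I := I) hL hL0 n
    rw [show n + 1 + 1 = n + 2 from rfl] at r1
    omega

theorem main_zero (I : Ideal (MvPolynomial (Fin 3) K))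
    (hAG : IsArtinianGorenstein I (2 * 0 + 1))
    (h1 : hf I 0 = 1) (h2 : hf I 1 = 1) : WLP I := by
  obtain ⟨ℓ, hl, hlI⟩ : ∃ ℓ : MvPolynomial (Fin 3) K, ℓ.IsHomogeneous 1 ∧ ℓ ∉ I := by
    by_contra! hh
    have f1 := finrank_Ik I 1
    have : Ik I 1 = Rk K 1 := inf_eq_left.2 hh
    rw [this] at f1
    omega
  apply wlp_of_inj hAG h1 h2 ℓ hl
  intro u hu hlu
  rw [← totalDegree_zero_iff_isHomogeneous, totalDegree_eq_zero_iff_eq_C] at hu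
  rw [hu] at hlu ⊢
  by_cases hc : coeff 0 u = 0
  · rw [hc]; simp
  · exfalso
    apply hlI
    have := I.mul_mem_right (C (coeff 0 u)⁻¹) hlu
    rw [mul_assoc, ← C_mul, mul_inv_cancel₀ hc] at this
    simpa using this

end WlpOdd

/-- Any artinian Gorenstein algebra of codimension 3 with socle degree `2m+1` and
h-vector `(1,3,5,…,2m+1,2m+1,…,5,3,1)` satisfies the WLP. -/
theorem wlp_odd_13579 {K : Type*} [Field K] [IsAlgClosed K] [CharZero K] (m : ℕ)
    (I : Ideal (MvPolynomial (Fin 3) K))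
    (hAG : IsArtinianGorenstein I (2 * m + 1))
    (hfirst : ∀ i : ℕ, i ≤ m → hf I i = 2 * i + 1)
    (hsecond : ∀ i : ℕ, m < i → i ≤ 2 * m + 1 → hf I i = 2 * (2 * m + 1 - i) + 1) :
    WLP I := by
  rcases m with _ | n
  · exact WlpOdd.main_zero I hAG (hfirst 0 le_rfl) (hsecond 1 (by omega) (by omega))
  · apply WlpOdd.main_succ n I hAG (hfirst _ le_rfl)
    · rw [hsecond (n + 2) (by omega) (by omega)]
      omega
    · rcases n with _ | n
      · rw [hsecond 2 (by omega) (by omega)]; norm_num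
      · rw [hfirst 2 (by omega)]; norm_num
end

section
/- Any artinian Gorenstein algebra A of codimension 4 with odd socle degree 2m+1 and h-vector (1, 4, 6, 8, 10, ..., 2m, 2m+2, 2m+2, 2m, ..., 10, 8, 6, 4, 1) satisfies the weak Lefschetz property. -/
open MvPolynomial

set_option linter.unusedSectionVars false

namespace WLPaux

lemma coeff_mem {K M : Type*} [Field K] [Infinite K] [AddCommGroup M] [Module K M]
    (W : Submodule K M) (v : ℕ → M) (n : ℕ)
    (h : ∀ c : K, ∑ k ∈ Finset.range n, c ^ k • v k ∈ W) : ∀ k < n, v k ∈ W := by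
  intro k hk
  rw [← Submodule.Quotient.mk_eq_zero, ← Module.forall_dual_apply_eq_zero_iff K]
  intro φ
  set p : Polynomial K := ∑ k ∈ Finset.range n,
    Polynomial.monomial k (φ (Submodule.Quotient.mk (p := W) (v k))) with hp
  have h0 : p = 0 := by
    apply Polynomial.funext
    intro c
    have h1 := (Submodule.Quotient.mk_eq_zero W).2 (h c)
    have h2 : φ (W.mkQ (∑ k ∈ Finset.range n, c ^ k • v k)) = 0 := by
      rw [Submodule.mkQ_apply, h1, map_zero]
    simp only [map_sum, map_smul] at h2
    rw [hp, Polynomial.eval_finsetSum, Polynomial.eval_zero, ← h2]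
    refine Finset.sum_congr rfl fun i _ => ?_
    simp [mul_comm]
  have h3 : p.coeff k = 0 := by rw [h0]; simp
  rw [hp, Polynomial.finsetSum_coeff] at h3
  simpa [Polynomial.coeff_monomial, hk] using h3

lemma filt {K A : Type*} [Field K] [AddCommGroup A] [Module K A] (g : A →ₗ[K] A) (n : ℕ) :
    ∀ (U : Submodule K A) (_ : Module.Finite K U) (V : ℕ → Submodule K A),
    (∀ k < n, V k ≤ U.map (g ^ k)) → (∀ k < n, V k ≤ LinearMap.ker g) →
    ∑ k ∈ Finset.range n, Module.finrank K (V k) ≤ Module.finrank K U := by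
  induction n with
  | zero => intros; simp
  | succ n ih =>
    intro U hU V h1 h2
    rw [Finset.sum_range_succ']
    have hfin : Module.Finite K (U.map g) := inferInstance
    have h3 := ih (U.map g) hfin (fun k => V (k + 1)) (by
      intro k hk
      rw [← Submodule.map_comp]
      have := h1 (k + 1) (by omega)
      rwa [pow_succ] at this) (fun k hk => h2 (k + 1) (by omega))
    have h4 := LinearMap.finrank_range_add_finrank_ker (g.domRestrict U)
    have h5 : LinearMap.range (g.domRestrict U) = U.map g := by
      ext y; simp
    rw [h5] at h4
    have h6 : Module.finrank K (V 0) ≤ Module.finrank K (LinearMap.ker (g.domRestrict U)) := by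
      have h7 : V 0 ≤ (LinearMap.ker (g.domRestrict U)).map U.subtype := by
        intro y hy
        have hyU := h1 0 (by omega) hy
        have hyk := h2 0 (by omega) hy
        simp at hyU hyk
        exact ⟨⟨y, hyU⟩, by simpa using hyk, rfl⟩
      calc _ ≤ _ := Submodule.finrank_mono h7
        _ = _ := Submodule.finrank_map_subtype_eq _ _
    omega

/-- Polynomial functions. -/
def IsPoly {K : Type*} [Field K] (G : (Fin 4 → K) → K) : Prop :=
  ∃ p : MvPolynomial (Fin 4) K, ∀ t, G t = eval t p

lemma IsPoly.mul {K : Type*} [Field K] {G H : (Fin 4 → K) → K} (hG : IsPoly G) (hH : IsPoly H) :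
    IsPoly (fun t => G t * H t) := by
  obtain ⟨p, hp⟩ := hG
  obtain ⟨q, hq⟩ := hH
  exact ⟨p * q, fun t => by simp [hp, hq]⟩

lemma IsPoly.sub {K : Type*} [Field K] {G H : (Fin 4 → K) → K} (hG : IsPoly G) (hH : IsPoly H) :
    IsPoly (fun t => G t - H t) := by
  obtain ⟨p, hp⟩ := hG
  obtain ⟨q, hq⟩ := hH
  exact ⟨p - q, fun t => by simp [hp, hq]⟩

lemma IsPoly.lin {K : Type*} [Field K] (η : (Fin 4 → K) →ₗ[K] K) : IsPoly (fun t => η t) := by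
  refine ⟨∑ i, C (η (Pi.single i 1)) * X i, fun t => ?_⟩
  change η t = _
  conv_lhs => rw [← Finset.univ_sum_single t]
  rw [map_sum, map_sum]
  refine Finset.sum_congr rfl fun i _ => ?_
  have : Pi.single i (t i) = t i • (Pi.single i 1 : Fin 4 → K) := by
    rw [← Pi.single_smul]; simp
  rw [this, map_smul]
  simp [mul_comm]

lemma IsPoly.dense {K : Type*} [Field K] [Infinite K] {G H : (Fin 4 → K) → K}
    (hG : IsPoly G) (hH : IsPoly H) (h1 : ∃ t, G t ≠ 0) (h2 : ∃ t, H t ≠ 0) :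
    ∃ t, G t * H t ≠ 0 := by
  by_contra! hcon
  obtain ⟨p, hp⟩ := hG
  obtain ⟨q, hq⟩ := hH
  have : p * q = 0 := by
    apply MvPolynomial.funext
    intro t
    rw [map_mul, ← hp, ← hq, hcon t, map_zero]
  rcases mul_eq_zero.1 this with h | h
  · obtain ⟨t, ht⟩ := h1
    exact ht (by rw [hp, h, map_zero])
  · obtain ⟨t, ht⟩ := h2
    exact ht (by rw [hq, h, map_zero])

/-- The linear form with given coefficients. -/
noncomputable def lin {K A : Type*} [Field K] [CommRing A] [Algebra K A] (x : Fin 4 → A) :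
    (Fin 4 → K) →ₗ[K] A :=
  Fintype.linearCombination K x

/-- The abstract properties used. -/
structure Good {K A : Type*} [Field K] [CommRing A] [Algebra K A] (P : ℕ → Submodule K A)
    (x : Fin 4 → A) (m : ℕ) : Prop where
  one_mem : (1 : A) ∈ P 0
  zero_le : P 0 ≤ Submodule.span K {(1 : A)}
  mul_mem : ∀ j i a, a ∈ P i → x j * a ∈ P (i + 1)
  step : ∀ i (Q : Submodule K A), (∀ j, ∀ a ∈ P i, x j * a ∈ Q) → P (i + 1) ≤ Q
  nd : ∀ i ≤ 2 * m, ∀ a ∈ P i, (∀ j, x j * a = 0) → a = 0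
  inj : Function.Injective (lin (K := K) x)
  pos : 1 ≤ m
  dim1 : Module.finrank K (P m) = 2 * m + 2
  dim2 : Module.finrank K (P (m + 1)) = 2 * m + 2
  dim3 : Module.finrank K (P (2 * m + 1)) = 1

section
variable {K A : Type*} [Field K] [CharZero K] [CommRing A] [Algebra K A]
  {P : ℕ → Submodule K A} {x : Fin 4 → A} {m : ℕ}

lemma lin_single (j : Fin 4) : lin (K := K) x (Pi.single j 1) = x j := by
  simp [lin]

lemma Good.mulP (h : Good P x m) : ∀ i j a b, a ∈ P i → b ∈ P j → a * b ∈ P (i + j) := by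
  intro i
  induction i with
  | zero =>
    intro j a b ha hb
    obtain ⟨c, rfl⟩ := Submodule.mem_span_singleton.1 (h.zero_le ha)
    simpa using (P j).smul_mem c hb
  | succ i ih =>
    intro j a b ha hb
    have := h.step i ((P (i + 1 + j)).comap (LinearMap.mulRight K b)) (by
      intro k a ha
      simp only [Submodule.mem_comap, LinearMap.mulRight_apply]
      rw [mul_assoc, show i + 1 + j = i + j + 1 by ring]
      exact h.mul_mem _ _ _ (ih j a b ha hb)) ha
    simpa using this

lemma Good.lin_mem (h : Good P x m) (t : Fin 4 → K) : lin x t ∈ P 1 := by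
  rw [lin, Fintype.linearCombination_apply]
  refine Submodule.sum_mem _ fun i _ => Submodule.smul_mem _ _ ?_
  simpa using h.mul_mem i 0 1 h.one_mem

lemma Good.P1_le (h : Good P x m) : P 1 ≤ LinearMap.range (lin (K := K) x) := by
  refine h.step 0 _ fun j a ha => ?_
  obtain ⟨c, rfl⟩ := Submodule.mem_span_singleton.1 (h.zero_le ha)
  exact ⟨c • Pi.single j 1, by rw [map_smul, lin_single]; simp⟩

lemma Good.ndk (h : Good P x m) : ∀ k i a, a ∈ P i → i + k ≤ 2 * m + 1 →
    (∀ b ∈ P k, b * a = 0) → a = 0 := by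
  intro k
  induction k with
  | zero => intro i a _ _ h1; simpa using h1 1 h.one_mem
  | succ k ih =>
    intro i a ha hi h1
    refine ih i a ha (by omega) fun b hb => ?_
    refine h.nd (k + i) (by omega) _ (h.mulP _ _ _ _ hb ha) fun j => ?_
    rw [← mul_assoc]
    exact h1 _ (h.mul_mem _ _ _ hb)

lemma Good.pow_aux (h : Good P x m) (k : ℕ) : ∀ j ≤ k, ∀ b ∈ P j, ∀ t : Fin 4 → K,
    b * lin x t ^ (k - j) ∈ Submodule.span K (Set.range fun t : Fin 4 → K => lin x t ^ k) := by
  intro j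
  induction j with
  | zero =>
    intro _ b hb t
    obtain ⟨c, rfl⟩ := Submodule.mem_span_singleton.1 (h.zero_le hb)
    rw [smul_mul_assoc, one_mul]
    exact Submodule.smul_mem _ _ (Submodule.subset_span ⟨t, rfl⟩)
  | succ j ih =>
    intro hj b hb t
    set Q := Submodule.span K (Set.range fun t : Fin 4 → K => lin x t ^ k) with hQ
    have := h.step j (Q.comap (LinearMap.mulRight K (lin x t ^ (k - (j + 1))))) (by
      intro i a ha
      simp only [Submodule.mem_comap, LinearMap.mulRight_apply]
      obtain ⟨r, hr⟩ : ∃ r, k - j = r + 1 := ⟨k - (j + 1), by omega⟩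
      have hr' : k - (j + 1) = r := by omega
      have h1 : ∀ c : K, ∑ l ∈ Finset.range (k - j + 1), c ^ l •
          (((k - j).choose l : ℕ) • (a * (x i ^ l * lin x t ^ (k - j - l)))) ∈ Q := by
        intro c
        have h2 := ih (by omega) a ha (c • Pi.single i 1 + t)
        rw [map_add, map_smul, lin_single, add_pow, Finset.mul_sum] at h2
        convert h2 using 2 with l _
        rw [smul_pow, nsmul_eq_mul, Algebra.smul_def, Algebra.smul_def]
        ring
      have h3 := coeff_mem Q _ _ h1 1 (by omega)
      rw [hr] at h3
      rw [hr']
      simp only [Nat.choose_one_right, pow_one, Nat.add_sub_cancel] at h3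
      rw [← Nat.cast_smul_eq_nsmul K] at h3
      have h4 := (Submodule.smul_mem_iff Q (by exact_mod_cast Nat.succ_ne_zero r)).1 h3
      convert h4 using 1
      ring) hb
    simpa using this

lemma Good.pow_span (h : Good P x m) (k : ℕ) :
    P k ≤ Submodule.span K (Set.range fun t : Fin 4 → K => lin x t ^ k) := by
  intro b hb
  simpa using h.pow_aux k k le_rfl b hb 0

/-- `P k * f`. -/
def orb (P : ℕ → Submodule K A) (f : A) (k : ℕ) : Submodule K A :=
  (P k).map (LinearMap.mulRight K f)

lemma mem_orb {f : A} {k : ℕ} {b : A} (hb : b ∈ P k) : b * f ∈ orb P f k := ⟨b, hb, rfl⟩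

lemma Good.orb_ne (h : Good P x m) {f : A} (hf : f ∈ P m) (h0 : f ≠ 0) {k : ℕ} (hk : k ≤ m + 1) :
    orb P f k ≠ ⊥ := by
  intro hb
  refine h0 (h.ndk k m f hf (by omega) fun b hbk => ?_)
  have := mem_orb (f := f) hbk
  rwa [hb, Submodule.mem_bot] at this

/-- if `P k f` is one-dimensional, so is `P 1 f`. -/
lemma Good.orb_two (h : Good P x m) {f : A} (hf : f ∈ P m) (h0 : f ≠ 0) {k : ℕ} (hk1 : 1 ≤ k)
    (hk : k ≤ m) (z : A) (hz : orb P f k ≤ Submodule.span K {z}) :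
    ∃ y, orb P f 1 ≤ Submodule.span K {y} := by
  obtain ⟨t, ht⟩ : ∃ t : Fin 4 → K, lin x t ^ k * f ≠ 0 := by
    by_contra! hcon
    refine h.orb_ne hf h0 (show k ≤ m + 1 by omega) ?_
    rw [orb, eq_bot_iff, Submodule.map_le_iff_le_comap]
    refine (h.pow_span k).trans ?_
    rw [Submodule.span_le]
    rintro _ ⟨t, rfl⟩
    simpa using hcon t
  have powP : ∀ k, lin x t ^ k ∈ P k := by
    intro k
    induction k with
    | zero => simpa using h.one_mem
    | succ k ih => rw [pow_succ]; exact h.mulP _ _ _ _ ih (h.lin_mem t)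
  have key : ∀ b ∈ P k, ∃ c : K, b * f = c • (lin x t ^ k * f) := by
    intro b hb
    obtain ⟨c, hc⟩ := Submodule.mem_span_singleton.1 (hz (mem_orb (f := f) (powP k)))
    obtain ⟨d, hd⟩ := Submodule.mem_span_singleton.1 (hz (mem_orb (f := f) hb))
    have hc0 : c ≠ 0 := by rintro rfl; rw [zero_smul] at hc; exact ht hc.symm
    refine ⟨d * c⁻¹, ?_⟩
    rw [← hc, ← hd, smul_smul, mul_assoc, inv_mul_cancel₀ hc0, mul_one]
  refine ⟨lin x t * f, ?_⟩
  rintro _ ⟨a, ha, rfl⟩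
  obtain ⟨r, rfl⟩ : ∃ r, k = r + 1 := ⟨k - 1, by omega⟩
  obtain ⟨c, hc⟩ := key (lin x t ^ r * a) (h.mulP _ _ _ _ (powP r) ha)
  rw [Submodule.mem_span_singleton]
  refine ⟨c, ?_⟩
  simp only [LinearMap.mulRight_apply]
  rw [eq_comm, ← sub_eq_zero]
  have haP : a * f - c • (lin x t * f) ∈ P (1 + m) :=
    Submodule.sub_mem _ (h.mulP _ _ _ _ ha hf)
      (Submodule.smul_mem _ _ (h.mulP _ _ _ _ (h.lin_mem t) hf))
  refine h.ndk (r + 1) (1 + m) _ haP (by omega) fun b hb => ?_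
  obtain ⟨d, hd⟩ := key b hb
  have e1 : b * (a * f - c • (lin x t * f)) = (a - c • lin x t) * (b * f) := by
    simp only [Algebra.smul_def]; ring
  have e2 : (a - c • lin x t) * (lin x t ^ (r + 1) * f) = 0 := by
    have : lin x t * (lin x t ^ r * a * f) = lin x t * c • (lin x t ^ (r + 1) * f) := by rw [hc]
    simp only [Algebra.smul_def] at this ⊢
    linear_combination this
  rw [e1, hd, mul_smul_comm, e2, smul_zero]

lemma poly_dual {ι : Type*} [Fintype ι] {f : (Fin 4 → K) → A} {v : ι → MvPolynomial (Fin 4) K}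
    {b : ι → A} (hf : ∀ t, f t = ∑ a, eval t (v a) • b a) (κ : A →ₗ[K] K) :
    IsPoly (fun t => κ (f t)) := by
  refine ⟨∑ a, C (κ (b a)) * v a, fun t => ?_⟩
  simp [hf, mul_comm]

lemma poly_expand {ι : Type*} [Fintype ι] {f : (Fin 4 → K) → A}
    {v : ι → MvPolynomial (Fin 4) K}
    {b : ι → A} (hf : ∀ t, f t = ∑ a, eval t (v a) • b a) (t y : Fin 4 → K) :
    ∃ (g : ℕ → A) (N : ℕ), (∀ k ≥ N, g k = 0) ∧
      ∀ c : K, f (t + c • y) = ∑ k ∈ Finset.range N, c ^ k • g k := by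
  let q : ι → Polynomial K := fun a =>
    aeval (fun i => Polynomial.C (t i) + Polynomial.X * Polynomial.C (y i)) (v a)
  have hq : ∀ c a, (q a).eval c = eval (t + c • y) (v a) := by
    intro c a
    have : ((Polynomial.evalRingHom c).comp (aeval (R := K) (fun i => Polynomial.C (t i) +
        Polynomial.X * Polynomial.C (y i))).toRingHom) = eval (t + c • y) := by
      apply MvPolynomial.ringHom_ext
      · intro r; simp
      · intro i; simp; ring
    exact congrArg (fun φ => φ (v a)) this
  let N := (Finset.univ.sup fun a => (q a).natDegree) + 1
  have hN : ∀ a, (q a).natDegree < N := fun a =>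
    Nat.lt_succ_of_le (Finset.le_sup (f := fun a => (q a).natDegree) (Finset.mem_univ a))
  refine ⟨fun k => ∑ a, (q a).coeff k • b a, N, ?_, ?_⟩
  · intro k hk
    refine Finset.sum_eq_zero fun a _ => ?_
    rw [Polynomial.coeff_eq_zero_of_natDegree_lt (lt_of_lt_of_le (hN a) hk), zero_smul]
  · intro c
    simp only [Finset.smul_sum]
    rw [hf, Finset.sum_comm]
    refine Finset.sum_congr rfl fun a _ => ?_
    rw [← hq, Polynomial.eval_eq_sum_range' (hN a), Finset.sum_smul]
    refine Finset.sum_congr rfl fun k _ => ?_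
    rw [smul_smul, mul_comm]

/-- The Gordan-Noether type identity. -/
lemma gn {ι : Type*} [Fintype ι] {f : (Fin 4 → K) → A} {v : ι → MvPolynomial (Fin 4) K}
    {b : ι → A} (hf : ∀ t, f t = ∑ a, eval t (v a) • b a)
    (hker : ∀ t, lin x t * f t = 0) (t y : Fin 4 → K) (k : ℕ) :
    ∃ u ∈ Submodule.span K (Set.range f), lin x y ^ k * f t = lin x t ^ k * u := by
  obtain ⟨g, N, hg, hN⟩ := poly_expand hf t y
  set U := Submodule.span K (Set.range f) with hU
  have hgU : ∀ k, g k ∈ U := by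
    intro k
    rcases lt_or_ge k N with hk | hk
    · refine coeff_mem U g N (fun c => ?_) k hk
      rw [← hN c]
      exact Submodule.subset_span ⟨_, rfl⟩
    · rw [hg k hk]; exact U.zero_mem
  have hg0 : g 0 = f t := by
    have h1 := hN 0
    rw [zero_smul, add_zero] at h1
    rcases Nat.eq_zero_or_pos N with hz | hz
    · rw [hg 0 (by omega), h1, hz]; simp
    · rw [h1, Finset.sum_eq_single 0]
      · simp
      · intro i _ hi; simp [hi]
      · intro h; simp at h; omega
  have hrec : ∀ k, lin x y * g k + lin x t * g (k + 1) = 0 := by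
    intro k
    rcases lt_or_ge k N with hk | hk
    · let w : ℕ → A := fun k => lin x t * g k + (if k = 0 then 0 else lin x y * g (k - 1))
      have hw := coeff_mem (⊥ : Submodule K A) w (N + 1) (by
        intro c
        rw [Submodule.mem_bot]
        have e := hker (t + c • y)
        rw [hN c, map_add, map_smul, add_mul, Finset.mul_sum, Finset.mul_sum] at e
        rw [← e]
        simp only [w, smul_add, Finset.sum_add_distrib]
        congr 1
        · rw [Finset.sum_range_succ, hg N le_rfl]
          simp
        · rw [Finset.sum_range_succ']
          simp only [if_true, smul_zero, add_zero, Nat.add_eq_zero_iff, one_ne_zero, and_false,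
            if_false, Nat.add_sub_cancel]
          refine Finset.sum_congr rfl fun i _ => ?_
          simp only [Algebra.smul_def, map_pow]
          ring) (k + 1) (by omega)
      rw [Submodule.mem_bot] at hw
      simp only [w, Nat.add_eq_zero_iff, one_ne_zero, and_false, if_false,
        Nat.add_sub_cancel] at hw
      rw [add_comm]; exact hw
    · rw [hg k hk, hg (k + 1) (by omega)]; simp
  have hmain : ∀ k, lin x y ^ k * g 0 = (-1) ^ k * (lin x t ^ k * g k) := by
    intro k
    induction k with
    | zero => simp
    | succ k ih =>
      linear_combination lin x y * ih + (-1) ^ k * lin x t ^ k * hrec k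
  refine ⟨(-1 : K) ^ k • g k, U.smul_mem _ (hgU k), ?_⟩
  rw [← hg0, hmain]
  simp only [Algebra.smul_def, map_pow, map_neg, map_one]
  ring

lemma Good.orb_le (h : Good P x m) {ι : Type*} [Fintype ι] {f : (Fin 4 → K) → A}
    {v : ι → MvPolynomial (Fin 4) K}
    {b : ι → A} (hf : ∀ t, f t = ∑ a, eval t (v a) • b a)
    (hker : ∀ t, lin x t * f t = 0) (t : Fin 4 → K) (k : ℕ) :
    orb P (f t) k ≤
      (Submodule.span K (Set.range f)).map (LinearMap.mulLeft K (lin x t) ^ k) := by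
  rw [orb, Submodule.map_le_iff_le_comap]
  refine (h.pow_span k).trans ?_
  rw [Submodule.span_le]
  rintro _ ⟨y, rfl⟩
  obtain ⟨u, hu, e⟩ := gn hf hker t y k
  refine ⟨u, hu, ?_⟩
  rw [LinearMap.pow_mulLeft]
  simp [e]

lemma Good.orb_le' (h : Good P x m) {ι : Type*} [Fintype ι] {f : (Fin 4 → K) → A}
    {v : ι → MvPolynomial (Fin 4) K}
    {b : ι → A} (hf : ∀ t, f t = ∑ a, eval t (v a) • b a)
    (hker : ∀ t, lin x t * f t = 0) (t : Fin 4 → K) (k : ℕ) :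
    orb P (f t) (k + 1) ≤
      (P 1 * Submodule.span K (Set.range f)).map (LinearMap.mulLeft K (lin x t) ^ k) := by
  rw [orb, Submodule.map_le_iff_le_comap]
  refine (h.pow_span (k + 1)).trans ?_
  rw [Submodule.span_le]
  rintro _ ⟨y, rfl⟩
  obtain ⟨u, hu, e⟩ := gn hf hker t y k
  refine ⟨lin x y * u, Submodule.mul_mem_mul (h.lin_mem y) hu, ?_⟩
  rw [LinearMap.pow_mulLeft]
  simp only [LinearMap.mulLeft_apply, LinearMap.mulRight_apply]
  linear_combination (- lin x y) * e

lemma orb_ker {f : (Fin 4 → K) → A} (hker : ∀ t, lin x t * f t = 0) (t : Fin 4 → K) (k : ℕ) :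
    orb P (f t) k ≤ LinearMap.ker (LinearMap.mulLeft K (lin x t)) := by
  rintro _ ⟨a, _, rfl⟩
  simp only [LinearMap.mem_ker, LinearMap.mulLeft_apply, LinearMap.mulRight_apply]
  linear_combination a * hker t

lemma line_gen {V : Type*} [AddCommGroup V] [Module K V] {S : Submodule K V}
    [Module.Finite K S] (hS : Module.finrank K S ≤ 1) {a b : V} (ha : a ∈ S) (hb : b ∈ S)
    (h0 : a ≠ 0) : ∃ c : K, b = c • a := by
  obtain ⟨v, hv⟩ := (finrank_le_one_iff (K := K) (V := S)).1 hS
  obtain ⟨c, hc⟩ := hv ⟨a, ha⟩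
  obtain ⟨d, hd⟩ := hv ⟨b, hb⟩
  have hc' : c • (v : V) = a := congrArg Subtype.val hc
  have hd' : d • (v : V) = b := congrArg Subtype.val hd
  have hc0 : c ≠ 0 := by rintro rfl; rw [zero_smul] at hc'; exact h0 hc'.symm
  refine ⟨d * c⁻¹, ?_⟩
  rw [← hc', ← hd', smul_smul, mul_assoc, inv_mul_cancel₀ hc0, mul_one]

lemma exists_dual_ne {V : Type*} [AddCommGroup V] [Module K V] {a : V} (ha : a ≠ 0) :
    ∃ κ : V →ₗ[K] K, κ a ≠ 0 := by
  by_contra! hcon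
  exact ha ((Module.forall_dual_apply_eq_zero_iff K a).1 hcon)

lemma poly_ne {ι : Type*} [Fintype ι] {f : (Fin 4 → K) → A} {v : ι → MvPolynomial (Fin 4) K}
    {b : ι → A} (hf : ∀ t, f t = ∑ a, eval t (v a) • b a) (a : A) (ha : ∃ t, a * f t ≠ 0) :
    ∃ G : (Fin 4 → K) → K, IsPoly G ∧ (∃ t, G t ≠ 0) ∧ ∀ t, G t ≠ 0 → a * f t ≠ 0 := by
  obtain ⟨t, ht⟩ := ha
  obtain ⟨κ, hκ⟩ := exists_dual_ne (K := K) ht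
  refine ⟨_, poly_dual hf (κ ∘ₗ LinearMap.mulLeft K a), ⟨t, hκ⟩, ?_⟩
  intro s hs h0
  exact hs (by simp [h0])

lemma lin_ne {N : Submodule K (Fin 4 → K)} (hN : N < ⊤) :
    ∃ G : (Fin 4 → K) → K, IsPoly G ∧ (∃ t, G t ≠ 0) ∧ ∀ t, G t ≠ 0 → t ∉ N := by
  obtain ⟨η, h0, hη⟩ := Submodule.exists_le_ker_of_lt_top N hN
  refine ⟨_, IsPoly.lin η, ?_, fun t ht htN => ht (hη htN)⟩
  by_contra! hcon
  exact h0 (LinearMap.ext hcon)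

/-- Annihilating linear forms. -/
noncomputable def NN (x : Fin 4 → A) (f : A) : Submodule K (Fin 4 → K) :=
  LinearMap.ker (LinearMap.mulRight K f ∘ₗ lin x)

lemma mem_NN {f : A} {t : Fin 4 → K} : t ∈ NN x f ↔ lin x t * f = 0 := by
  simp [NN]

lemma Good.finrank_NN (h : Good P x m) (f : A) :
    Module.finrank K (orb P f 1) + Module.finrank K (NN (K := K) x f) = 4 := by
  have h1 := LinearMap.finrank_range_add_finrank_ker (LinearMap.mulRight K f ∘ₗ lin (K := K) x)
  have h2 : LinearMap.range (LinearMap.mulRight K f ∘ₗ lin (K := K) x) = orb P f 1 := by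
    rw [LinearMap.range_comp, orb]
    congr 1
    apply le_antisymm _ h.P1_le
    rintro _ ⟨t, rfl⟩
    exact h.lin_mem t
  rw [h2, Module.finrank_fin_fun] at h1
  exact h1

lemma Good.prodzero (h : Good P x m) {f g : A} (hf : f ∈ P m) (hg : g ∈ P m)
    (hN : NN (K := K) x f ⊔ NN x g = ⊤) : f * g = 0 := by
  refine h.nd (m + m) (by omega) _ (h.mulP _ _ _ _ hf hg) fun j => ?_
  have : (Pi.single j 1 : Fin 4 → K) ∈ NN (K := K) x f ⊔ NN x g := by rw [hN]; trivial
  obtain ⟨a, ha, b, hb, hab⟩ := Submodule.mem_sup.1 this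
  rw [mem_NN] at ha hb
  rw [← lin_single (K := K) (x := x) j, ← hab, map_add]
  linear_combination g * ha + f * hb

lemma Good.finP (h : Good P x m) : Module.Finite K (P m) :=
  Module.finite_of_finrank_pos (by rw [h.dim1]; omega)

lemma Good.finP' (h : Good P x m) : Module.Finite K (P (m + 1)) :=
  Module.finite_of_finrank_pos (by rw [h.dim2]; omega)

lemma finite_of_le {S T : Submodule K A} (hT : Module.Finite K T) (hST : S ≤ T) :
    Module.Finite K S :=
  Submodule.finiteDimensional_of_le hST

/-- orthogonality bound -/
lemma Good.pairing (h : Good P x m) {U W : Submodule K A} (hU : U ≤ P m) (hW : W ≤ P (m + 1))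
    (h0 : ∀ u ∈ U, ∀ w ∈ W, u * w = 0) :
    Module.finrank K U + Module.finrank K W ≤ 2 * m + 2 := by
  have := h.finP
  have := h.finP'
  have := finite_of_le h.finP hU
  have hfin : Module.Finite K (P (2 * m + 1)) :=
    Module.finite_of_finrank_pos (by rw [h.dim3]; omega)
  have hne : P (2 * m + 1) ≠ ⊥ := by
    intro hb
    have := h.dim3
    rw [hb] at this
    simp at this
  obtain ⟨z, hz, hz0⟩ := Submodule.exists_mem_ne_zero_of_ne_bot hne
  obtain ⟨θ, hθ⟩ := exists_dual_ne (K := K) hz0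
  have hθi : ∀ a ∈ P (2 * m + 1), θ a = 0 → a = 0 := by
    intro a ha hta
    obtain ⟨c, rfl⟩ := line_gen h.dim3.le hz ha hz0
    rw [map_smul, smul_eq_mul] at hta
    rcases mul_eq_zero.1 hta with hc | hc
    · rw [hc, zero_smul]
    · exact absurd hc hθ
  let B : A →ₗ[K] Module.Dual K (P (m + 1)) :=
    ((LinearMap.mul K A).compr₂ θ).compl₂ (P (m + 1)).subtype
  have hB : ∀ a (b : P (m + 1)), B a b = θ (a * b) := fun a b => rfl
  have hBi : Function.Injective (B.domRestrict U) := by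
    rw [← LinearMap.ker_eq_bot, LinearMap.ker_eq_bot']
    rintro ⟨u, hu⟩ hu0
    rw [LinearMap.domRestrict_apply] at hu0
    have : u = 0 := by
      refine h.ndk (m + 1) m u (hU hu) (by omega) fun b hb => ?_
      refine hθi _ ?_ ?_
      · have := h.mulP _ _ _ _ hb (hU hu)
        rwa [show m + 1 + m = 2 * m + 1 by ring] at this
      · have := congrArg (fun φ => φ ⟨b, hb⟩) hu0
        simp only [hB] at this
        rw [mul_comm]; exact this
    simp [this]
  have h1 := LinearMap.finrank_range_of_inj hBi
  let W' : Submodule K (P (m + 1)) := W.comap (P (m + 1)).subtype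
  have hW' : Module.finrank K W' = Module.finrank K W :=
    (Submodule.comapSubtypeEquivOfLe hW).finrank_eq
  have h2 : LinearMap.range (B.domRestrict U) ≤ W'.dualAnnihilator := by
    rintro _ ⟨⟨u, hu⟩, rfl⟩
    rw [Submodule.mem_dualAnnihilator]
    rintro ⟨w, hw⟩ hw'
    rw [LinearMap.domRestrict_apply, hB]
    rw [h0 u hu w hw', map_zero]
  have h3 := Submodule.finrank_mono h2
  have h4 := Subspace.finrank_add_finrank_dualAnnihilator_eq W'
  rw [h.dim2] at h4
  omega

theorem Good.main (h : Good P x m) {ι : Type*} [Fintype ι] {f : (Fin 4 → K) → A}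
    {v : ι → MvPolynomial (Fin 4) K}
    {b : ι → A} (hf : ∀ t, f t = ∑ a, eval t (v a) • b a)
    (hker : ∀ t, lin x t * f t = 0) (hfP : ∀ t, f t ∈ P m) (hne : ∃ t, f t ≠ 0) : False := by
  have finPm := h.finP
  have finPm' := h.finP'
  have hm := h.pos
  set U := Submodule.span K (Set.range f) with hU
  have hUP : U ≤ P m := by
    rw [hU, Submodule.span_le]
    rintro _ ⟨t, rfl⟩
    exact hfP t
  have finU : Module.Finite K U := finite_of_le finPm hUP
  have hfU : ∀ t, f t ∈ U := fun t => Submodule.subset_span ⟨t, rfl⟩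
  have hUdim : Module.finrank K U ≤ 2 * m + 2 := h.dim1 ▸ Submodule.finrank_mono hUP
  have finOrb : ∀ t k, Module.Finite K (orb P (f t) k) := fun t k =>
    finite_of_le inferInstance (h.orb_le hf hker t k)
  have hsum : ∀ t, ∑ k ∈ Finset.range (m + 2), Module.finrank K (orb P (f t) k) ≤
      Module.finrank K U := fun t =>
    filt _ _ U finU _ (fun k _ => h.orb_le hf hker t k) (fun k _ => orb_ker hker t k)
  have hone : ∀ t, f t ≠ 0 → ∀ k ≤ m + 1, 1 ≤ Module.finrank K (orb P (f t) k) := by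
    intro t ht k hk
    exact Submodule.one_le_finrank_iff.2 (h.orb_ne (hfP t) ht hk)
  have htwo : ∀ t, f t ≠ 0 → 2 ≤ Module.finrank K (orb P (f t) 1) → ∀ k, 1 ≤ k → k ≤ m →
      2 ≤ Module.finrank K (orb P (f t) k) := by
    intro t ht h2 k hk1 hk
    by_contra hcon
    obtain ⟨z, hz⟩ := (finrank_le_one_iff (K := K) (V := orb P (f t) k)).1 (by omega)
    obtain ⟨y, hy⟩ := h.orb_two (hfP t) ht hk1 hk z (by
      intro w hw
      obtain ⟨c, hc⟩ := hz ⟨w, hw⟩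
      exact Submodule.mem_span_singleton.2 ⟨c, congrArg Subtype.val hc⟩)
    have h3 := Submodule.finrank_mono hy
    have h4 := finrank_span_le_card (R := K) ({y} : Set A)
    simp at h4
    omega
  have hbig : ∀ t, f t ≠ 0 → 2 ≤ Module.finrank K (orb P (f t) 1) →
      Module.finrank K (orb P (f t) 1) + 2 * m ≤ Module.finrank K U := by
    intro t ht h2
    have h3 := hsum t
    obtain ⟨r, rfl⟩ : ∃ r, m = r + 1 := ⟨m - 1, by omega⟩
    rw [Finset.sum_range_succ, Finset.sum_range_succ', Finset.sum_range_succ'] at h3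
    have h4 : r * 2 ≤ ∑ k ∈ Finset.range r, Module.finrank K (orb P (f t) (k + 1 + 1)) := by
      have := Finset.card_nsmul_le_sum (Finset.range r)
        (fun k => Module.finrank K (orb P (f t) (k + 1 + 1))) 2 (fun k hk => by
          rw [Finset.mem_range] at hk
          exact htwo t ht h2 _ (by omega) (by omega))
      simpa using this
    have h5 := hone t ht 0 (by omega)
    have h6 := hone t ht (r + 2) (by omega)
    rw [show (0 + 1 : ℕ) = 1 from rfl] at h3
    omega
  have tmem : ∀ t, t ∈ NN x (f t) := fun t => mem_NN.2 (hker t)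
  have hNtop : ∀ t, f t ≠ 0 → NN (K := K) x (f t) < ⊤ := by
    intro t ht
    rw [lt_top_iff_ne_top]
    intro htop
    have h1 := h.finrank_NN (K := K) (f t)
    have h2 := hone t ht 1 (by omega)
    rw [htop, finrank_top, Module.finrank_fin_fun] at h1
    omega
  by_cases hcase : ∃ s, f s ≠ 0 ∧ 2 ≤ Module.finrank K (orb P (f s) 1)
  · obtain ⟨s, hs, hs2⟩ := hcase
    have hUeq : U = P m := by
      refine Submodule.eq_of_le_of_finrank_le hUP ?_
      have := hbig s hs hs2
      have := h.dim1
      omega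
    have hle2 : ∀ t, f t ≠ 0 → Module.finrank K (orb P (f t) 1) ≤ 2 := by
      intro t ht
      by_contra hcon
      have := hbig t ht (by omega)
      omega
    -- nondegeneracy against values of `f`
    have hnd : ∀ i a, a ∈ P i → i + m ≤ 2 * m + 1 → a ≠ 0 → ∃ t, a * f t ≠ 0 := by
      intro i a ha hi h0
      by_contra! hcon
      refine h0 (h.ndk m i a ha hi fun u hu => ?_)
      rw [← hUeq] at hu
      have : U ≤ LinearMap.ker (LinearMap.mulLeft K a) := by
        rw [hU, Submodule.span_le]
        rintro _ ⟨t, rfl⟩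
        simpa using hcon t
      have := this hu
      rw [mul_comm]
      simpa using this
    -- the open condition
    obtain ⟨δ, δpoly, δs, hδ⟩ : ∃ δ : (Fin 4 → K) → K, IsPoly δ ∧ δ s ≠ 0 ∧
        ∀ t, δ t ≠ 0 → f t ≠ 0 ∧ 2 ≤ Module.finrank K (orb P (f t) 1) := by
      obtain ⟨w1, hw1, hw10⟩ := Submodule.exists_mem_ne_zero_of_ne_bot
        (h.orb_ne (hfP s) hs (show 1 ≤ m + 1 by omega))
      obtain ⟨κ₁, hκ₁⟩ := exists_dual_ne (K := K) hw10
      have : ¬ orb P (f s) 1 ≤ Submodule.span K {w1} := by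
        intro hle
        have h3 := Submodule.finrank_mono hle
        have h4 := finrank_span_le_card (R := K) ({w1} : Set A)
        simp at h4
        omega
      obtain ⟨w, hw, hwn⟩ := SetLike.not_le_iff_exists.1 this
      set w2 := w - (κ₁ w * (κ₁ w1)⁻¹) • w1 with hw2
      have hw2m : w2 ∈ orb P (f s) 1 := Submodule.sub_mem _ hw (Submodule.smul_mem _ _ hw1)
      have hw20 : w2 ≠ 0 := by
        intro h0
        exact hwn (Submodule.mem_span_singleton.2 ⟨_, (sub_eq_zero.1 h0).symm⟩)
      have hκw2 : κ₁ w2 = 0 := by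
        rw [hw2, map_sub, map_smul, smul_eq_mul]
        field_simp
        simp
      obtain ⟨κ₂, hκ₂⟩ := exists_dual_ne (K := K) hw20
      obtain ⟨a1, ha1, ea1⟩ := hw1
      obtain ⟨a2, ha2, ea2⟩ := hw2m
      rw [LinearMap.mulRight_apply] at ea1 ea2
      refine ⟨fun t => κ₁ (a1 * f t) * κ₂ (a2 * f t) - κ₁ (a2 * f t) * κ₂ (a1 * f t),
        ((poly_dual hf (κ₁ ∘ₗ LinearMap.mulLeft K a1)).mul
          (poly_dual hf (κ₂ ∘ₗ LinearMap.mulLeft K a2))).sub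
        ((poly_dual hf (κ₁ ∘ₗ LinearMap.mulLeft K a2)).mul
          (poly_dual hf (κ₂ ∘ₗ LinearMap.mulLeft K a1))), ?_, ?_⟩
      · simp only [ea1, ea2, hκw2, zero_mul, sub_zero]
        exact mul_ne_zero hκ₁ hκ₂
      · intro t ht
        constructor
        · intro h0
          simp [h0] at ht
        · by_contra hcon
          apply ht
          obtain ⟨z, hz⟩ := (finrank_le_one_iff (K := K) (V := orb P (f t) 1)).1 (by omega)
          obtain ⟨c1, hc1⟩ := hz ⟨_, mem_orb (f := f t) ha1⟩
          obtain ⟨c2, hc2⟩ := hz ⟨_, mem_orb (f := f t) ha2⟩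
          have e1 : c1 • (z : A) = a1 * f t := congrArg Subtype.val hc1
          have e2 : c2 • (z : A) = a2 * f t := congrArg Subtype.val hc2
          simp only [← e1, ← e2, map_smul, smul_eq_mul]
          ring
    have hN2 : ∀ t, δ t ≠ 0 → Module.finrank K (NN (K := K) x (f t)) = 2 := by
      intro t ht
      obtain ⟨h1, h2⟩ := hδ t ht
      have h3 := hle2 t h1
      have h4 := h.finrank_NN (K := K) (f t)
      omega
    have hmeet : ∀ r t, δ r ≠ 0 → δ t ≠ 0 → f r * f t ≠ 0 →
        NN (K := K) x (f r) ⊔ NN x (f t) < ⊤ ∧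
        1 ≤ Module.finrank K (NN (K := K) x (f r) ⊓ NN x (f t) : Submodule K (Fin 4 → K)) := by
      intro r t hr ht hrt
      have h1 : NN (K := K) x (f r) ⊔ NN x (f t) < ⊤ := by
        rw [lt_top_iff_ne_top]
        exact fun htop => hrt (h.prodzero (hfP r) (hfP t) htop)
      refine ⟨h1, ?_⟩
      have h2 := Submodule.finrank_lt h1.ne
      have h3 := Submodule.finrank_sup_add_finrank_inf_eq (NN (K := K) x (f r)) (NN x (f t))
      rw [hN2 r hr, hN2 t ht] at h3
      simp at h2
      omega
    obtain ⟨G1, G1p, G1n, hG1⟩ := poly_ne hf (f s) (hnd m (f s) (hfP s) (by omega) hs)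
    obtain ⟨G2, G2p, G2n, hG2⟩ := lin_ne (hNtop s hs)
    obtain ⟨t, ht⟩ := (δpoly.mul G1p).dense G2p (δpoly.dense G1p ⟨s, δs⟩ G1n) G2n
    have δt : δ t ≠ 0 := fun h0 => ht (by simp [h0])
    have hst : f s * f t ≠ 0 := hG1 t fun h0 => ht (by simp [h0])
    have htN : t ∉ NN x (f s) := hG2 t fun h0 => ht (by simp [h0])
    obtain ⟨hM, hI⟩ := hmeet s t δs δt hst
    set S := NN (K := K) x (f s) with hS
    set T := NN (K := K) x (f t) with hT
    have hI1 : Module.finrank K (S ⊓ T : Submodule K (Fin 4 → K)) ≤ 1 := by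
      have hlt : S ⊓ T < T := by
        refine lt_of_le_of_ne inf_le_right fun heq => htN ?_
        exact (inf_eq_right.1 heq) (tmem t)
      have := Submodule.finrank_lt_finrank_of_lt hlt
      have h9 : Module.finrank K T = 2 := hN2 t δt
      omega
    obtain ⟨p, hp, hp0⟩ := Submodule.exists_mem_ne_zero_of_ne_bot
      (Submodule.one_le_finrank_iff.1 hI)
    obtain ⟨G3, G3p, G3n, hG3⟩ := poly_ne hf (f t) (hnd m (f t) (hfP t) (by omega) (hδ t δt).1)
    obtain ⟨G4, G4p, G4n, hG4⟩ := lin_ne hM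
    have hlp : lin x p ≠ 0 := fun h0 => hp0 (h.inj (by rw [h0, map_zero]))
    obtain ⟨G5, G5p, G5n, hG5⟩ := poly_ne hf (lin x p)
      (hnd 1 _ (h.lin_mem p) (by omega) hlp)
    obtain ⟨r, hr⟩ := (((δpoly.mul G1p).mul G3p).mul G4p).dense G5p
      (((δpoly.mul G1p).mul G3p).dense G4p
        ((δpoly.mul G1p).dense G3p (δpoly.dense G1p ⟨s, δs⟩ G1n) G3n) G4n) G5n
    have δr : δ r ≠ 0 := fun h0 => hr (by simp [h0])
    have hsr : f s * f r ≠ 0 := hG1 r fun h0 => hr (by simp [h0])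
    have htr : f t * f r ≠ 0 := hG3 r fun h0 => hr (by simp [h0])
    have hrM : r ∉ S ⊔ T := hG4 r fun h0 => hr (by simp [h0])
    have hpr : lin x p * f r ≠ 0 := hG5 r fun h0 => hr (by simp [h0])
    apply hpr
    rw [← mem_NN]
    obtain ⟨-, hI2⟩ := hmeet s r δs δr hsr
    obtain ⟨-, hI3⟩ := hmeet t r δt δr htr
    obtain ⟨a, ha, ha0⟩ := Submodule.exists_mem_ne_zero_of_ne_bot
      (Submodule.one_le_finrank_iff.1 hI2)
    obtain ⟨b', hb, hb0⟩ := Submodule.exists_mem_ne_zero_of_ne_bot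
      (Submodule.one_le_finrank_iff.1 hI3)
    have hJ : Module.finrank K
        ((S ⊔ T) ⊓ NN (K := K) x (f r) : Submodule K (Fin 4 → K)) ≤ 1 := by
      have hlt : (S ⊔ T) ⊓ NN (K := K) x (f r) < NN x (f r) := by
        refine lt_of_le_of_ne inf_le_right fun heq => hrM ?_
        exact (inf_eq_right.1 heq) (tmem r)
      have := Submodule.finrank_lt_finrank_of_lt hlt
      have := hN2 r δr
      omega
    obtain ⟨c, hc⟩ := line_gen hJ (a := a) (b := b')
      ⟨Submodule.mem_sup_left ha.1, ha.2⟩ ⟨Submodule.mem_sup_right hb.1, hb.2⟩ ha0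
    have hbS : b' ∈ S ⊓ T := ⟨by rw [hc]; exact S.smul_mem _ ha.1, hb.1⟩
    obtain ⟨d, hd⟩ := line_gen hI1 hbS hp hb0
    rw [hd]
    exact Submodule.smul_mem _ _ hb.2
  · push Not at hcase
    have hN3 : ∀ t, f t ≠ 0 → 3 ≤ Module.finrank K (NN (K := K) x (f t)) := by
      intro t ht
      have h1 := hcase t ht
      have h4 := h.finrank_NN (K := K) (f t)
      omega
    have hzero : ∀ s t, f s * f t = 0 := by
      intro s
      by_contra! hcon
      have hs : f s ≠ 0 := by
        obtain ⟨t, ht⟩ := hcon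
        exact fun h0 => ht (by simp [h0])
      obtain ⟨G1, G1p, G1n, hG1⟩ := poly_ne hf (f s) hcon
      obtain ⟨G2, G2p, G2n, hG2⟩ := lin_ne (hNtop s hs)
      obtain ⟨t, ht⟩ := G1p.dense G2p G1n G2n
      have hst : f s * f t ≠ 0 := hG1 t fun h0 => ht (by simp [h0])
      have htN : t ∉ NN x (f s) := hG2 t fun h0 => ht (by simp [h0])
      refine hst (h.prodzero (K := K) (hfP s) (hfP t) ?_)
      have hlt : NN (K := K) x (f s) < NN x (f s) ⊔ NN x (f t) := by
        refine lt_of_le_of_ne le_sup_left fun heq => htN ?_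
        rw [heq]
        exact Submodule.mem_sup_right (tmem t)
      have h1 := Submodule.finrank_lt_finrank_of_lt hlt
      have h2 := hN3 s hs
      refine Submodule.eq_top_of_finrank_eq (le_antisymm (Submodule.finrank_le _) ?_)
      simp
      omega
    obtain ⟨t, ht⟩ := hne
    have hWP : P 1 * U ≤ P (m + 1) := by
      rw [Submodule.mul_le]
      intro a ha u hu
      have := h.mulP _ _ _ _ ha (hUP hu)
      rwa [add_comm] at this
    have hWsum : ∑ k ∈ Finset.range (m + 1), Module.finrank K (orb P (f t) (k + 1)) ≤
        Module.finrank K (P 1 * U : Submodule K A) :=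
      filt _ _ _ (finite_of_le finPm' hWP) (fun k => orb P (f t) (k + 1))
        (fun k _ => h.orb_le' hf hker t k) (fun k _ => orb_ker hker t (k + 1))
    have h1 : m + 1 ≤ ∑ k ∈ Finset.range (m + 1), Module.finrank K (orb P (f t) (k + 1)) := by
      have := Finset.card_nsmul_le_sum (Finset.range (m + 1))
        (fun k => Module.finrank K (orb P (f t) (k + 1))) 1 (fun k hk => by
          rw [Finset.mem_range] at hk
          exact hone t ht _ (by omega))
      simpa using this
    have h2 : m + 2 ≤ ∑ k ∈ Finset.range (m + 2), Module.finrank K (orb P (f t) k) := by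
      have := Finset.card_nsmul_le_sum (Finset.range (m + 2))
        (fun k => Module.finrank K (orb P (f t) k)) 1 (fun k hk => by
          rw [Finset.mem_range] at hk
          exact hone t ht _ (by omega))
      simpa using this
    have hUU : ∀ u ∈ U, ∀ u' ∈ U, u * u' = 0 := by
      have h3 : ∀ s, ∀ u ∈ U, f s * u = 0 := by
        intro s u hu
        have : U ≤ LinearMap.ker (LinearMap.mulLeft K (f s)) := by
          rw [hU, Submodule.span_le]
          rintro _ ⟨t, rfl⟩
          simpa using hzero s t
        simpa using this hu
      intro u hu u' hu'
      have : U ≤ LinearMap.ker (LinearMap.mulRight K u') := by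
        rw [hU, Submodule.span_le]
        rintro _ ⟨t, rfl⟩
        simpa using h3 t u' hu'
      simpa using this hu
    have h4 := h.pairing hUP hWP (by
      intro u hu w hw
      have : P 1 * U ≤ LinearMap.ker (LinearMap.mulLeft K u) := by
        rw [Submodule.mul_le]
        intro a _ u' hu'
        simp only [LinearMap.mem_ker, LinearMap.mulLeft_apply]
        linear_combination a * hUU u hu u' hu'
      simpa using this hw)
    have h5 := hsum t
    omega

lemma Good.exists_inj (h : Good P x m) :
    ∃ t : Fin 4 → K, ∀ a ∈ P m, lin x t * a = 0 → a = 0 := by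
  classical
  by_contra! hcon
  haveI := h.finP
  haveI := h.finP'
  let b := Module.finBasisOfFinrankEq K (P m) h.dim1
  let b' := Module.finBasisOfFinrankEq K (P (m + 1)) h.dim2
  let y : Fin 4 → Fin (2 * m + 2) → P (m + 1) := fun k j =>
    ⟨x k * (b j : A), h.mul_mem k m _ (b j).2⟩
  let M : Matrix (Fin (2 * m + 2)) (Fin (2 * m + 2)) (MvPolynomial (Fin 4) K) :=
    Matrix.of fun i j => ∑ k, X k * C (b'.repr (y k j) i)
  have key : ∀ (t : Fin 4 → K) (w : Fin (2 * m + 2) → K),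
      (∀ i, ∑ j, eval t (M i j) * w j = 0) ↔ lin x t * ∑ j, w j • (b j : A) = 0 := by
    intro t w
    let z : P (m + 1) := ∑ j, ∑ k, (t k * w j) • y k j
    have hz : (z : A) = lin x t * ∑ j, w j • (b j : A) := by
      simp only [z, y, lin, Fintype.linearCombination_apply, Submodule.coe_sum,
        Submodule.coe_smul, Finset.mul_sum, Finset.sum_mul]
      refine Finset.sum_congr rfl fun j _ => Finset.sum_congr rfl fun k _ => ?_
      rw [smul_mul_smul_comm]
    have hr : ∀ i, b'.repr z i = ∑ j, eval t (M i j) * w j := by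
      intro i
      simp only [z, M, map_sum, map_smul, Finsupp.coe_finsetSum, Finset.sum_apply,
        Finsupp.smul_apply, Matrix.of_apply, map_mul, eval_X, eval_C, Finset.sum_mul, smul_eq_mul]
      refine Finset.sum_congr rfl fun j _ => Finset.sum_congr rfl fun k _ => ?_
      ring
    rw [← hz]
    simp only [← hr]
    rw [Submodule.coe_eq_zero]
    constructor
    · intro h1
      apply b'.repr.map_eq_zero_iff.1
      ext i
      exact h1 i
    · intro h1 i
      rw [h1]; simp
  have hdet : M.det = 0 := by
    apply MvPolynomial.funext
    intro t
    rw [map_zero, RingHom.map_det]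
    apply Matrix.exists_mulVec_eq_zero_iff.1
    obtain ⟨a, ha, h1, h2⟩ := hcon t
    have hs : ∑ j, (b.repr ⟨a, ha⟩ j) • (b j : A) = a := by
      have := congrArg (Subtype.val) (b.sum_repr ⟨a, ha⟩)
      simpa only [Submodule.coe_sum, Submodule.coe_smul] using this
    refine ⟨fun j => b.repr ⟨a, ha⟩ j, ?_, ?_⟩
    · intro h3
      apply h2
      rw [← hs]
      exact Finset.sum_eq_zero fun j _ => by rw [show b.repr ⟨a, ha⟩ j = 0 from congrFun h3 j, zero_smul]
    · funext i
      exact (key t _).2 (by rw [hs]; exact h1) i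
  obtain ⟨v, hv, hMv⟩ := Matrix.exists_mulVec_eq_zero_iff.2 hdet
  refine h.main (f := fun t => ∑ a, eval t (v a) • (b a : A)) (v := v) (b := fun a => (b a : A))
    (fun t => rfl) ?_ ?_ ?_
  · intro t
    refine (key t _).1 fun i => ?_
    have := congrArg (eval t) (congrFun hMv i)
    simpa [Matrix.mulVec, dotProduct] using this
  · intro t
    exact Submodule.sum_mem _ fun a _ => Submodule.smul_mem _ _ (b a).2
  · by_contra! h0
    apply hv
    funext a
    apply MvPolynomial.funext
    intro t
    have h1 : ∑ a, eval t (v a) • b a = 0 := by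
      apply Subtype.ext
      simpa using h0 t
    have := Fintype.linearIndependent_iff.1 b.linearIndependent _ h1 a
    simpa using this

lemma Good.inj_low (h : Good P x m) {t : Fin 4 → K}
    (ht : ∀ a ∈ P m, lin x t * a = 0 → a = 0) :
    ∀ k i, i + k = m → ∀ a ∈ P i, lin x t * a = 0 → a = 0 := by
  intro k
  induction k with
  | zero => intro i hi; obtain rfl : i = m := by omega
            exact ht
  | succ k ih =>
    intro i hi a ha h0
    refine h.nd i (by omega) a ha fun j => ih (i + 1) (by omega) _ (h.mul_mem j i a ha) ?_
    linear_combination x j * h0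

lemma Good.surj_high (h : Good P x m) {t : Fin 4 → K}
    (ht : ∀ a ∈ P m, lin x t * a = 0 → a = 0) :
    ∀ k, ∀ b ∈ P (m + k + 1), ∃ a ∈ P (m + k), lin x t * a = b := by
  intro k
  induction k with
  | zero =>
    haveI := h.finP
    haveI := h.finP'
    let g : P m →ₗ[K] P (m + 1) := (LinearMap.mulLeft K (lin x t)).restrict fun a ha => by
      rw [LinearMap.mulLeft_apply, mul_comm]
      exact h.mulP _ _ _ _ ha (h.lin_mem t)
    have hg : Function.Injective g := by
      rw [injective_iff_map_eq_zero]
      intro a ha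
      exact Subtype.ext (ht a a.2 (congrArg Subtype.val ha))
    have hs := (LinearMap.injective_iff_surjective_of_finrank_eq_finrank
      (h.dim1.trans h.dim2.symm)).1 hg
    intro b hb
    obtain ⟨a, ha⟩ := hs ⟨b, hb⟩
    exact ⟨a, a.2, congrArg Subtype.val ha⟩
  | succ k ih =>
    intro b hb
    have := h.step (m + k + 1) ((P (m + k + 1)).map (LinearMap.mulLeft K (lin x t)))
      (fun j a ha => by
        obtain ⟨c, hc, rfl⟩ := ih a ha
        exact ⟨x j * c, h.mul_mem j _ c hc, by rw [LinearMap.mulLeft_apply]; ring⟩) hb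
    obtain ⟨a, ha, hab⟩ := this
    exact ⟨a, ha, hab⟩

end

section
variable {K : Type*} [Field K] [CharZero K] {I : Ideal (MvPolynomial (Fin 4) K)}

lemma mem_piece {i : ℕ} {a : MvPolynomial (Fin 4) K ⧸ I} :
    a ∈ piece I i ↔ ∃ p : MvPolynomial (Fin 4) K, p.IsHomogeneous i ∧
      Ideal.Quotient.mk I p = a := Iff.rfl

lemma lin_mk (t : Fin 4 → K) :
    lin (fun j => Ideal.Quotient.mk I (X j)) t = Ideal.Quotient.mk I (∑ j, C (t j) * X j) := by
  rw [lin, Fintype.linearCombination_apply, map_sum]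
  refine Finset.sum_congr rfl fun j _ => ?_
  rw [map_mul, Algebra.smul_def]
  rfl

lemma piece_step (i : ℕ) (Q : Submodule K (MvPolynomial (Fin 4) K ⧸ I))
    (hQ : ∀ j, ∀ a ∈ piece I i, Ideal.Quotient.mk I (X j) * a ∈ Q) : piece I (i + 1) ≤ Q := by
  intro a ha
  obtain ⟨p, hp, rfl⟩ := mem_piece.1 ha
  rw [p.as_sum, map_sum]
  refine Submodule.sum_mem _ fun d hd => ?_
  have hdeg : d.degree = i + 1 := by
    have := hp (mem_support_iff.1 hd)
    rw [← this, Finsupp.degree_eq_weight_one]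
    rfl
  have hd0 : d ≠ 0 := by
    rintro rfl
    simp at hdeg
  obtain ⟨j, hj⟩ := Finsupp.ne_iff.1 hd0
  have e : Finsupp.single j 1 + (d - Finsupp.single j 1) = d := by
    apply add_tsub_cancel_of_le
    rw [Finsupp.single_le_iff]
    exact Nat.one_le_iff_ne_zero.2 hj
  have e2 : monomial d (coeff d p) = X j * monomial (d - Finsupp.single j 1) (coeff d p) := by
    rw [X, monomial_mul, e, one_mul]
  rw [e2, map_mul]
  refine hQ j _ (mem_piece.2 ⟨_, ?_, rfl⟩)
  apply isHomogeneous_monomial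
  have := congrArg Finsupp.degree e
  rw [map_add, hdeg, Finsupp.degree_single] at this
  omega

lemma piece_disj (hI : IsHomogIdeal I) {i d : ℕ} (hid : i ≠ d) {a : MvPolynomial (Fin 4) K ⧸ I}
    (hi : a ∈ piece I i) (hd : a ∈ piece I d) : a = 0 := by
  obtain ⟨p, hp, rfl⟩ := mem_piece.1 hi
  obtain ⟨q, hq, hpq⟩ := mem_piece.1 hd
  have h1 := hI _ (Ideal.Quotient.eq.1 hpq) i
  rw [map_sub, homogeneousComponent_of_mem hp, homogeneousComponent_of_mem hq, if_neg hid,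
    if_pos rfl, zero_sub] at h1
  exact Ideal.Quotient.eq_zero_iff_mem.2 (neg_mem_iff.1 h1)

lemma good_piece (m : ℕ) (hAG : IsArtinianGorenstein I (2 * m + 1)) (h1 : hf I 1 = 4)
    (hfirst : ∀ i : ℕ, 2 ≤ i → i ≤ m → hf I i = 2 * i + 2)
    (hmid : hf I (m + 1) = 2 * m + 2) :
    Good (piece I) (fun j => Ideal.Quotient.mk I (X j)) m := by
  obtain ⟨hI, hd, -, -, -, hsoc⟩ := hAG
  have pos : 1 ≤ m := by
    rcases Nat.eq_zero_or_pos m with rfl | h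
    · rw [zero_add, h1] at hmid; omega
    · exact h
  have hone : (1 : MvPolynomial (Fin 4) K ⧸ I) ∈ piece I 0 :=
    mem_piece.2 ⟨1, isHomogeneous_one _ _, map_one _⟩
  have hzero : piece I 0 ≤ Submodule.span K {(1 : MvPolynomial (Fin 4) K ⧸ I)} := by
    intro a ha
    obtain ⟨p, hp, rfl⟩ := mem_piece.1 ha
    rw [Submodule.mem_span_singleton]
    refine ⟨coeff 0 p, ?_⟩
    have hp2 := totalDegree_eq_zero_iff_eq_C.1 (Nat.le_zero.1 hp.totalDegree_le)
    conv_rhs => rw [hp2]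
    exact (Algebra.algebraMap_eq_smul_one (A := MvPolynomial (Fin 4) K ⧸ I) (coeff 0 p)).symm
  have hmul : ∀ (j : Fin 4) i a, a ∈ piece I i →
      Ideal.Quotient.mk I (X j) * a ∈ piece I (i + 1) := by
    intro j i a ha
    obtain ⟨p, hp, rfl⟩ := mem_piece.1 ha
    refine mem_piece.2 ⟨X j * p, ?_, map_mul _ _ _⟩
    rw [add_comm]
    exact (isHomogeneous_X K j).mul hp
  refine ⟨hone, hzero, hmul, piece_step, ?_, ?_, pos, ?_, hmid, hd⟩
  · intro i hi a ha h0
    refine piece_disj hI (show i ≠ 2 * m + 1 by omega) ha (hsoc ?_)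
    rw [socle, Submodule.mem_iInf]
    exact h0
  · have hle : piece I 1 ≤ LinearMap.range (lin (K := K) fun j => Ideal.Quotient.mk I (X j)) := by
      refine piece_step 0 _ fun j a ha => ?_
      obtain ⟨c, rfl⟩ := Submodule.mem_span_singleton.1 (hzero ha)
      exact ⟨c • Pi.single j 1, by rw [map_smul, lin_single]; simp⟩
    have h4 := Submodule.finrank_mono hle
    change Module.finrank K (piece I 1) = 4 at h1
    rw [h1] at h4
    have h5 := LinearMap.finrank_range_add_finrank_ker
      (lin (K := K) fun j => Ideal.Quotient.mk I (X j))
    rw [Module.finrank_fin_fun] at h5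
    rw [← LinearMap.ker_eq_bot]
    apply Submodule.finrank_eq_zero.1
    omega
  · rcases Nat.lt_or_ge m 2 with h2 | h2
    · obtain rfl : m = 1 := by omega
      exact h1
    · exact hfirst m h2 le_rfl

lemma wlp_of_good {m : ℕ} (h : Good (piece I) (fun j => Ideal.Quotient.mk I (X j)) m) :
    WLP I := by
  obtain ⟨t, ht⟩ := h.exists_inj
  refine ⟨∑ j, C (t j) * X j, ?_, ?_⟩
  · refine IsHomogeneous.sum _ _ _ fun j _ => ?_
    simpa using (isHomogeneous_C (Fin 4) (t j)).mul (isHomogeneous_X K j)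
  · intro i
    rw [← lin_mk]
    rcases le_total i m with hi | hi
    · left
      exact h.inj_low ht (m - i) i (by omega)
    · right
      obtain ⟨k, rfl⟩ := Nat.exists_eq_add_of_le hi
      exact h.surj_high ht k

end

end WLPaux

/-- Any artinian Gorenstein algebra of codimension 4 with socle degree `2m+1` and
h-vector `(1,4,6,8,…,2m,2m+2,2m+2,2m,…,8,6,4,1)` satisfies the WLP. -/
theorem wlp_odd_1468 {K : Type*} [Field K] [IsAlgClosed K] [CharZero K] (m : ℕ)
    (I : Ideal (MvPolynomial (Fin 4) K))
    (hAG : IsArtinianGorenstein I (2 * m + 1))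
    (h0 : hf I 0 = 1) (h1 : hf I 1 = 4)
    (hfirst : ∀ i : ℕ, 2 ≤ i → i ≤ m → hf I i = 2 * i + 2)
    (hmid : hf I (m + 1) = 2 * m + 2)
    (hsecond : ∀ i : ℕ, m + 1 ≤ i → i ≤ 2 * m + 1 → hf I i = hf I (2 * m + 1 - i)) :
    WLP I := by
  exact WLPaux.wlp_of_good (WLPaux.good_piece m hAG h1 hfirst hmid)
end
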